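/- Sharpness of the hypothesis on b (constant ε not allowed): Let min(q, l) > 1 and let b > 0, k > 0 be constants with k ≤ |Ω|⁻¹ (b/λ₁)^{(l−1)/(q−1)}. Take a(x,t) ≡ 0, b(x,t) = b exp[λ₁(q−1)t] and k(x,y,t) = k exp[λ₁(l−1)t]. Then the function ū(x,t) = (λ₁/b)^{1/(q−1)} e^{−λ₁ t} is a supersolution of problem (P) in Q_T for every T > 0 whenever u₀(x) ≤ (λ₁/b)^{1/(q−1)}; consequently problem (P) with these coefficients has global solutions for such initial data. -/

import Mathlib

open Set MeasureTheory Real Filter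

noncomputable section

/-- The Laplacian of `f : ℝⁿ → ℝ`, written as the sum of second directional
derivatives along the coordinate directions. -/
def lap {n : ℕ} (f : EuclideanSpace ℝ (Fin n) → ℝ) (x : EuclideanSpace ℝ (Fin n)) : ℝ :=
  ∑ i : Fin n,
    fderiv ℝ (fun y => fderiv ℝ f y (EuclideanSpace.single i 1)) x (EuclideanSpace.single i 1)

/-- Local Hölder continuity on `closure Ω × [0,∞)` (with exponent `α ∈ (0,1)`). -/
def LocHolder {n : ℕ} (Ω : Set (EuclideanSpace ℝ (Fin n)))
    (f : EuclideanSpace ℝ (Fin n) → ℝ → ℝ) : Prop :=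
  ∃ α : ℝ, 0 < α ∧ α < 1 ∧ ∀ M : ℝ, 0 < M → ∃ C : ℝ,
    ∀ x ∈ closure Ω, ∀ y ∈ closure Ω, ∀ s ∈ Icc (0:ℝ) M, ∀ t ∈ Icc (0:ℝ) M,
      |f x s - f y t| ≤ C * (dist x y + |s - t|) ^ α

/-- Structural hypotheses on the domain `Ω` and the coefficients `a`, `b`, `k`
of problem (P): `Ω` is a nonempty bounded open set, `a, b` are nonnegative and locally
Hölder continuous on `closure Ω × [0,∞)`, and `k` is nonnegative and continuous on
`∂Ω × closure Ω × [0,∞)`. -/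
def GoodData {n : ℕ} (Ω : Set (EuclideanSpace ℝ (Fin n)))
    (a b : EuclideanSpace ℝ (Fin n) → ℝ → ℝ)
    (k : EuclideanSpace ℝ (Fin n) → EuclideanSpace ℝ (Fin n) → ℝ → ℝ) : Prop :=
  IsOpen Ω ∧ Bornology.IsBounded Ω ∧ Ω.Nonempty ∧
  LocHolder Ω a ∧ LocHolder Ω b ∧
  (∀ x ∈ closure Ω, ∀ t : ℝ, 0 ≤ t → 0 ≤ a x t ∧ 0 ≤ b x t) ∧
  ContinuousOn (fun z : (EuclideanSpace ℝ (Fin n) × EuclideanSpace ℝ (Fin n)) × ℝ =>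
      k z.1.1 z.1.2 z.2) ((frontier Ω ×ˢ closure Ω) ×ˢ Ici 0) ∧
  (∀ x ∈ frontier Ω, ∀ y ∈ closure Ω, ∀ t : ℝ, 0 ≤ t → 0 ≤ k x y t)

/-- Admissible initial datum for problem (P): nonnegative, continuous on `closure Ω`,
and compatible with the nonlocal boundary condition at `t = 0`. -/
def GoodInit {n : ℕ} (Ω : Set (EuclideanSpace ℝ (Fin n)))
    (k : EuclideanSpace ℝ (Fin n) → EuclideanSpace ℝ (Fin n) → ℝ → ℝ) (l : ℝ)
    (u0 : EuclideanSpace ℝ (Fin n) → ℝ) : Prop :=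
  ContinuousOn u0 (closure Ω) ∧ (∀ x ∈ closure Ω, 0 ≤ u0 x) ∧
  ∀ x ∈ frontier Ω, u0 x = ∫ y in Ω, k x y 0 * u0 y ^ l

/-- Regularity required of sub/supersolutions in `Q_T`: continuity on
`Q_T ∪ Γ_T = closure Ω × [0,T)`, `C²` in space and differentiability in time inside `Q_T`. -/
def RegQ {n : ℕ} (Ω : Set (EuclideanSpace ℝ (Fin n))) (T : ℝ)
    (u : EuclideanSpace ℝ (Fin n) → ℝ → ℝ) : Prop :=
  ContinuousOn (fun z : EuclideanSpace ℝ (Fin n) × ℝ => u z.1 z.2) (closure Ω ×ˢ Ico 0 T) ∧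
  (∀ t ∈ Ioo (0:ℝ) T, ContDiffOn ℝ 2 (fun x => u x t) Ω) ∧
  (∀ x ∈ Ω, ∀ t ∈ Ioo (0:ℝ) T, DifferentiableAt ℝ (u x) t)

/-- `u` is a supersolution of problem (P) in `Q_T`. -/
def IsSuperSol {n : ℕ} (r p q l : ℝ) (Ω : Set (EuclideanSpace ℝ (Fin n)))
    (a b : EuclideanSpace ℝ (Fin n) → ℝ → ℝ)
    (k : EuclideanSpace ℝ (Fin n) → EuclideanSpace ℝ (Fin n) → ℝ → ℝ)
    (u0 : EuclideanSpace ℝ (Fin n) → ℝ) (T : ℝ)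
    (u : EuclideanSpace ℝ (Fin n) → ℝ → ℝ) : Prop :=
  RegQ Ω T u ∧ (∀ x ∈ closure Ω, ∀ t ∈ Ico (0:ℝ) T, 0 ≤ u x t) ∧
  (∀ x ∈ Ω, ∀ t ∈ Ioo (0:ℝ) T,
    deriv (u x) t ≥ lap (fun y => u y t) x
      + a x t * u x t ^ r * (∫ y in Ω, u y t ^ p) - b x t * u x t ^ q) ∧
  (∀ x ∈ frontier Ω, ∀ t ∈ Ioo (0:ℝ) T, u x t ≥ ∫ y in Ω, k x y t * u y t ^ l) ∧
  (∀ x ∈ Ω, u x 0 ≥ u0 x)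

/-- `u` is a subsolution of problem (P) in `Q_T`. -/
def IsSubSol {n : ℕ} (r p q l : ℝ) (Ω : Set (EuclideanSpace ℝ (Fin n)))
    (a b : EuclideanSpace ℝ (Fin n) → ℝ → ℝ)
    (k : EuclideanSpace ℝ (Fin n) → EuclideanSpace ℝ (Fin n) → ℝ → ℝ)
    (u0 : EuclideanSpace ℝ (Fin n) → ℝ) (T : ℝ)
    (u : EuclideanSpace ℝ (Fin n) → ℝ → ℝ) : Prop :=
  RegQ Ω T u ∧ (∀ x ∈ closure Ω, ∀ t ∈ Ico (0:ℝ) T, 0 ≤ u x t) ∧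
  (∀ x ∈ Ω, ∀ t ∈ Ioo (0:ℝ) T,
    deriv (u x) t ≤ lap (fun y => u y t) x
      + a x t * u x t ^ r * (∫ y in Ω, u y t ^ p) - b x t * u x t ^ q) ∧
  (∀ x ∈ frontier Ω, ∀ t ∈ Ioo (0:ℝ) T, u x t ≤ ∫ y in Ω, k x y t * u y t ^ l) ∧
  (∀ x ∈ Ω, u x 0 ≤ u0 x)

/-- `u` is a solution of problem (P) in `Q_T`: both a subsolution and a supersolution. -/
def IsSol {n : ℕ} (r p q l : ℝ) (Ω : Set (EuclideanSpace ℝ (Fin n)))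
    (a b : EuclideanSpace ℝ (Fin n) → ℝ → ℝ)
    (k : EuclideanSpace ℝ (Fin n) → EuclideanSpace ℝ (Fin n) → ℝ → ℝ)
    (u0 : EuclideanSpace ℝ (Fin n) → ℝ) (T : ℝ)
    (u : EuclideanSpace ℝ (Fin n) → ℝ → ℝ) : Prop :=
  IsSubSol r p q l Ω a b k u0 T u ∧ IsSuperSol r p q l Ω a b k u0 T u

/-- `u` solves problem (P) in `Q_T` for every `T < Tstar`. -/
def IsSolOn {n : ℕ} (r p q l : ℝ) (Ω : Set (EuclideanSpace ℝ (Fin n)))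
    (a b : EuclideanSpace ℝ (Fin n) → ℝ → ℝ)
    (k : EuclideanSpace ℝ (Fin n) → EuclideanSpace ℝ (Fin n) → ℝ → ℝ)
    (u0 : EuclideanSpace ℝ (Fin n) → ℝ) (Tstar : ℝ)
    (u : EuclideanSpace ℝ (Fin n) → ℝ → ℝ) : Prop :=
  ∀ T : ℝ, 0 < T → T < Tstar → IsSol r p q l Ω a b k u0 T u

/-- `sup_Ω u(·,t) → ∞` as `t → Tstar⁻`. -/
def BlowsUpAt {n : ℕ} (Ω : Set (EuclideanSpace ℝ (Fin n)))
    (u : EuclideanSpace ℝ (Fin n) → ℝ → ℝ) (Tstar : ℝ) : Prop :=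
  ∀ M : ℝ, ∀ᶠ t in nhdsWithin Tstar (Iio Tstar), ∃ x ∈ Ω, M < u x t

/-- Every nontrivial solution with initial datum `u0` blows up in finite time: there is no
global solution, and every noncontinuable solution on a maximal time interval `[0, Tstar)`
satisfies `sup_Ω u(·,t) → ∞` as `t → Tstar⁻`. -/
def AllSolutionsBlowUp {n : ℕ} (r p q l : ℝ) (Ω : Set (EuclideanSpace ℝ (Fin n)))
    (a b : EuclideanSpace ℝ (Fin n) → ℝ → ℝ)
    (k : EuclideanSpace ℝ (Fin n) → EuclideanSpace ℝ (Fin n) → ℝ → ℝ)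
    (u0 : EuclideanSpace ℝ (Fin n) → ℝ) : Prop :=
  (∀ u : EuclideanSpace ℝ (Fin n) → ℝ → ℝ, ¬ (∀ T : ℝ, 0 < T → IsSol r p q l Ω a b k u0 T u)) ∧
  (∀ (u : EuclideanSpace ℝ (Fin n) → ℝ → ℝ) (Tstar : ℝ), 0 < Tstar →
    IsSolOn r p q l Ω a b k u0 Tstar u →
    (¬ ∃ (v : EuclideanSpace ℝ (Fin n) → ℝ → ℝ) (T' : ℝ), Tstar < T' ∧
        IsSolOn r p q l Ω a b k u0 T' v ∧
        ∀ x ∈ closure Ω, ∀ t ∈ Ico (0:ℝ) Tstar, v x t = u x t) →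
    BlowsUpAt Ω u Tstar)

/-- `φ` is a (positive, hence principal) Dirichlet eigenfunction of `-Δ` on `Ω` with
eigenvalue `lam`:  `Δφ + lam φ = 0` in `Ω`, `φ = 0` on `∂Ω`, `φ > 0` in `Ω`. -/
def IsDirichletEigen {n : ℕ} (Ω : Set (EuclideanSpace ℝ (Fin n))) (lam : ℝ)
    (φ : EuclideanSpace ℝ (Fin n) → ℝ) : Prop :=
  ContinuousOn φ (closure Ω) ∧ ContDiffOn ℝ 2 φ Ω ∧
  (∀ x ∈ Ω, lap φ x + lam * φ x = 0) ∧ (∀ x ∈ frontier Ω, φ x = 0) ∧ (∀ x ∈ Ω, 0 < φ x)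

/-- `lam` is the first Dirichlet eigenvalue of `-Δ` on `Ω`, with (some) positive
eigenfunction `φ`. -/
def IsFirstEigen {n : ℕ} (Ω : Set (EuclideanSpace ℝ (Fin n))) (lam : ℝ)
    (φ : EuclideanSpace ℝ (Fin n) → ℝ) : Prop :=
  IsDirichletEigen Ω lam φ ∧
  ∀ lam' : ℝ, (∃ ψ : EuclideanSpace ℝ (Fin n) → ℝ, ContinuousOn ψ (closure Ω) ∧
      ContDiffOn ℝ 2 ψ Ω ∧ (∀ x ∈ Ω, lap ψ x + lam' * ψ x = 0) ∧
      (∀ x ∈ frontier Ω, ψ x = 0) ∧ ∃ x ∈ Ω, ψ x ≠ 0) → lam ≤ lam'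

/-- `sup_Ω f(·,t)`. -/
def supOmega {n : ℕ} (Ω : Set (EuclideanSpace ℝ (Fin n)))
    (f : EuclideanSpace ℝ (Fin n) → ℝ → ℝ) (t : ℝ) : ℝ :=
  sSup ((fun x => f x t) '' Ω)

/-- `inf_Ω f(·,t)`. -/
def infOmega {n : ℕ} (Ω : Set (EuclideanSpace ℝ (Fin n)))
    (f : EuclideanSpace ℝ (Fin n) → ℝ → ℝ) (t : ℝ) : ℝ :=
  sInf ((fun x => f x t) '' Ω)

/-- `inf_{∂Ω × Ω} k(·,·,t)`. -/
def infBdry {n : ℕ} (Ω : Set (EuclideanSpace ℝ (Fin n)))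
    (k : EuclideanSpace ℝ (Fin n) → EuclideanSpace ℝ (Fin n) → ℝ → ℝ) (t : ℝ) : ℝ :=
  sInf ((fun z : EuclideanSpace ℝ (Fin n) × EuclideanSpace ℝ (Fin n) => k z.1 z.2 t) ''
    (frontier Ω ×ˢ Ω))

/-- The convolution `∫ k(w) f(z - w) dw`. -/
def cv {G : Type*} [NormedAddCommGroup G] [MeasureSpace G] (k f : G → ℝ) (z : G) : ℝ :=
  ∫ w, k w * f (z - w)

/-- Measurable functions bounded by `C`. -/
def BM {G : Type*} [MeasurableSpace G] (f : G → ℝ) (C : ℝ) : Prop :=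
  Measurable f ∧ ∀ z, |f z| ≤ C

/-- `k` vanishes outside the open ball of radius `R`. -/
def SuppIn {G : Type*} [NormedAddCommGroup G] (R : ℝ) (k : G → ℝ) : Prop :=
  ∀ w, R ≤ ‖w‖ → k w = 0

section Convolution

variable {G : Type*} [NormedAddCommGroup G] [NormedSpace ℝ G] [FiniteDimensional ℝ G]
  [MeasureSpace G] [BorelSpace G] [(volume : Measure G).IsAddHaarMeasure]

/-- The `L¹` modulus of continuity under translation. -/
def om (k : G → ℝ) (h : G) : ℝ := ∫ w, |k (w + h) - k w|

lemma BM.nonneg {f : G → ℝ} {C : ℝ} (hf : BM f C) : 0 ≤ C :=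
  (abs_nonneg _).trans (hf.2 0)

lemma cv_swap (k f : G → ℝ) (z : G) : cv k f z = ∫ w, k (z - w) * f w := by
  unfold cv
  rw [← integral_sub_left_eq_self (fun w => k w * f (z - w)) volume z]
  simp

lemma integrable_reflect {k : G → ℝ} (hk : Integrable k) (z : G) :
    Integrable (fun w => k (z - w)) := hk.comp_sub_left z

lemma integrable_cv {k f : G → ℝ} {C : ℝ} (hk : Integrable k) (hf : BM f C) (z : G) :
    Integrable (fun w => k w * f (z - w)) := by
  refine hk.mul_bdd (c := C) ?_ ?_
  · exact (hf.1.comp (measurable_const.sub measurable_id)).aestronglyMeasurable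
  · exact Eventually.of_forall fun w => hf.2 _

lemma integrable_cv_swap {k f : G → ℝ} {C : ℝ} (hk : Integrable k) (hf : BM f C) (z : G) :
    Integrable (fun w => k (z - w) * f w) := by
  refine (integrable_reflect hk z).mul_bdd (c := C) hf.1.aestronglyMeasurable ?_
  exact Eventually.of_forall fun w => hf.2 _

lemma abs_cv_le {k f : G → ℝ} {C : ℝ} (hk : Integrable k) (hf : BM f C) (z : G) :
    |cv k f z| ≤ C * ∫ w, |k w| := by
  unfold cv
  rw [← integral_const_mul]
  refine (abs_integral_le_integral_abs).trans ?_
  refine integral_mono (integrable_cv hk hf z).abs (hk.abs.const_mul C) fun w => ?_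
  simp only [abs_mul]
  rw [mul_comm]
  exact mul_le_mul_of_nonneg_right (hf.2 _) (abs_nonneg _)

lemma tendsto_om {k : G → ℝ} (hk : Integrable k) : Tendsto (om k) (nhds 0) (nhds 0) := by
  have hcomp : ∀ g : G → ℝ, Continuous g → HasCompactSupport g →
      Tendsto (om g) (nhds 0) (nhds 0) := by
    intro g hg hgs
    obtain ⟨C, hC⟩ := hgs.exists_bound_of_continuous hg
    set K := tsupport g
    have hK : IsCompact K := hgs
    have hK' : IsCompact (Metric.cthickening 1 K) := hK.cthickening
    have : Tendsto (fun h : G => ∫ w, |g (w + h) - g w|) (nhds 0)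
        (nhds (∫ w : G, |g (w + 0) - g w|)) := by
      refine tendsto_integral_filter_of_dominated_convergence
        ((Metric.cthickening 1 K).indicator fun _ => 2 * C) ?_ ?_ ?_ ?_
      · refine Eventually.of_forall fun h => ?_
        exact (by fun_prop : Continuous fun w => |g (w + h) - g w|).aestronglyMeasurable
      · filter_upwards [Metric.ball_mem_nhds (0 : G) one_pos] with h hh
        refine Eventually.of_forall fun w => ?_
        by_cases hw : w ∈ Metric.cthickening 1 K
        · rw [indicator_of_mem hw, norm_eq_abs, abs_abs]
          have h1 := hC (w + h)
          have h2 := hC w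
          rw [norm_eq_abs] at h1 h2
          rw [abs_le] at h1 h2 ⊢
          constructor <;> linarith [h1.1, h1.2, h2.1, h2.2]
        · have h1 : g w = 0 := by
            apply image_eq_zero_of_notMem_tsupport
            exact fun hh => hw (Metric.self_subset_cthickening K hh)
          have h2 : g (w + h) = 0 := by
            apply image_eq_zero_of_notMem_tsupport
            intro hh'
            apply hw
            refine Metric.mem_cthickening_of_dist_le w (w + h) 1 K hh' ?_
            simp only [Metric.mem_ball, dist_zero_right] at hh
            simp [dist_eq_norm]; exact hh.le
          simp [h1, h2, hw]
      · refine (integrable_indicator_iff hK'.measurableSet).2 ?_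
        exact integrableOn_const hK'.measure_lt_top.ne
      · refine Eventually.of_forall fun w => ?_
        have : Continuous fun h => |g (w + h) - g w| := by fun_prop
        exact this.tendsto 0
    show Tendsto (fun h : G => ∫ w, |g (w + h) - g w|) (nhds 0) (nhds 0)
    simpa using this
  rw [Metric.tendsto_nhds]
  intro ε hε
  obtain ⟨g, hgs, hgk, hgc, hgi⟩ := hk.exists_hasCompactSupport_integral_sub_le
    (ε := ε / 4) (by positivity)
  have h1 := (Metric.tendsto_nhds.1 (hcomp g hgc hgs)) (ε / 4) (by positivity)
  filter_upwards [h1] with h hh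
  rw [Real.dist_0_eq_abs] at hh ⊢
  have hnn : 0 ≤ om k h := integral_nonneg fun w => abs_nonneg _
  rw [abs_of_nonneg hnn]
  have hh := (abs_lt.1 hh).2
  have i1 : Integrable fun w => |k (w + h) - g (w + h)| :=
    ((hk.sub hgi).comp_add_right h).abs
  have i2 : Integrable fun w => |g (w + h) - g w| := ((hgi.comp_add_right h).sub hgi).abs
  have i3 : Integrable fun w => |k w - g w| := (hk.sub hgi).abs
  have key : om k h ≤ (∫ w, |k (w + h) - g (w + h)|) + om g h + ∫ w, |k w - g w| := by
    unfold om
    have i12 : Integrable fun w => |k (w + h) - g (w + h)| + |g (w + h) - g w| := i1.add i2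
    rw [← integral_add i1 i2, ← integral_add i12 i3]
    refine integral_mono ((hk.comp_add_right h).sub hk).abs (i12.add i3) fun w => ?_
    calc |k (w + h) - k w| = |(k (w + h) - g (w + h)) + (g (w + h) - g w) + -(k w - g w)| := by
          congr 1; ring
      _ ≤ _ := by
        refine (abs_add_le _ _).trans ?_
        rw [abs_neg]
        gcongr
        exact abs_add_le _ _
  rw [integral_add_right_eq_self (fun w => |k w - g w|) h] at key
  simp only [norm_eq_abs] at hgk
  linarith

lemma abs_cv_sub_le {k f : G → ℝ} {C : ℝ} (hk : Integrable k) (hf : BM f C) (z z' : G) :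
    |cv k f z - cv k f z'| ≤ C * om k (z - z') := by
  rw [cv_swap, cv_swap, ← integral_sub (integrable_cv_swap hk hf z) (integrable_cv_swap hk hf z')]
  have : om k (z - z') = ∫ w, |k (z - w) - k (z' - w)| := by
    unfold om
    rw [← integral_sub_left_eq_self _ volume z']
    congr 1; ext w; congr 2; congr 1; abel
  rw [this, ← integral_const_mul]
  refine (abs_integral_le_integral_abs).trans ?_
  have hi := (integrable_reflect hk z).sub (integrable_reflect hk z')
  refine integral_mono
    ((integrable_cv_swap hk hf z).sub (integrable_cv_swap hk hf z')).abs
    (hi.abs.const_mul C) fun w => ?_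
  simp only []
  rw [← sub_mul, abs_mul, mul_comm]
  exact mul_le_mul_of_nonneg_right (hf.2 _) (abs_nonneg _)

lemma continuous_cv {k f : G → ℝ} {C : ℝ} (hk : Integrable k) (hf : BM f C) :
    Continuous (cv k f) := by
  rw [continuous_iff_continuousAt]
  intro z
  rw [ContinuousAt, tendsto_iff_dist_tendsto_zero]
  have h : Tendsto (fun z' : G => C * om k (z' - z)) (nhds z) (nhds 0) := by
    have h0 : Tendsto (fun z' : G => z' - z) (nhds z) (nhds 0) := by
      have : Continuous fun z' : G => z' - z := by fun_prop
      simpa using this.tendsto z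
    simpa using ((tendsto_om hk).comp h0).const_mul C
  refine squeeze_zero (fun _ => dist_nonneg) (fun z' => ?_) h
  rw [Real.dist_eq]
  exact abs_cv_sub_le hk hf z' z

lemma bm_cv {k f : G → ℝ} {C : ℝ} (hk : Integrable k) (hf : BM f C) :
    BM (cv k f) (C * ∫ w, |k w|) :=
  ⟨(continuous_cv hk hf).measurable, abs_cv_le hk hf⟩

lemma cv_comm (k f : G → ℝ) : cv k f = cv f k := by
  ext z
  rw [cv_swap]
  unfold cv
  congr 1; ext w; ring

lemma integrable_cv_kernel {k f : G → ℝ} (hk : Integrable k) (hf : Integrable f) :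
    Integrable (cv k f) :=
  hk.integrable_convolution (ContinuousLinearMap.mul ℝ ℝ) hf

lemma cv_assoc {k₁ k₂ f : G → ℝ} {C : ℝ} (h₁ : Integrable k₁) (h₂ : Integrable k₂)
    (hf : BM f C) : cv (cv k₁ k₂) f = cv k₁ (cv k₂ f) := by
  ext z
  have hF : Integrable (fun p : G × G => k₁ p.2 * k₂ (p.1 - p.2)) :=
    h₁.convolution_integrand (ContinuousLinearMap.mul ℝ ℝ) h₂
  have hF2 : Integrable (fun p : G × G => (k₁ p.2 * k₂ (p.1 - p.2)) * f (z - p.1)) := by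
    refine hF.mul_bdd (c := C) ?_ (Eventually.of_forall fun w => hf.2 _)
    exact (hf.1.comp (measurable_const.sub measurable_fst)).aestronglyMeasurable
  calc cv (cv k₁ k₂) f z = ∫ x, ∫ y, (k₁ y * k₂ (x - y)) * f (z - x) := by
        unfold cv
        congr 1; ext x
        rw [integral_mul_const]
    _ = ∫ y, ∫ x, (k₁ y * k₂ (x - y)) * f (z - x) := integral_integral_swap hF2
    _ = cv k₁ (cv k₂ f) z := by
        unfold cv
        congr 1; ext y
        rw [← integral_const_mul, ← integral_add_right_eq_self _ y]
        congr 1; ext x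
        rw [add_sub_cancel_right, ← sub_sub, mul_assoc, sub_right_comm]

lemma cv_left_comm {k₁ k₂ f : G → ℝ} {C : ℝ} (h₁ : Integrable k₁) (h₂ : Integrable k₂)
    (hf : BM f C) : cv k₁ (cv k₂ f) = cv k₂ (cv k₁ f) := by
  rw [← cv_assoc h₁ h₂ hf, cv_comm k₁ k₂, cv_assoc h₂ h₁ hf]

/-- Locality of the convolution. -/
lemma cv_congr_ball {k f g : G → ℝ} {R : ℝ} (hk : SuppIn R k) {z : G}
    (h : ∀ y ∈ Metric.ball z R, f y = g y) : cv k f z = cv k g z := by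
  unfold cv
  congr 1; ext w
  by_cases hw : R ≤ ‖w‖
  · simp [hk w hw]
  · rw [h (z - w) (by simpa [Metric.mem_ball, dist_eq_norm] using hw)]

lemma suppIn_cv {k f : G → ℝ} {R S : ℝ} (hk : SuppIn R k) (hf : SuppIn S f) :
    SuppIn (R + S) (cv k f) := by
  intro z hz
  unfold cv
  rw [integral_eq_zero_of_ae]
  refine Eventually.of_forall fun w => ?_
  by_cases hw : R ≤ ‖w‖
  · simp [hk w hw]
  · have : S ≤ ‖z - w‖ := by
      have := norm_sub_norm_le z w
      push Not at hw
      linarith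
    simp [hf _ this]

lemma cv_add_right {k f g : G → ℝ} {C D : ℝ} (hk : Integrable k) (hf : BM f C) (hg : BM g D)
    (z : G) : cv k (fun w => f w + g w) z = cv k f z + cv k g z := by
  unfold cv
  rw [← integral_add (integrable_cv hk hf z) (integrable_cv hk hg z)]
  congr 1; ext w; ring

lemma cv_sub_right {k f g : G → ℝ} {C D : ℝ} (hk : Integrable k) (hf : BM f C) (hg : BM g D)
    (z : G) : cv k (fun w => f w - g w) z = cv k f z - cv k g z := by
  unfold cv
  rw [← integral_sub (integrable_cv hk hf z) (integrable_cv hk hg z)]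
  congr 1; ext w; ring

lemma cv_smul_right (k f : G → ℝ) (c : ℝ) (z : G) :
    cv k (fun w => c * f w) z = c * cv k f z := by
  unfold cv
  rw [← integral_const_mul]
  congr 1; ext w; ring

lemma cv_add_left {k f g : G → ℝ} {C : ℝ} (hf : Integrable f) (hg : Integrable g)
    (hk : BM k C) (z : G) : cv (fun w => f w + g w) k z = cv f k z + cv g k z := by
  unfold cv
  rw [← integral_add (integrable_cv hf hk z) (integrable_cv hg hk z)]
  congr 1; ext w; ring

lemma cv_sub_left {k f g : G → ℝ} {C : ℝ} (hf : Integrable f) (hg : Integrable g)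
    (hk : BM k C) (z : G) : cv (fun w => f w - g w) k z = cv f k z - cv g k z := by
  unfold cv
  rw [← integral_sub (integrable_cv hf hk z) (integrable_cv hg hk z)]
  congr 1; ext w; ring

lemma cv_smul_left (k f : G → ℝ) (c : ℝ) (z : G) :
    cv (fun w => c * k w) f z = c * cv k f z := by
  unfold cv
  rw [← integral_const_mul]
  congr 1; ext w; ring

lemma cv_mono {k f g : G → ℝ} {C D : ℝ} (hk : Integrable k) (hk0 : ∀ w, 0 ≤ k w)
    (hf : BM f C) (hg : BM g D) (hfg : ∀ w, f w ≤ g w) (z : G) : cv k f z ≤ cv k g z :=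
  integral_mono (integrable_cv hk hf z) (integrable_cv hk hg z)
    fun w => mul_le_mul_of_nonneg_left (hfg _) (hk0 w)

/-- Smooth functions supported in the ball of radius `R`. -/
def IsTest (R : ℝ) (ρ : G → ℝ) : Prop := ContDiff ℝ (⊤ : ℕ∞) ρ ∧ SuppIn R ρ

lemma SuppIn.hasCompactSupport {R : ℝ} {ρ : G → ℝ} (h : SuppIn R ρ) : HasCompactSupport ρ := by
  refine HasCompactSupport.intro (isCompact_closedBall (0 : G) R) fun x hx => h x ?_
  simp only [Metric.mem_closedBall, dist_zero_right, not_le] at hx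
  exact hx.le

lemma SuppIn.mono {R S : ℝ} {ρ : G → ℝ} (h : SuppIn R ρ) (hRS : R ≤ S) : SuppIn S ρ :=
  fun w hw => h w (hRS.trans hw)

lemma IsTest.integrable {R : ℝ} {ρ : G → ℝ} (h : IsTest R ρ) : Integrable ρ :=
  h.1.continuous.integrable_of_hasCompactSupport h.2.hasCompactSupport

lemma IsTest.bm {R : ℝ} {ρ : G → ℝ} (h : IsTest R ρ) : ∃ C, BM ρ C := by
  obtain ⟨C, hC⟩ := h.2.hasCompactSupport.exists_bound_of_continuous h.1.continuous
  exact ⟨C, h.1.continuous.measurable, hC⟩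

lemma SuppIn.fderiv {R : ℝ} {ρ : G → ℝ} (h : SuppIn R ρ) (hc : Continuous (fderiv ℝ ρ)) (e : G) :
    SuppIn R (fun w => fderiv ℝ ρ w e) := by
  have hopen : ∀ w, R < ‖w‖ → _root_.fderiv ℝ ρ w = 0 := by
    intro w hw
    have : ρ =ᶠ[nhds w] fun _ => 0 := by
      filter_upwards [(isOpen_lt continuous_const continuous_norm).mem_nhds hw] with y hy
      exact h y (le_of_lt hy)
    rw [this.fderiv_eq]; simp
  intro w hw
  rcases hw.lt_or_eq with hw | hw
  · simp [hopen w hw]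
  · by_cases hw0 : w = 0
    · subst hw0
      have hR : R = 0 := by simpa using hw
      have : ρ = fun _ => 0 := by
        ext y; exact h y (by rw [hR]; positivity)
      simp [this]
    · have hcl : Tendsto (fun s : ℝ => _root_.fderiv ℝ ρ (s • w)) (nhdsWithin 1 (Ioi 1))
          (nhds (_root_.fderiv ℝ ρ w)) := by
        have : Continuous fun s : ℝ => _root_.fderiv ℝ ρ (s • w) := by fun_prop
        have := (this.tendsto 1).mono_left (nhdsWithin_le_nhds (s := Ioi 1))
        simpa using this
      have hz : Tendsto (fun s : ℝ => _root_.fderiv ℝ ρ (s • w)) (nhdsWithin 1 (Ioi 1))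
          (nhds 0) := by
        refine tendsto_const_nhds.congr' ?_
        filter_upwards [self_mem_nhdsWithin] with s hs
        rw [hopen]
        rw [norm_smul, norm_eq_abs, abs_of_pos (by linarith [mem_Ioi.1 hs]), hw]
        have : 0 < ‖w‖ := norm_pos_iff.2 hw0
        nlinarith [mem_Ioi.1 hs]
      simp [tendsto_nhds_unique hcl hz]

lemma IsTest.fderiv {R : ℝ} {ρ : G → ℝ} (h : IsTest R ρ) (e : G) :
    IsTest R (fun w => fderiv ℝ ρ w e) := by
  have h1 : ContDiff ℝ (⊤ : ℕ∞) (_root_.fderiv ℝ ρ) := h.1.fderiv_right (by simp)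
  exact ⟨h1.clm_apply contDiff_const, h.2.fderiv h1.continuous e⟩

lemma hasFDerivAt_cv_test {R : ℝ} {k ρ : G → ℝ} (hk : LocallyIntegrable k) (h : IsTest R ρ)
    (z e : G) : HasFDerivAt (cv k ρ) (fderiv ℝ (cv k ρ) z) z ∧
      fderiv ℝ (cv k ρ) z e = cv k (fun w => fderiv ℝ ρ w e) z := by
  have h1 := HasCompactSupport.hasFDerivAt_convolution_right (ContinuousLinearMap.mul ℝ ℝ)
    h.2.hasCompactSupport hk (h.1.of_le (by exact_mod_cast le_top) : ContDiff ℝ 1 ρ) z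
  have h2 : HasFDerivAt (cv k ρ) _ z := h1
  refine ⟨h2.differentiableAt.hasFDerivAt, ?_⟩
  rw [h2.fderiv]
  exact convolution_precompR_apply (ContinuousLinearMap.mul ℝ ℝ) hk
    (h.2.hasCompactSupport.fderiv ℝ) (h.1.continuous_fderiv (by simp)) z e

lemma fderiv_cv_test {R : ℝ} {k ρ : G → ℝ} (hk : LocallyIntegrable k) (h : IsTest R ρ) (e : G) :
    (fun z => fderiv ℝ (cv k ρ) z e) = cv k (fun w => fderiv ℝ ρ w e) :=
  funext fun z => (hasFDerivAt_cv_test hk h z e).2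

lemma contDiff_cv_test {R : ℝ} {k ρ : G → ℝ} (hk : LocallyIntegrable k) (h : IsTest R ρ) :
    ContDiff ℝ (⊤ : ℕ∞) (cv k ρ) :=
  HasCompactSupport.contDiff_convolution_right (ContinuousLinearMap.mul ℝ ℝ)
    h.2.hasCompactSupport hk h.1

lemma isTest_cv {R S : ℝ} {k ρ : G → ℝ} (hk : Integrable k) (hkS : SuppIn S k)
    (h : IsTest R ρ) : IsTest (S + R) (cv k ρ) :=
  ⟨contDiff_cv_test hk.locallyIntegrable h, suppIn_cv hkS h.2⟩

lemma BM.locallyIntegrable {f : G → ℝ} {C : ℝ} (hf : BM f C) : LocallyIntegrable f := by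
  refine (locallyIntegrable_const C).mono hf.1.aestronglyMeasurable
    (Eventually.of_forall fun w => ?_)
  rw [norm_eq_abs, norm_eq_abs]
  exact (hf.2 w).trans (le_abs_self C)

/-- Smooth approximate identities. -/
lemma exists_mollifier (ε : ℝ) (hε : 0 < ε) :
    ∃ ρ : G → ℝ, IsTest ε ρ ∧ (∀ w, 0 ≤ ρ w) ∧ ∫ w, ρ w = 1 := by
  let b : ContDiffBump (0 : G) := ⟨ε / 2, ε, by positivity, by linarith⟩
  refine ⟨b.normed volume, ⟨b.contDiff_normed, fun w hw => ?_⟩, b.nonneg_normed, b.integral_normed⟩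
  have : w ∉ Function.support (b.normed volume) := by
    rw [b.support_normed_eq]
    simpa using hw
  simpa using this

lemma abs_cv_mollifier_sub_le {ρ f : G → ℝ} {ε C η : ℝ} (hρ : IsTest ε ρ) (h0 : ∀ w, 0 ≤ ρ w)
    (h1 : ∫ w, ρ w = 1) (hf : BM f C) {z : G} (h : ∀ y ∈ Metric.ball z ε, |f y - f z| ≤ η) :
    |cv ρ f z - f z| ≤ η := by
  have e1 : cv ρ f z - f z = ∫ w, ρ w * (f (z - w) - f z) := by
    simp_rw [mul_sub]
    rw [integral_sub (integrable_cv hρ.integrable hf z) (hρ.integrable.mul_const _),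
      integral_mul_const, h1, one_mul]
    rfl
  have hb : BM (fun w => f w - f z) (C + |f z|) :=
    ⟨hf.1.sub_const _, fun w => (abs_sub _ _).trans (by gcongr; exact hf.2 w)⟩
  rw [e1]
  refine (abs_integral_le_integral_abs).trans ?_
  calc ∫ w, |ρ w * (f (z - w) - f z)| ≤ ∫ w, ρ w * η := by
        refine integral_mono (integrable_cv hρ.integrable hb z).abs (hρ.integrable.mul_const _)
          fun w => ?_
        simp only [abs_mul, abs_of_nonneg (h0 w)]
        by_cases hw : ε ≤ ‖w‖
        · simp [hρ.2 w hw]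
        · refine mul_le_mul_of_nonneg_left (h _ ?_) (h0 w)
          simpa [Metric.mem_ball, dist_eq_norm] using hw
    _ = η := by rw [integral_mul_const, h1, one_mul]

/-- A sequence of mollifiers, whose convolutions converge at continuity points. -/
lemma exists_mollifier_seq : ∃ ρ : ℕ → G → ℝ, (∀ m : ℕ, IsTest (1 / ((m : ℝ) + 1)) (ρ m)) ∧
    (∀ m w, 0 ≤ ρ m w) ∧ (∀ m, ∫ w, ρ m w = 1) ∧
    ∀ (f : G → ℝ) (C : ℝ) (z : G), BM f C → ContinuousAt f z →
      Tendsto (fun m => cv (ρ m) f z) atTop (nhds (f z)) := by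
  choose ρ h1 h2 h3 using fun m : ℕ => exists_mollifier (G := G) (1 / ((m : ℝ) + 1)) (by positivity)
  refine ⟨ρ, h1, h2, h3, fun f C z hf hc => ?_⟩
  rw [Metric.tendsto_atTop]
  intro ε hε
  obtain ⟨δ, hδ, hd⟩ := Metric.continuousAt_iff.1 hc (ε / 2) (by positivity)
  obtain ⟨M, hM⟩ := exists_nat_one_div_lt hδ
  refine ⟨M, fun m hm => ?_⟩
  rw [Real.dist_eq]
  refine lt_of_le_of_lt (abs_cv_mollifier_sub_le (η := ε / 2) (h1 m) (h2 m) (h3 m) hf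
    fun y hy => ?_) (by linarith)
  have : (1 : ℝ) / ((m : ℝ) + 1) ≤ 1 / ((M : ℝ) + 1) := by gcongr
  have := hd (lt_trans (lt_of_lt_of_le (Metric.mem_ball.1 hy) this) hM)
  rw [Real.dist_eq] at this
  exact this.le

lemma cv_kernel_segment {k k' F : G → ℝ} {C : ℝ} (hk : Integrable k) (hk' : Integrable k')
    (hm : Measurable k') (hF : BM F C) (h : G)
    (hd : ∀ y, k (y + h) - k y = ∫ σ in (0 : ℝ)..1, k' (y + σ • h)) (z : G) :
    cv k F (z + h) - cv k F z = ∫ σ in (0 : ℝ)..1, cv k' F (z + σ • h) := by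
  rw [cv_swap, cv_swap, ← integral_sub (integrable_cv_swap hk hF _) (integrable_cv_swap hk hF _)]
  simp_rw [cv_swap k' F]
  rw [intervalIntegral.integral_of_le zero_le_one]
  have hi : Integrable (fun p : ℝ × G => k' (z + p.1 • h - p.2) * F p.2)
      ((volume.restrict (Ioc (0 : ℝ) 1)).prod volume) := by
    refine Integrable.mul_bdd (c := C) ?_ (hF.1.comp measurable_snd).aestronglyMeasurable
      (Eventually.of_forall fun w => hF.2 _)
    have hms : Measurable fun p : ℝ × G => k' (z + p.1 • h - p.2) := hm.comp (by fun_prop)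
    refine (integrable_prod_iff hms.aestronglyMeasurable).2 ⟨?_, ?_⟩
    · exact Eventually.of_forall fun σ => integrable_reflect hk' (z + σ • h)
    · have : ∀ σ : ℝ, ∫ w, ‖k' (z + σ • h - w)‖ = ∫ w, ‖k' w‖ := fun σ =>
        integral_sub_left_eq_self (fun w => ‖k' w‖) volume _
      simp only [this]
      exact integrable_const _
  rw [integral_integral_swap hi]
  congr 1; ext w
  rw [integral_mul_const, ← sub_mul]
  congr 1
  have := hd (z - w)
  rw [intervalIntegral.integral_of_le zero_le_one] at this
  rw [show z + h - w = z - w + h by abel, this]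
  congr 1; ext σ; congr 1; abel

lemma cv_function_segment {k F F' : G → ℝ} {C C' R : ℝ} (hk : Integrable k) (hkR : SuppIn R k)
    (hF : BM F C) (hF' : BM F' C') {h z : G}
    (hd : ∀ y ∈ Metric.ball z R, F (y + h) - F y = ∫ σ in (0 : ℝ)..1, F' (y + σ • h)) :
    cv k F (z + h) - cv k F z = ∫ σ in (0 : ℝ)..1, cv k F' (z + σ • h) := by
  unfold cv
  rw [← integral_sub (integrable_cv hk hF _) (integrable_cv hk hF _)]
  rw [intervalIntegral.integral_of_le zero_le_one]
  have hi : Integrable (fun p : ℝ × G => k p.2 * F' (z + p.1 • h - p.2))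
      ((volume.restrict (Ioc (0 : ℝ) 1)).prod volume) := by
    refine Integrable.mul_bdd (c := C') ?_ ?_ (Eventually.of_forall fun w => hF'.2 _)
    · exact hk.comp_snd _
    · exact (hF'.1.comp (by fun_prop)).aestronglyMeasurable
  rw [integral_integral_swap hi]
  congr 1; ext w
  rw [integral_const_mul, ← mul_sub]
  by_cases hw : R ≤ ‖w‖
  · simp [hkR w hw]
  congr 1
  have := hd (z - w) (by simpa [Metric.mem_ball, dist_eq_norm] using hw)
  rw [intervalIntegral.integral_of_le zero_le_one] at this
  rw [show z + h - w = z - w + h by abel, this]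
  congr 1; ext σ; congr 1; abel

end Convolution

/-- Euclidean space. -/
abbrev Sp (n : ℕ) := EuclideanSpace ℝ (Fin n)

/-- Space-time. -/
abbrev SpT (n : ℕ) := EuclideanSpace ℝ (Fin n) × ℝ

instance instIsAddHaarMeasureSpT (n : ℕ) : (volume : Measure (SpT n)).IsAddHaarMeasure :=
  inferInstanceAs ((volume : Measure (Sp n)).prod (volume : Measure ℝ)).IsAddHaarMeasure

section Gauss

variable {n : ℕ}

/-- The heat kernel at time one. -/
def gs (z : Sp n) : ℝ := (4 * π) ^ (-(n : ℝ) / 2) * exp (-(1 / 4) * ‖z‖ ^ 2)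

lemma gs_pos (z : Sp n) : 0 < gs z := by unfold gs; positivity

lemma gs_nonneg (z : Sp n) : 0 ≤ gs z := (gs_pos z).le

lemma integrable_gaussian {b : ℝ} (hb : 0 < b) :
    Integrable (fun z : Sp n => exp (-b * ‖z‖ ^ 2)) := by
  refine Integrable.of_integral_ne_zero ?_
  rw [GaussianFourier.integral_rexp_neg_mul_sq_norm hb]
  positivity

lemma integrable_gs : Integrable (gs : Sp n → ℝ) :=
  (integrable_gaussian (by norm_num : (0 : ℝ) < 1 / 4)).const_mul _

lemma integral_gs : ∫ z : Sp n, gs z = 1 := by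
  unfold gs
  rw [integral_const_mul, GaussianFourier.integral_rexp_neg_mul_sq_norm (by norm_num)]
  rw [show π / (1 / 4) = 4 * π by ring, ← rpow_add (by positivity), finrank_euclideanSpace_fin]
  rw [show -(n : ℝ) / 2 + n / 2 = 0 by ring, rpow_zero]

lemma contDiff_gs : ContDiff ℝ (⊤ : ℕ∞) (gs : Sp n → ℝ) := by
  unfold gs
  exact contDiff_const.mul (contDiff_exp.comp (contDiff_const.mul (contDiff_norm_sq ℝ)))

lemma continuous_gs : Continuous (gs : Sp n → ℝ) := contDiff_gs.continuous

lemma integrable_norm_gs : Integrable (fun z : Sp n => ‖z‖ * gs z) := by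
  have h := (integrable_gaussian (n := n) (by norm_num : (0 : ℝ) < 1 / 8)).const_mul
    (4 * (4 * π) ^ (-(n : ℝ) / 2))
  refine h.mono' ?_ (Eventually.of_forall fun z => ?_)
  · exact (continuous_norm.mul continuous_gs).aestronglyMeasurable
  · rw [norm_eq_abs, abs_of_nonneg (mul_nonneg (norm_nonneg _) (gs_nonneg _))]
    unfold gs
    have h1 : ‖z‖ * exp (-(1 / 8) * ‖z‖ ^ 2) ≤ 4 := by
      have := add_one_le_exp ((1 / 8) * ‖z‖ ^ 2)
      rw [show -(1 / 8 : ℝ) * ‖z‖ ^ 2 = -((1 / 8) * ‖z‖ ^ 2) by ring, exp_neg,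
        ← div_eq_mul_inv, div_le_iff₀ (exp_pos _)]
      nlinarith [sq_nonneg (‖z‖ - 1), norm_nonneg z]
    have h2 : exp (-(1 / 4) * ‖z‖ ^ 2) = exp (-(1 / 8) * ‖z‖ ^ 2) * exp (-(1 / 8) * ‖z‖ ^ 2) := by
      rw [← exp_add]; congr 1; ring
    rw [h2]
    calc _ = (4 * π) ^ (-(n : ℝ) / 2) * exp (-(1 / 8) * ‖z‖ ^ 2) *
          (‖z‖ * exp (-(1 / 8) * ‖z‖ ^ 2)) := by ring
      _ ≤ (4 * π) ^ (-(n : ℝ) / 2) * exp (-(1 / 8) * ‖z‖ ^ 2) * 4 := by gcongr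
      _ = _ := by ring

lemma fderiv_gs (z e : Sp n) : fderiv ℝ gs z e = -(1 / 2) * inner ℝ z e * gs z := by
  have h : HasFDerivAt (fun z : Sp n => (4 * π) ^ (-(n : ℝ) / 2) * exp (-(1 / 4) * ‖z‖ ^ 2)) _ z :=
    (((hasStrictFDerivAt_norm_sq z).hasFDerivAt.const_mul (-(1 / 4) : ℝ)).exp).const_mul _
  unfold gs
  rw [h.fderiv]
  simp
  ring

end Gauss

section Kernel

variable {n : ℕ}

/-- The heat kernel on space-time with killing rate `N`. -/
def hkN (N : ℝ) (w : SpT n) : ℝ :=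
  if 0 < w.2 then exp (-N * w.2) * ((√w.2 ^ n)⁻¹ * gs ((√w.2)⁻¹ • w.1)) else 0

lemma hkN_nonneg (N : ℝ) (w : SpT n) : 0 ≤ hkN N w := by
  unfold hkN
  split_ifs
  · have := gs_nonneg ((√w.2)⁻¹ • w.1)
    positivity
  · exact le_rfl

lemma measurable_hkN (N : ℝ) : Measurable (hkN N : SpT n → ℝ) := by
  have h1 : Measurable fun w : SpT n => gs ((√w.2)⁻¹ • w.1) :=
    continuous_gs.measurable.comp (by fun_prop)
  unfold hkN
  refine Measurable.ite (measurableSet_lt measurable_const measurable_snd) ?_ measurable_const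
  fun_prop

lemma integral_scale_gs {r : ℝ} (hr : 0 < r) (F : Sp n → ℝ) :
    ∫ y, ((√r ^ n)⁻¹ * gs ((√r)⁻¹ • y)) * F y = ∫ z, gs z * F (√r • z) := by
  have hs : 0 < √r := sqrt_pos.2 hr
  have := Measure.integral_comp_smul (volume : Measure (Sp n)) 
    (fun y => ((√r ^ n)⁻¹ * gs ((√r)⁻¹ • y)) * F y) (√r)
  simp only [smul_smul, inv_mul_cancel₀ hs.ne', one_smul, finrank_euclideanSpace_fin] at this
  rw [abs_of_pos (by positivity), smul_eq_mul] at this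
  have h2 : ∫ z, (√r ^ n)⁻¹ * gs z * F (√r • z) = (√r ^ n)⁻¹ * ∫ z, gs z * F (√r • z) := by
    rw [← integral_const_mul]; congr 1; ext z; ring
  rw [h2] at this
  exact (mul_left_cancel₀ (by positivity) this).symm

lemma integrable_scale_gs {r : ℝ} (hr : 0 < r) :
    Integrable fun y : Sp n => (√r ^ n)⁻¹ * gs ((√r)⁻¹ • y) := by
  have hs : 0 < √r := sqrt_pos.2 hr
  exact (integrable_gs.comp_smul (inv_ne_zero hs.ne')).const_mul _

lemma integral_hkN_slice (N : ℝ) {r : ℝ} (hr : 0 < r) (F : Sp n → ℝ) :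
    ∫ y, hkN N (y, r) * F y = exp (-N * r) * ∫ z, gs z * F (√r • z) := by
  simp only [hkN, hr, if_true]
  rw [← integral_scale_gs hr, ← integral_const_mul]
  congr 1; ext y; ring

lemma hkN_of_nonpos (N : ℝ) {r : ℝ} (hr : r ≤ 0) (y : Sp n) : hkN N (y, r) = 0 := by
  simp [hkN, not_lt.2 hr]

lemma integrable_hkN {N : ℝ} (hN : 0 < N) : Integrable (hkN N : SpT n → ℝ) := by
  have hm := (measurable_hkN (n := n) N).aestronglyMeasurable (μ := volume)
  refine (integrable_prod_iff' hm).2 ⟨Eventually.of_forall fun r => ?_, ?_⟩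
  · by_cases hr : 0 < r
    · simp only [hkN, hr, if_true]
      exact (integrable_scale_gs hr).const_mul _
    · simp only [hkN, hr, if_false]
      exact integrable_zero _ _ _
  · have : (fun r : ℝ => ∫ y : Sp n, ‖hkN N (y, r)‖) =
        (Ioi (0 : ℝ)).indicator fun r => exp (-N * r) := by
      ext r
      by_cases hr : 0 < r
      · rw [indicator_of_mem (mem_Ioi.2 hr)]
        have := integral_hkN_slice (n := n) N hr fun _ => 1
        simp only [mul_one, integral_gs] at this
        rw [← this]
        congr 1; ext y
        rw [norm_eq_abs, abs_of_nonneg (hkN_nonneg _ _)]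
      · rw [indicator_of_notMem (by simpa using hr)]
        simp [hkN, hr]
    rw [this, integrable_indicator_iff measurableSet_Ioi]
    exact integrableOn_exp_mul_Ioi (by linarith) 0

/-- Disintegration of the heat potential. -/
lemma integral_hkN_mul (N : ℝ) {F : SpT n → ℝ} (hF : Integrable fun w => hkN N w * F w) :
    ∫ w, hkN N w * F w =
      ∫ r in Ioi (0 : ℝ), exp (-N * r) * ∫ z, gs z * F (√r • z, r) := by
  have h1 : ∫ w, hkN N w * F w = ∫ r : ℝ, ∫ y : Sp n, hkN N (y, r) * F (y, r) :=
    integral_prod_symm _ hF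
  rw [h1, ← integral_indicator measurableSet_Ioi]
  congr 1; ext r
  by_cases hr : 0 < r
  · rw [indicator_of_mem (mem_Ioi.2 hr)]
    exact integral_hkN_slice N hr fun y => F (y, r)
  · rw [indicator_of_notMem (by simpa using hr)]
    simp [hkN_of_nonpos N (not_lt.1 hr)]

end Kernel

section Derivatives

variable {n : ℕ}

/-- Directional derivative. -/
def dd {G : Type*} [NormedAddCommGroup G] [NormedSpace ℝ G] (e : G) (f : G → ℝ) (w : G) : ℝ :=
  fderiv ℝ f w e

/-- Spatial coordinate directions. -/
def ei (i : Fin n) : SpT n := (EuclideanSpace.single i 1, 0)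

/-- The time direction. -/
def et : SpT n := (0, 1)

/-- The spatial Laplacian on space-time. -/
def sl (ρ : SpT n → ℝ) (w : SpT n) : ℝ := ∑ i : Fin n, dd (ei i) (dd (ei i) ρ) w

/-- The heat operator. -/
def HL (ρ : SpT n → ℝ) (w : SpT n) : ℝ := dd et ρ w - sl ρ w

end Derivatives

section Dynkin

variable {n : ℕ}

lemma contDiff_dd {G : Type*} [NormedAddCommGroup G] [NormedSpace ℝ G] {m k : ℕ∞} {f : G → ℝ}
    (hf : ContDiff ℝ k f) (hmk : m + 1 ≤ k) (e : G) : ContDiff ℝ m (dd e f) :=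
  (hf.fderiv_right (m := m) (by exact_mod_cast hmk)).clm_apply contDiff_const

lemma continuous_sl {χ : SpT n → ℝ} (hχ : ContDiff ℝ 2 χ) : Continuous (sl χ) := by
  unfold sl
  refine continuous_finsetSum _ fun i _ => ?_
  have h1 : ContDiff ℝ 1 (dd (ei i) χ) := contDiff_dd (m := 1) (k := 2) hχ (by norm_num) _
  exact (contDiff_dd (m := 0) (k := 1) h1 (by simp) (ei i)).continuous

lemma continuous_dd {G : Type*} [NormedAddCommGroup G] [NormedSpace ℝ G] {f : G → ℝ}
    (hf : ContDiff ℝ 1 f) (e : G) : Continuous (dd e f) :=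
  (contDiff_dd (m := 0) (k := 1) hf (by simp) e).continuous

lemma integrable_gs_mul {f : Sp n → ℝ} {C : ℝ} (hf : Continuous f) (h : ∀ z, |f z| ≤ C) :
    Integrable fun z => gs z * f z :=
  integrable_gs.mul_bdd (c := C) hf.aestronglyMeasurable (Eventually.of_forall h)

/-- Continuity of Gaussian averages. -/
lemma continuousOn_gs_average {ψ : SpT n → ℝ} {s : Set ℝ} {C : ℝ} (hψ : Continuous ψ)
    (h : ∀ y, ∀ r ∈ s, |ψ (y, r)| ≤ C) :
    ContinuousOn (fun r => ∫ z : Sp n, gs z * ψ (√r • z, r)) s := by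
  refine continuousOn_of_dominated (bound := fun z => gs z * C) ?_ ?_ ?_ ?_
  · intro r hr
    exact (continuous_gs.mul (by fun_prop)).aestronglyMeasurable
  · intro r hr
    refine Eventually.of_forall fun z => ?_
    rw [norm_mul, norm_eq_abs, norm_eq_abs, abs_of_nonneg (gs_nonneg z)]
    exact mul_le_mul_of_nonneg_left (h _ r hr) (gs_nonneg z)
  · exact integrable_gs.mul_const C
  · refine Eventually.of_forall fun z => Continuous.continuousOn ?_
    exact continuous_const.mul (by fun_prop)

/-- Gaussian integration by parts. -/
lemma gs_integration_by_parts {g : Sp n → ℝ} (hg : ContDiff ℝ 1 g) {C : ℝ}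
    (h0 : ∀ z, |g z| ≤ C) (e : Sp n) (h1 : ∀ z, |fderiv ℝ g z e| ≤ C) :
    ∫ z, gs z * (inner ℝ z e * g z) = 2 * ∫ z, gs z * fderiv ℝ g z e := by
  have hc1 : Continuous fun z => fderiv ℝ g z e := continuous_dd hg e
  have i1 : Integrable fun z => fderiv ℝ gs z e * g z := by
    refine Integrable.mul_bdd (c := C) ?_ hg.continuous.aestronglyMeasurable
      (Eventually.of_forall h0)
    refine (integrable_norm_gs.mul_const ‖e‖).mono'
      (continuous_dd (contDiff_gs.of_le (by exact_mod_cast le_top)) e).aestronglyMeasurable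
      (Eventually.of_forall fun z => ?_)
    rw [fderiv_gs, norm_eq_abs, abs_mul, abs_mul, abs_of_nonneg (gs_nonneg z)]
    have := abs_real_inner_le_norm z e
    have hgz := gs_nonneg z
    have h2 : |(-(1 / 2) : ℝ)| = 1 / 2 := by norm_num
    rw [h2]
    calc 1 / 2 * |inner ℝ z e| * gs z ≤ 1 * (‖z‖ * ‖e‖) * gs z := by
          gcongr; norm_num
      _ = _ := by ring
  have i2 := integrable_gs_mul hc1 h1
  have i3 := integrable_gs_mul hg.continuous h0
  have key := integral_mul_fderiv_eq_neg_fderiv_mul_of_integrable i1 i2 i3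
    (fun x _ => (contDiff_gs.differentiable (by simp)).differentiableAt)
    (fun x _ => (hg.differentiable (by simp)).differentiableAt)
  rw [key, ← integral_neg, ← integral_const_mul]
  congr 1; ext z
  rw [fderiv_gs]; ring

lemma dynkin {χ : SpT n → ℝ} (hχ : ContDiff ℝ 2 χ) {T C : ℝ} (hT : 0 ≤ T)
    (h0 : ∀ y, ∀ r ∈ Icc 0 T, |χ (y, r)| ≤ C)
    (h1 : ∀ y, ∀ r ∈ Icc 0 T, ‖fderiv ℝ χ (y, r)‖ ≤ C)
    (h2 : ∀ y, ∀ r ∈ Icc 0 T, ∀ i, |dd (ei i) (dd (ei i) χ) (y, r)| ≤ C) :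
    (∫ z, gs z * χ (√T • z, T)) - χ 0 =
      ∫ r in (0 : ℝ)..T, ∫ z, gs z * (dd et χ (√r • z, r) + sl χ (√r • z, r)) := by
  have hC : 0 ≤ C := (abs_nonneg _).trans (h0 0 0 ⟨le_rfl, hT⟩)
  have hχ1 : ContDiff ℝ 1 χ := hχ.of_le (by norm_num)
  have hdif : Differentiable ℝ χ := hχ.differentiable (by norm_num)
  set ψ : SpT n → ℝ := fun w => dd et χ w + sl χ w with hψ
  have hψc : Continuous ψ := (continuous_dd hχ1 et).add (continuous_sl hχ)
  have het : ‖(et : SpT n)‖ ≤ 1 := by simp [et, Prod.norm_def]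
  have hei : ∀ i, ‖(ei i : SpT n)‖ ≤ 1 := fun i => by simp [ei, Prod.norm_def]
  have hdt : ∀ y, ∀ r ∈ Icc 0 T, |dd et χ (y, r)| ≤ C := fun y r hr =>
    ((fderiv ℝ χ (y, r)).le_opNorm et).trans
      ((mul_le_mul (h1 y r hr) het (norm_nonneg _) hC).trans (by simp))
  have hdi : ∀ y, ∀ r ∈ Icc 0 T, ∀ i, |dd (ei i) χ (y, r)| ≤ C := fun y r hr i =>
    ((fderiv ℝ χ (y, r)).le_opNorm (ei i)).trans
      ((mul_le_mul (h1 y r hr) (hei i) (norm_nonneg _) hC).trans (by simp))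
  have hsl : ∀ y, ∀ r ∈ Icc 0 T, |sl χ (y, r)| ≤ n * C := fun y r hr => by
    refine (Finset.abs_sum_le_sum_abs _ _).trans ?_
    refine (Finset.sum_le_sum fun i _ => h2 y r hr i).trans ?_
    simp
  have hψb : ∀ y, ∀ r ∈ Icc 0 T, |ψ (y, r)| ≤ C + n * C := fun y r hr =>
    (abs_add_le _ _).trans (add_le_add (hdt y r hr) (hsl y r hr))
  have hA : ContinuousOn (fun r => ∫ z : Sp n, gs z * χ (√r • z, r)) (Icc 0 T) :=
    continuousOn_gs_average hχ.continuous h0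
  have hB : ContinuousOn (fun r => ∫ z : Sp n, gs z * ψ (√r • z, r)) (Icc 0 T) :=
    continuousOn_gs_average hψc hψb
  have hder : ∀ r ∈ Ioo 0 T, HasDerivAt (fun r => ∫ z : Sp n, gs z * χ (√r • z, r))
      (∫ z : Sp n, gs z * ψ (√r • z, r)) r := by
    intro r hr
    have hr0 : 0 < r := hr.1
    have hs : 0 < √r := sqrt_pos.2 hr0
    have hrI : r ∈ Icc 0 T := ⟨hr.1.le, hr.2.le⟩
    have key := hasDerivAt_integral_of_dominated_loc_of_deriv_le (μ := (volume : Measure (Sp n)))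
      (F := fun r z => gs z * χ (√r • z, r)) (x₀ := r) (s := Ioo (r / 2) T)
      (F' := fun r z => gs z * fderiv ℝ χ (√r • z, r) ((1 / (2 * √r)) • z, 1))
      (bound := fun z => C * (1 / (2 * √(r / 2)) * (‖z‖ * gs z) + gs z))
      (Ioo_mem_nhds (by linarith) hr.2) ?_ ?_ ?_ ?_ ?_ ?_
    · have e1 : ∫ z : Sp n, gs z * fderiv ℝ χ (√r • z, r) ((1 / (2 * √r)) • z, 1) =
          ∫ z : Sp n, gs z * ψ (√r • z, r) := by
        have hsplit : ∀ z : Sp n, gs z * fderiv ℝ χ (√r • z, r) ((1 / (2 * √r)) • z, 1) =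
            gs z * dd et χ (√r • z, r) + ∑ i, (1 / (2 * √r)) *
              (gs z * (inner ℝ z (EuclideanSpace.single i 1) * dd (ei i) χ (√r • z, r))) := by
          intro z
          have hz : ((1 / (2 * √r)) • z, (1 : ℝ)) =
              et + (1 / (2 * √r)) • ∑ i, (z i) • (ei i : SpT n) := by
            refine Prod.ext ?_ ?_
            · simp only [et, ei, Prod.fst_add, Prod.smul_fst, Prod.fst_sum, zero_add]
              congr 1
              ext j
              simp [Finset.sum_apply, Pi.single_apply]
            · simp [et, ei, Prod.snd_sum]
          rw [hz, map_add, map_smul, map_sum]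
          simp only [map_smul, smul_eq_mul, dd, EuclideanSpace.inner_single_right]
          rw [mul_add, Finset.mul_sum, Finset.mul_sum]
          congr 1
          refine Finset.sum_congr rfl fun i _ => ?_
          simp; ring
        have hcomp : ∀ i, ContDiff ℝ 1 fun z : Sp n => dd (ei i) χ (√r • z, r) := fun i =>
          (contDiff_dd (m := 1) (k := 2) hχ (by norm_num) (ei i)).comp
            (by fun_prop : ContDiff ℝ 1 fun z : Sp n => ((√r • z, r) : SpT n))
        have hfd : ∀ i (z : Sp n), fderiv ℝ (fun z : Sp n => dd (ei i) χ (√r • z, r)) z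
            (EuclideanSpace.single i 1) = √r * dd (ei i) (dd (ei i) χ) (√r • z, r) := by
          intro i z
          have hd : HasFDerivAt (dd (ei i) χ) (fderiv ℝ (dd (ei i) χ) (√r • z, r)) (√r • z, r) :=
            ((contDiff_dd (m := 1) (k := 2) hχ (by norm_num) (ei i)).differentiable
              (by simp)).differentiableAt.hasFDerivAt
          have hl : HasFDerivAt (fun z : Sp n => (√r • z, r))
              ((√r • ContinuousLinearMap.id ℝ (Sp n)).prod 0) z :=
            ((hasFDerivAt_id z).const_smul √r).prodMk (hasFDerivAt_const r z)
          have hcl := HasFDerivAt.comp (g := dd (ei i) χ) z hd hl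
          simp only [Function.comp_def] at hcl
          rw [hcl.fderiv]
          have : ((√r • ContinuousLinearMap.id ℝ (Sp n)).prod (0 : Sp n →L[ℝ] ℝ))
              (EuclideanSpace.single i 1) = √r • ei i := by
            simp [ei, Prod.smul_mk]
          rw [ContinuousLinearMap.comp_apply, this, map_smul]
          rfl
        have hibp : ∀ i, ∫ z : Sp n, gs z * (inner ℝ z (EuclideanSpace.single i 1) *
            dd (ei i) χ (√r • z, r)) = 2 * (√r * ∫ z, gs z * dd (ei i) (dd (ei i) χ) (√r • z, r)) := by
          intro i
          rw [gs_integration_by_parts (hcomp i) (C := C + √r * C) (fun z => ?_)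
            (EuclideanSpace.single i 1) (fun z => ?_)]
          · congr 1
            rw [← integral_const_mul]
            congr 1; ext z; rw [hfd]; ring
          · exact (hdi _ r hrI i).trans (by nlinarith [mul_nonneg hs.le hC])
          · rw [hfd, abs_mul, abs_of_pos hs]
            have := h2 (√r • z) r hrI i
            nlinarith [mul_le_mul_of_nonneg_left this hs.le]
        have hii : ∀ i, Integrable fun z : Sp n => gs z * (inner ℝ z (EuclideanSpace.single i 1) *
            dd (ei i) χ (√r • z, r)) := by
          intro i
          have hcc : Continuous fun z : Sp n => dd (ei i) χ (√r • z, r) := (hcomp i).continuous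
          have := (integrable_norm_gs (n := n)).mul_const C
          refine this.mono' ?_ (Eventually.of_forall fun z => ?_)
          · exact (continuous_gs.mul ((by fun_prop : Continuous fun z : Sp n => inner ℝ z
              (EuclideanSpace.single i (1 : ℝ))).mul hcc)).aestronglyMeasurable
          · rw [norm_eq_abs, abs_mul, abs_mul, abs_of_nonneg (gs_nonneg z)]
            have a1 := abs_real_inner_le_norm z (EuclideanSpace.single i (1 : ℝ))
            simp only [PiLp.norm_single, norm_one, mul_one] at a1
            have a2 := hdi (√r • z) r hrI i
            have := gs_nonneg z
            calc gs z * (|inner ℝ z (EuclideanSpace.single i (1 : ℝ))| * |dd (ei i) χ (√r • z, r)|)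
                ≤ gs z * (‖z‖ * C) := by gcongr
              _ = _ := by ring
        have hit : Integrable fun z : Sp n => gs z * dd et χ (√r • z, r) :=
          integrable_gs_mul ((continuous_dd hχ1 et).comp (by fun_prop)) fun z => hdt _ r hrI
        have his : ∀ i, Integrable fun z : Sp n => gs z * dd (ei i) (dd (ei i) χ) (√r • z, r) :=
          fun i => integrable_gs_mul ((continuous_dd (contDiff_dd (m := 1) (k := 2) hχ
            (by norm_num) (ei i)) (ei i)).comp (by fun_prop)) fun z => h2 _ r hrI i
        simp_rw [hsplit, hψ, sl, mul_add, Finset.mul_sum]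
        rw [integral_add hit (integrable_finsetSum _ fun i _ => (hii i).const_mul _),
          integral_add hit (integrable_finsetSum _ fun i _ => his i),
          integral_finsetSum _ fun i _ => (hii i).const_mul _, integral_finsetSum _ fun i _ => his i]
        congr 1
        refine Finset.sum_congr rfl fun i _ => ?_
        rw [integral_const_mul, hibp]
        field_simp
      rw [← e1]
      exact key.2
    · refine Eventually.of_forall fun r' => ?_
      exact (continuous_gs.mul (hχ.continuous.comp (by fun_prop))).aestronglyMeasurable
    · exact integrable_gs_mul (hχ.continuous.comp (by fun_prop)) fun z => h0 _ r hrI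
    · refine Continuous.aestronglyMeasurable (continuous_gs.mul ?_)
      exact ((hχ1.continuous_fderiv (by simp)).comp
        (by fun_prop : Continuous fun z : Sp n => (√r • z, r))).clm_apply (by fun_prop)
    · refine Eventually.of_forall fun z r' hr' => ?_
      have hr'0 : 0 < r' := by linarith [hr'.1]
      have hr'I : r' ∈ Icc 0 T := ⟨hr'0.le, hr'.2.le⟩
      rw [norm_mul, norm_eq_abs, abs_of_nonneg (gs_nonneg z)]
      have b1 : ‖((1 / (2 * √r')) • z, (1 : ℝ))‖ ≤ 1 / (2 * √(r / 2)) * ‖z‖ + 1 := by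
        rw [Prod.norm_def]
        refine max_le ?_ ?_
        · have : ‖(1 / (2 * √r')) • z‖ ≤ 1 / (2 * √(r / 2)) * ‖z‖ := by
            rw [norm_smul, norm_eq_abs, abs_of_pos (by positivity)]
            gcongr
            exact hr'.1.le
          exact this.trans (by linarith)
        · have : 0 ≤ 1 / (2 * √(r / 2)) * ‖z‖ := by positivity
          simp only [norm_one]; linarith
      have b2 := (fderiv ℝ χ (√r' • z, r')).le_opNorm ((1 / (2 * √r')) • z, 1)
      have b3 := mul_le_mul (h1 (√r' • z) r' hr'I) b1 (norm_nonneg _) hC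
      have := mul_le_mul_of_nonneg_left (b2.trans b3) (gs_nonneg z)
      refine this.trans (le_of_eq ?_)
      ring
    · exact (((integrable_norm_gs.const_mul _).add integrable_gs).const_mul C)
    · refine Eventually.of_forall fun z r' hr' => ?_
      have hr'0 : 0 < r' := by linarith [hr'.1]
      have hc : HasDerivAt (fun r : ℝ => ((√r • z, r) : SpT n)) ((1 / (2 * √r')) • z, 1) r' :=
        ((hasDerivAt_sqrt hr'0.ne').smul_const z).prodMk (hasDerivAt_id r')
      exact ((hdif _).hasFDerivAt.comp_hasDerivAt r' hc).const_mul _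
  have fin := intervalIntegral.integral_eq_sub_of_hasDerivAt_of_le hT hA hder
    ((hB.mono (by rw [uIcc_of_le hT])).intervalIntegrable)
  rw [fin]
  simp only [sqrt_zero, zero_smul]
  rw [integral_mul_const, integral_gs, one_mul]
  rfl

end Dynkin

section TestFunctions

variable {n : ℕ} {R : ℝ} {ρ ρ' : SpT n → ℝ}

lemma IsTest.add (h : IsTest R ρ) (h' : IsTest R ρ') : IsTest R (fun w => ρ w + ρ' w) :=
  ⟨h.1.add h'.1, fun w hw => by simp [h.2 w hw, h'.2 w hw]⟩

lemma IsTest.sub (h : IsTest R ρ) (h' : IsTest R ρ') : IsTest R (fun w => ρ w - ρ' w) :=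
  ⟨h.1.sub h'.1, fun w hw => by simp [h.2 w hw, h'.2 w hw]⟩

lemma IsTest.const_mul (h : IsTest R ρ) (c : ℝ) : IsTest R (fun w => c * ρ w) :=
  ⟨contDiff_const.mul h.1, fun w hw => by simp [h.2 w hw]⟩

lemma IsTest.dd (h : IsTest R ρ) (e : SpT n) : IsTest R (dd e ρ) := h.fderiv e

lemma IsTest.sl (h : IsTest R ρ) : IsTest R (sl ρ) := by
  refine ⟨ContDiff.sum fun i _ => ((h.dd (ei i)).dd (ei i)).1, fun w hw => ?_⟩
  exact Finset.sum_eq_zero fun i _ => ((h.dd (ei i)).dd (ei i)).2 w hw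

lemma IsTest.HL (h : IsTest R ρ) : IsTest R (HL ρ) := (h.dd et).sub h.sl

lemma IsTest.HLN (h : IsTest R ρ) (N : ℝ) : IsTest R (fun w => _root_.HL ρ w + N * ρ w) :=
  h.HL.add (h.const_mul N)

lemma IsTest.mono {S : ℝ} (h : IsTest R ρ) (hRS : R ≤ S) : IsTest S ρ := ⟨h.1, h.2.mono hRS⟩

end TestFunctions

section Fundamental

variable {n : ℕ}

lemma integrable_hkN_mul (N : ℝ) {F : SpT n → ℝ} {C T : ℝ} (hF : BM F C)
    (hT : ∀ w, T ≤ w.2 → F w = 0) : Integrable fun w => hkN N w * F w := by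
  refine ((integrable_hkN one_pos).const_mul (exp (|1 - N| * |T|) * C)).mono'
    ((measurable_hkN N).mul hF.1).aestronglyMeasurable (Eventually.of_forall fun w => ?_)
  have hC := hF.nonneg
  have h1 := hkN_nonneg (n := n) 1 w
  rw [norm_mul, norm_eq_abs, norm_eq_abs, abs_of_nonneg (hkN_nonneg N w)]
  by_cases hw : T ≤ w.2
  · rw [hT w hw]; simp only [abs_zero, mul_zero]; positivity
  by_cases hw0 : 0 < w.2
  · have e : hkN N w = exp ((1 - N) * w.2) * hkN 1 w := by
      have e0 : exp (-N * w.2) = exp ((1 - N) * w.2) * exp (-1 * w.2) := by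
        rw [← exp_add]; congr 1; ring
      simp only [hkN, hw0, if_true]
      rw [e0]; ring
    have h2 : exp ((1 - N) * w.2) ≤ exp (|1 - N| * |T|) := by
      refine exp_le_exp.2 (mul_le_mul (le_abs_self _) ?_ hw0.le (abs_nonneg _))
      exact (not_le.1 hw).le.trans (le_abs_self _)
    rw [e]
    have := hF.2 w
    calc exp ((1 - N) * w.2) * hkN 1 w * |F w| ≤ exp (|1 - N| * |T|) * hkN 1 w * C := by gcongr
      _ = _ := by ring
  · have : hkN N w = 0 := by simp [hkN, hw0]
    rw [this, zero_mul]; positivity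

lemma dd_exp_mul_comp_sub (N : ℝ) {f : SpT n → ℝ} (hf : ContDiff ℝ 1 f) (z e w : SpT n) :
    dd e (fun w => exp (-N * w.2) * f (z - w)) w =
      -(exp (-N * w.2) * (N * e.2 * f (z - w) + dd e f (z - w))) := by
  have h1 : HasFDerivAt (fun w : SpT n => exp (-N * w.2))
      (exp (-N * w.2) • (-N • ContinuousLinearMap.snd ℝ (Sp n) ℝ)) w :=
    ((hasFDerivAt_snd (p := w)).const_mul (-N)).exp
  have h2 : HasFDerivAt (fun w : SpT n => z - w) (-ContinuousLinearMap.id ℝ (SpT n)) w :=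
    (hasFDerivAt_id w).const_sub z
  have h3 := HasFDerivAt.comp (g := f) w
    ((hf.differentiable (by simp)) (z - w)).hasFDerivAt h2
  simp only [Function.comp_def] at h3
  unfold dd
  rw [(h1.fun_mul h3).fderiv]
  simp
  ring

lemma cv_hkN_HL {R : ℝ} {ρ : SpT n → ℝ} (h : IsTest R ρ) (N : ℝ) :
    cv (hkN N) (fun w => HL ρ w + N * ρ w) = ρ := by
  ext z
  set g : SpT n → ℝ := fun w => HL ρ w + N * ρ w with hg
  have hgt : IsTest R g := h.HLN N
  set χ : SpT n → ℝ := fun w => exp (-N * w.2) * ρ (z - w) with hχ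
  have hsupp : ∀ w, R + ‖z‖ ≤ ‖w‖ → R ≤ ‖z - w‖ := fun w hw => by
    have := norm_sub_norm_le w z
    rw [norm_sub_rev] at this
    linarith
  have hcomp : ∀ f : SpT n → ℝ, ContDiff ℝ (⊤ : ℕ∞) f →
      ContDiff ℝ (⊤ : ℕ∞) (fun w : SpT n => exp (-N * w.2) * f (z - w)) := fun f hf =>
    (contDiff_exp.comp (contDiff_const.mul contDiff_snd)).mul
      (hf.comp (contDiff_const.sub contDiff_id))
  have hχt : IsTest (R + ‖z‖) χ := ⟨hcomp ρ h.1, fun w hw => by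
    simp [hχ, h.2 _ (hsupp w hw)]⟩
  have e1 : ∀ i, dd (ei i) χ = fun w => -(exp (-N * w.2) * dd (ei i) ρ (z - w)) := by
    intro i; ext w
    rw [hχ, dd_exp_mul_comp_sub N (h.1.of_le (by exact_mod_cast le_top))]
    simp [ei]
  have e2 : ∀ i w, dd (ei i) (dd (ei i) χ) w = exp (-N * w.2) * dd (ei i) (dd (ei i) ρ) (z - w) := by
    intro i w
    rw [e1]
    have : (fun w : SpT n => -(exp (-N * w.2) * dd (ei i) ρ (z - w))) =
        fun w => exp (-N * w.2) * (fun y => -dd (ei i) ρ y) (z - w) := by ext w; ring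
    have hd : ContDiff ℝ 1 (dd (ei i) ρ) := (h.dd (ei i)).1.of_le (by exact_mod_cast le_top)
    rw [this, dd_exp_mul_comp_sub N hd.neg]
    have : dd (ei i) (fun y => -dd (ei i) ρ y) (z - w) = -dd (ei i) (dd (ei i) ρ) (z - w) := by
      unfold dd; rw [fderiv_fun_neg]; simp
    rw [this]
    simp [ei]
  have e3 : ∀ w, dd et χ w + sl χ w = -(exp (-N * w.2) * g (z - w)) := by
    intro w
    rw [hχ, dd_exp_mul_comp_sub N (h.1.of_le (by exact_mod_cast le_top))]
    simp only [sl, hg, HL, et]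
    rw [← hχ]
    simp only [e2, ← Finset.mul_sum]
    ring
  set T := |R| + ‖z‖ + 1 with hT
  have hT0 : 0 < T := by positivity
  have hTg : ∀ f : SpT n → ℝ, SuppIn R f → ∀ w : SpT n, T ≤ w.2 → f (z - w) = 0 := by
    intro f hf w hw
    refine hf _ (hsupp w ?_)
    have : |w.2| ≤ ‖w‖ := norm_snd_le w
    have := le_abs_self w.2
    have := le_abs_self R
    linarith
  have hcf : Continuous (fderiv ℝ χ) := hχt.1.continuous_fderiv (by simp)
  obtain ⟨C0, hC0⟩ := hχt.bm
  obtain ⟨C1, hC1⟩ := (hχt.2.hasCompactSupport.fderiv ℝ).exists_bound_of_continuous hcf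
  choose C2 hC2 using fun i => ((hχt.dd (ei i)).dd (ei i)).bm
  have hC2' : ∀ i, C2 i ≤ ∑ j, |C2 j| := fun i => (le_abs_self _).trans
    (Finset.single_le_sum (f := fun j => |C2 j|) (fun j _ => abs_nonneg _) (Finset.mem_univ i))
  have hS : 0 ≤ ∑ j, |C2 j| := Finset.sum_nonneg fun j _ => abs_nonneg _
  have dy := dynkin (χ := χ) (C := |C0| + |C1| + ∑ j, |C2 j|)
    (contDiff_infty.1 hχt.1 2) hT0.le
    (fun y r _ => (hC0.2 _).trans (by linarith [le_abs_self C0, abs_nonneg C1]))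
    (fun y r _ => (hC1 _).trans (by linarith [le_abs_self C1, abs_nonneg C0]))
    (fun y r _ i => ((hC2 i).2 _).trans (by linarith [abs_nonneg C1, abs_nonneg C0, hC2' i]))
  have z1 : ∀ ζ : Sp n, χ (√T • ζ, T) = 0 := fun ζ => by
    simp only [hχ]; rw [hTg ρ h.2 _ le_rfl, mul_zero]
  have z2 : χ 0 = ρ z := by simp [hχ]
  simp only [z1, mul_zero, integral_zero, z2, zero_sub, e3] at dy
  obtain ⟨Cg, hCg⟩ := hgt.bm
  have hgz : BM (fun w => g (z - w)) Cg :=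
    ⟨hCg.1.comp (measurable_const.sub measurable_id), fun w => hCg.2 _⟩
  unfold cv
  rw [integral_hkN_mul N (integrable_hkN_mul N hgz (hTg g hgt.2))]
  rw [intervalIntegral.integral_of_le hT0.le] at dy
  rw [← neg_neg (ρ z), dy, ← integral_neg]
  symm
  rw [← setIntegral_eq_of_subset_of_forall_sdiff_eq_zero (s := Ioc 0 T) measurableSet_Ioi
    Ioc_subset_Ioi_self ?_]
  · congr 1; ext r
    rw [← integral_neg, ← integral_const_mul]
    congr 1; ext ζ; ring
  · intro r hr
    have : T ≤ r := by
      by_contra hlt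
      exact hr.2 ⟨hr.1, (not_le.1 hlt).le⟩
    have hz : ∀ ζ : Sp n, g (z - (√r • ζ, r)) = 0 := fun ζ => hTg g hgt.2 _ this
    simp [hz]

lemma weak_cv_hkN {R N C : ℝ} (hN : 0 < N) {ρ F : SpT n → ℝ} (h : IsTest R ρ) (hF : BM F C) :
    cv (fun w => HL ρ w + N * ρ w) (cv (hkN N) F) = cv ρ F := by
  rw [cv_left_comm (h.HLN N).integrable (integrable_hkN hN) hF,
    ← cv_assoc (integrable_hkN hN) (h.HLN N).integrable hF, cv_hkN_HL h N]

lemma eq_cv_hkN_of_weak {N C D : ℝ} (hN : 0 < N) {v F : SpT n → ℝ} (hv : BM v C) (hF : BM F D)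
    (h : ∀ R ρ, IsTest R ρ → ∀ z, cv (fun w => HL ρ w + N * ρ w) v z = cv ρ F z)
    {z : SpT n} (hz : ContinuousAt v z) : v z = cv (hkN N) F z := by
  obtain ⟨ρ, h1, h2, h3, h4⟩ := exists_mollifier_seq (G := SpT n)
  have t1 := h4 v C z hv hz
  have t2 := h4 (cv (hkN N) F) _ z (bm_cv (integrable_hkN hN) hF)
    (continuous_cv (integrable_hkN hN) hF).continuousAt
  refine tendsto_nhds_unique t1 (t2.congr fun m => ?_)
  rw [cv_left_comm (h1 m).integrable (integrable_hkN hN) hF]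
  have e : cv (ρ m) F = cv (fun w => HL (ρ m) w + N * ρ m w) v := by
    ext z; rw [h _ _ (h1 m) z]
  rw [e, ← cv_assoc (integrable_hkN hN) ((h1 m).HLN N).integrable hv, cv_hkN_HL (h1 m) N]

end Fundamental

section Initial

variable {n : ℕ}

/-- The heat semigroup with killing rate `N`, extended by zero to negative times. -/
def pN (N : ℝ) (f : Sp n → ℝ) (w : SpT n) : ℝ :=
  if 0 ≤ w.2 then exp (-N * w.2) * ∫ z, gs z * f (w.1 - √w.2 • z) else 0

lemma continuousOn_pN (N : ℝ) {f : Sp n → ℝ} {C : ℝ} (hf : Continuous f) (h : ∀ x, |f x| ≤ C) :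
    ContinuousOn (pN N f) {w | 0 ≤ w.2} := by
  have h1 : Continuous fun w : SpT n => exp (-N * w.2) * ∫ z, gs z * f (w.1 - √w.2 • z) := by
    refine (by fun_prop : Continuous fun w : SpT n => exp (-N * w.2)).mul ?_
    refine continuous_of_dominated (bound := fun z => gs z * C) ?_ ?_ ?_ ?_
    · intro w
      exact (continuous_gs.mul (by fun_prop)).aestronglyMeasurable
    · intro w
      refine Eventually.of_forall fun z => ?_
      rw [norm_mul, norm_eq_abs, norm_eq_abs, abs_of_nonneg (gs_nonneg z)]
      exact mul_le_mul_of_nonneg_left (h _) (gs_nonneg z)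
    · exact integrable_gs.mul_const C
    · exact Eventually.of_forall fun z => continuous_const.mul (by fun_prop)
  refine h1.continuousOn.congr fun w hw => ?_
  simp only [mem_ofPred_eq] at hw
  simp [pN, hw]

lemma pN_neg (N : ℝ) (f : Sp n → ℝ) {w : SpT n} (hw : w.2 < 0) : pN N f w = 0 := by
  simp [pN, not_le.2 hw]

lemma measurable_pN (N : ℝ) {f : Sp n → ℝ} {C : ℝ} (hf : Continuous f) (h : ∀ x, |f x| ≤ C) :
    Measurable (pN N f) := by
  have hs : MeasurableSet {w : SpT n | 0 ≤ w.2} := measurableSet_le measurable_const measurable_snd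
  refine measurable_of_restrict_of_restrict_compl hs ?_ ?_
  · exact (continuousOn_iff_continuous_domRestrict.1 (continuousOn_pN N hf h)).measurable
  · have : (({w : SpT n | 0 ≤ w.2}ᶜ).domRestrict (pN N f)) = fun _ => 0 := by
      ext ⟨w, hw⟩
      exact pN_neg N f (by simpa using hw)
    rw [this]; exact measurable_const

lemma pN_zero_time (N : ℝ) (f : Sp n → ℝ) (x : Sp n) : pN N f (x, 0) = f x := by
  simp [pN, integral_mul_const, integral_gs]

lemma pN_mono (N : ℝ) {f g : Sp n → ℝ} {C : ℝ} (hf : Continuous f) (h : ∀ x, |f x| ≤ C)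
    (hg : Continuous g) (h' : ∀ x, |g x| ≤ C) (hfg : ∀ x, f x ≤ g x) (w : SpT n) :
    pN N f w ≤ pN N g w := by
  unfold pN
  split_ifs
  · refine mul_le_mul_of_nonneg_left (integral_mono (integrable_gs_mul (by fun_prop) fun z => h _)
      (integrable_gs_mul (by fun_prop) fun z => h' _) fun z => ?_) (exp_nonneg _)
    exact mul_le_mul_of_nonneg_left (hfg _) (gs_nonneg z)
  · exact le_rfl

lemma pN_const (N c : ℝ) (w : SpT n) (hw : 0 ≤ w.2) :
    pN N (fun _ => c) w = exp (-N * w.2) * c := by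
  simp [pN, hw, integral_mul_const, integral_gs]

lemma bm_pN {N : ℝ} (hN : 0 ≤ N) {f : Sp n → ℝ} {C : ℝ} (hf : Continuous f) (h : ∀ x, |f x| ≤ C) :
    BM (pN N f) C := by
  refine ⟨measurable_pN N hf h, fun w => ?_⟩
  have hC : 0 ≤ C := (abs_nonneg _).trans (h 0)
  by_cases hw : 0 ≤ w.2
  · have hle : exp (-N * w.2) ≤ 1 := exp_le_one_iff.2 (by nlinarith)
    have a := pN_mono N hf h continuous_const (fun _ => by rw [abs_of_nonneg hC])
      (fun x => (abs_le.1 (h x)).2) w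
    have b := pN_mono N continuous_const (fun _ => by rw [abs_neg, abs_of_nonneg hC]) hf h
      (fun x => (abs_le.1 (h x)).1) w
    rw [pN_const _ _ _ hw] at a b
    rw [abs_le]
    constructor <;> nlinarith [exp_nonneg (-N * w.2)]
  · rw [pN_neg N f (not_le.1 hw)]; simpa using hC

lemma pN_eq_integral (N : ℝ) (f : Sp n → ℝ) {w : SpT n} (hw : w.2 ≠ 0) :
    pN N f w = ∫ y, hkN N (w.1 - y, w.2) * f y := by
  rcases lt_or_gt_of_ne hw with h | h
  · simp [pN_neg N f h, hkN_of_nonpos N h.le]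
  · have := integral_hkN_slice N h fun y => f (w.1 - y)
    simp only [pN, h.le, if_true]
    rw [← this, ← integral_sub_left_eq_self _ volume w.1]
    simp

lemma cv_pN {N R C : ℝ} {g ρ : SpT n → ℝ} (hg : IsTest R g) (hgρ : cv (hkN N) g = ρ)
    {f : Sp n → ℝ} (hf : Continuous f) (h : ∀ x, |f x| ≤ C) (z : SpT n) :
    cv g (pN N f) z = ∫ y, f y * ρ (z.1 - y, z.2) := by
  have hC : 0 ≤ C := (abs_nonneg _).trans (h 0)
  have hnull : ∀ᵐ w : SpT n, w.2 ≠ 0 := by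
    rw [ae_iff]
    have : {w : SpT n | ¬ w.2 ≠ 0} = univ ×ˢ {0} := by ext w; simp
    rw [this]
    show (volume.prod volume) _ = 0
    rw [Measure.prod_prod]; simp
  have hm : Measurable fun p : SpT n × Sp n => g (z - p.1) * (hkN N (p.1.1 - p.2, p.1.2) * f p.2) := by
    have m1 : Measurable fun p : SpT n × Sp n => g (z - p.1) :=
      hg.1.continuous.measurable.comp (by fun_prop)
    have m2 : Measurable fun p : SpT n × Sp n => hkN N (p.1.1 - p.2, p.1.2) :=
      (measurable_hkN N).comp (by fun_prop)
    have m3 : Measurable fun p : SpT n × Sp n => f p.2 := hf.measurable.comp measurable_snd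
    exact m1.mul (m2.mul m3)
  have hslice : ∀ w : SpT n, Integrable fun y => hkN N (w.1 - y, w.2) := by
    intro w
    by_cases hw : 0 < w.2
    · simp only [hkN, hw, if_true]
      exact ((integrable_scale_gs hw).const_mul _).comp_sub_left w.1
    · simp only [hkN, hw, if_false]
      exact integrable_zero _ _ _
  have hslice1 : ∀ w : SpT n, ∫ y, hkN N (w.1 - y, w.2) ≤ exp (-N * w.2) := by
    intro w
    by_cases hw : 0 < w.2
    · have := integral_hkN_slice (n := n) N hw fun _ => 1
      simp only [mul_one, integral_gs] at this
      rw [integral_sub_left_eq_self (fun y => hkN N (y, w.2)) volume w.1, this]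
    · have : ∀ y, hkN N (w.1 - y, w.2) = 0 := fun y => hkN_of_nonpos N (not_lt.1 hw) _
      simp only [this, integral_zero]; positivity
  have hi : Integrable (fun p : SpT n × Sp n => g (z - p.1) * (hkN N (p.1.1 - p.2, p.1.2) * f p.2))
      (volume.prod volume) := by
    refine (integrable_prod_iff hm.aestronglyMeasurable).2 ⟨Eventually.of_forall fun w => ?_, ?_⟩
    · exact ((hslice w).mul_bdd (c := C) hf.aestronglyMeasurable
        (Eventually.of_forall h)).const_mul (g (z - w))
    · have hcs : Integrable fun w : SpT n => |g (z - w)| * exp (-N * w.2) * C := by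
        refine Continuous.integrable_of_hasCompactSupport ?_ ?_
        · have := hg.1.continuous
          fun_prop
        · refine HasCompactSupport.intro (isCompact_closedBall z R) fun w hw => ?_
          rw [hg.2 (z - w)]
          · simp
          · rw [Metric.mem_closedBall, dist_eq_norm, norm_sub_rev] at hw
            exact (not_le.1 hw).le
      refine hcs.mono' hm.aestronglyMeasurable.norm.integral_prod_right'
        (Eventually.of_forall fun w => ?_)
      rw [norm_eq_abs, abs_of_nonneg (integral_nonneg fun _ => norm_nonneg _)]
      calc ∫ y, ‖g (z - w) * (hkN N (w.1 - y, w.2) * f y)‖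
          ≤ ∫ y, |g (z - w)| * (hkN N (w.1 - y, w.2) * C) := by
            refine integral_mono (((hslice w).mul_bdd (c := C) hf.aestronglyMeasurable
              (Eventually.of_forall h)).const_mul _).norm
              (((hslice w).mul_const C).const_mul _) fun y => ?_
            simp only [norm_mul, norm_eq_abs, abs_of_nonneg (hkN_nonneg N _)]
            have := h y
            have := hkN_nonneg N (w.1 - y, w.2)
            gcongr
        _ = |g (z - w)| * ((∫ y, hkN N (w.1 - y, w.2)) * C) := by
            rw [integral_const_mul, integral_mul_const]
        _ ≤ |g (z - w)| * (exp (-N * w.2) * C) := by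
            gcongr; exact hslice1 w
        _ = _ := by ring
  rw [cv_swap]
  calc ∫ w, g (z - w) * pN N f w
      = ∫ w : SpT n, ∫ y, g (z - w) * (hkN N (w.1 - y, w.2) * f y) := by
        refine integral_congr_ae ?_
        filter_upwards [hnull] with w hw
        rw [pN_eq_integral N f hw, integral_const_mul]
    _ = ∫ y, ∫ w : SpT n, g (z - w) * (hkN N (w.1 - y, w.2) * f y) := integral_integral_swap hi
    _ = ∫ y, f y * ρ (z.1 - y, z.2) := by
        congr 1; ext y
        have : ρ (z.1 - y, z.2) = ∫ w, hkN N w * g (z - (y, 0) - w) := by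
          rw [← hgρ]
          have : (z.1 - y, z.2) = z - (y, 0) := by
            refine Prod.ext ?_ ?_ <;> simp
          rw [this]; rfl
        rw [this, ← integral_const_mul,
          ← integral_sub_right_eq_self (fun w => f y * (hkN N w * g (z - (y, 0) - w))) ((y, 0) : SpT n)]
        congr 1; ext w
        have : w - (y, 0) = (w.1 - y, w.2) := by
          refine Prod.ext ?_ ?_ <;> simp
        rw [← this, show z - (y, 0) - (w - (y, 0)) = z - w by abel]
        ring

end Initial

section FlatPower

/-- The smooth functions `s ↦ s^(-p) e^(-1/s)`, extended by zero to `s ≤ 0`. -/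
def flatPow (p s : ℝ) : ℝ := if 0 < s then (s⁻¹) ^ p * exp (-s⁻¹) else 0

lemma flatPow_of_nonpos (p : ℝ) {s : ℝ} (hs : s ≤ 0) : flatPow p s = 0 := by
  simp [flatPow, not_lt.2 hs]

lemma tendsto_flatPow_zero (p : ℝ) : Tendsto (flatPow p) (nhdsWithin 0 {0}ᶜ) (nhds 0) := by
  rw [← Iio_union_Ioi, nhdsWithin_union, tendsto_sup]
  constructor
  · refine tendsto_const_nhds.congr' ?_
    filter_upwards [self_mem_nhdsWithin] with s hs
    exact (flatPow_of_nonpos p (le_of_lt hs)).symm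
  · have h := (tendsto_rpow_mul_exp_neg_mul_atTop_nhds_zero p 1 one_pos).comp
      (tendsto_inv_nhdsGT_zero (𝕜 := ℝ))
    refine h.congr' ?_
    filter_upwards [self_mem_nhdsWithin] with s hs
    simp [flatPow, mem_Ioi.1 hs]

lemma hasDerivAt_flatPow (p s : ℝ) :
    HasDerivAt (flatPow p) (-p * flatPow (p + 1) s + flatPow (p + 2) s) s := by
  rcases lt_trichotomy s 0 with hs | rfl | hs
  · simp only [flatPow_of_nonpos _ hs.le, mul_zero, add_zero]
    refine (hasDerivAt_const s (0 : ℝ)).congr_of_eventuallyEq ?_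
    filter_upwards [Iio_mem_nhds hs] with t ht
    exact flatPow_of_nonpos p (le_of_lt ht)
  · simp only [flatPow_of_nonpos _ le_rfl, mul_zero, add_zero]
    rw [hasDerivAt_iff_tendsto_slope]
    refine (tendsto_flatPow_zero (p + 1)).congr' ?_
    filter_upwards [self_mem_nhdsWithin] with t ht
    simp only [slope, vsub_eq_sub, sub_zero, flatPow_of_nonpos p le_rfl, smul_eq_mul]
    by_cases h : 0 < t
    · have : 0 < t⁻¹ := inv_pos.2 h
      simp only [flatPow, h, if_true]
      rw [rpow_add_one this.ne']; ring
    · simp [flatPow, h]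
  · have h1 := ((hasDerivAt_inv hs.ne').rpow_const (p := p) (Or.inl (inv_ne_zero hs.ne'))).mul
      (hasDerivAt_inv hs.ne').neg.exp
    have h2 : HasDerivAt (flatPow p) _ s := h1.congr_of_eventuallyEq (by
      filter_upwards [Ioi_mem_nhds hs] with t ht
      simp [flatPow, mem_Ioi.1 ht])
    convert h2 using 1
    have hi : 0 < s⁻¹ := inv_pos.2 hs
    have e1 : (s⁻¹) ^ (p + 1) = (s⁻¹) ^ (p - 1) * (s⁻¹) ^ 2 := by
      rw [show p + 1 = (p - 1) + (2 : ℕ) by push_cast; ring, rpow_add_natCast hi.ne']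
    have e2 : (s⁻¹) ^ (p + 2) = (s⁻¹) ^ p * (s⁻¹) ^ 2 := by
      rw [show p + 2 = p + (2 : ℕ) by push_cast; ring, rpow_add_natCast hi.ne']
    simp only [flatPow, hs, if_true, e1, e2, Pi.neg_apply]
    field_simp

lemma contDiff_flatPow (p : ℝ) : ContDiff ℝ (⊤ : ℕ∞) (flatPow p) := by
  refine contDiff_infty.2 fun m => ?_
  induction m generalizing p with
  | zero =>
    exact contDiff_zero.2 (continuous_iff_continuousAt.2 fun s => (hasDerivAt_flatPow p s).continuousAt)
  | succ m ih =>
    push_cast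
    refine contDiff_succ_iff_deriv.2 ⟨fun s => (hasDerivAt_flatPow p s).differentiableAt,
      by simp, ?_⟩
    have : deriv (flatPow p) = fun s => -p * flatPow (p + 1) s + flatPow (p + 2) s :=
      funext fun s => (hasDerivAt_flatPow p s).deriv
    rw [this]
    exact (contDiff_const.mul (ih _)).add (ih _)

end FlatPower

section KernelSmooth

variable {n : ℕ}

lemma contDiffAt_hkN_of_pos {w : SpT n} (hw : 0 < w.2) :
    ContDiffAt ℝ (⊤ : ℕ∞) (hkN 0 : SpT n → ℝ) w := by
  have h1 : ContDiffAt ℝ (⊤ : ℕ∞) (fun w : SpT n => √w.2) w :=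
    contDiffAt_snd.sqrt hw.ne'
  have hs : √w.2 ≠ 0 := (sqrt_pos.2 hw).ne'
  have h2 : ContDiffAt ℝ (⊤ : ℕ∞) (fun w : SpT n => (√w.2 ^ n)⁻¹ * gs ((√w.2)⁻¹ • w.1)) w :=
    ((h1.pow n).inv (pow_ne_zero n hs)).mul
      (contDiff_gs.contDiffAt.comp w ((h1.inv hs).smul contDiffAt_fst))
  refine h2.congr_of_eventuallyEq ?_
  filter_upwards [(continuous_snd.continuousAt (x := w)).eventually (Ioi_mem_nhds hw)] with v hv
  have hv' : 0 < v.2 := hv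
  simp [hkN, hv']

lemma hkN_eq_flatPow {w : SpT n} (hw : w.1 ≠ 0) :
    hkN 0 w = π ^ (-(n : ℝ) / 2) * ((‖w.1‖ ^ 2) ^ (-(n : ℝ) / 2) *
      flatPow (n / 2) (4 * w.2 * (‖w.1‖ ^ 2)⁻¹)) := by
  have hn : 0 < ‖w.1‖ ^ 2 := by positivity
  by_cases h : 0 < w.2
  · have hs : 0 < 4 * w.2 * (‖w.1‖ ^ 2)⁻¹ := by positivity
    have e1 : √w.2 ^ n = w.2 ^ ((n : ℝ) / 2) := by
      rw [sqrt_eq_rpow, ← rpow_natCast, ← rpow_mul h.le]; congr 1; ring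
    have e2 : -(1 / 4) * ‖(√w.2)⁻¹ • w.1‖ ^ 2 = -(4 * w.2 * (‖w.1‖ ^ 2)⁻¹)⁻¹ := by
      rw [norm_smul, mul_pow, norm_inv, norm_eq_abs, abs_of_nonneg (sqrt_nonneg _), inv_pow,
        sq_sqrt h.le]
      field_simp
    have e3 : ((4 * w.2 * (‖w.1‖ ^ 2)⁻¹)⁻¹) ^ ((n : ℝ) / 2) =
        (4 * w.2) ^ (-(n : ℝ) / 2) * (‖w.1‖ ^ 2) ^ ((n : ℝ) / 2) := by
      rw [mul_inv, inv_inv, mul_rpow (by positivity) hn.le, inv_rpow (by positivity),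
        ← rpow_neg (by positivity), neg_div]
    have e4 : (‖w.1‖ ^ 2) ^ (-(n : ℝ) / 2) * (‖w.1‖ ^ 2) ^ ((n : ℝ) / 2) = 1 := by
      rw [← rpow_add hn, show -(n : ℝ) / 2 + n / 2 = 0 by ring, rpow_zero]
    simp only [hkN, h, if_true, flatPow, hs, gs, e1, e2, e3, neg_zero, zero_mul, exp_zero, one_mul]
    rw [mul_rpow (by norm_num) pi_pos.le, mul_rpow (by norm_num) h.le, ← rpow_neg h.le, ← neg_div]
    linear_combination (-(4 ^ (-(n : ℝ) / 2) * π ^ (-(n : ℝ) / 2) * w.2 ^ (-(n : ℝ) / 2) *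
      exp (-(4 * w.2 * (‖w.1‖ ^ 2)⁻¹)⁻¹))) * e4
  · have hs : 4 * w.2 * (‖w.1‖ ^ 2)⁻¹ ≤ 0 :=
      mul_nonpos_of_nonpos_of_nonneg (by linarith) (by positivity)
    rw [flatPow_of_nonpos _ hs]
    simp [hkN, h]

lemma contDiffAt_hkN_zero {w : SpT n} (hw : w ≠ 0) :
    ContDiffAt ℝ (⊤ : ℕ∞) (hkN 0 : SpT n → ℝ) w := by
  rcases lt_trichotomy w.2 0 with h | h | h
  · refine contDiffAt_const (c := (0 : ℝ)).congr_of_eventuallyEq ?_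
    filter_upwards [(continuous_snd.continuousAt (x := w)).eventually (Iio_mem_nhds h)] with v hv
    exact hkN_of_nonpos 0 (le_of_lt hv) v.1
  · have h1 : w.1 ≠ 0 := fun h1 => hw (Prod.ext h1 h)
    have hn : ‖w.1‖ ^ 2 ≠ 0 := by positivity
    have c1 : ContDiffAt ℝ (⊤ : ℕ∞) (fun w : SpT n => ‖w.1‖ ^ 2) w := contDiffAt_fst.norm_sq ℝ
    have c2 := contDiffAt_const (c := π ^ (-(n : ℝ) / 2)).mul
      ((c1.rpow_const_of_ne (p := -(n : ℝ) / 2) hn).mul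
      ((contDiff_flatPow (n / 2)).contDiffAt.comp w
        ((contDiffAt_const (c := (4 : ℝ)).mul contDiffAt_snd).mul (c1.inv hn))))
    refine c2.congr_of_eventuallyEq ?_
    filter_upwards [(continuous_fst.continuousAt (x := w)).eventually_ne h1] with v hv
    exact hkN_eq_flatPow hv
  · exact contDiffAt_hkN_of_pos h

/-- Multiplying the heat kernel by a test function vanishing near the origin gives a test
function. -/
lemma isTest_hkN_mul {R ε : ℝ} {ψ : SpT n → ℝ} (hε : 0 < ε) (h : IsTest R ψ)
    (h0 : ∀ w, ‖w‖ < ε → ψ w = 0) : IsTest R (fun w => hkN 0 w * ψ w) := by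
  refine ⟨contDiff_iff_contDiffAt.2 fun w => ?_, fun w hw => by simp [h.2 w hw]⟩
  by_cases hw : w = 0
  · refine contDiffAt_const (c := (0 : ℝ)).congr_of_eventuallyEq ?_
    rw [hw]
    filter_upwards [Metric.ball_mem_nhds 0 hε] with v hv
    rw [h0 v (by simpa using hv), mul_zero]
  · exact (contDiffAt_hkN_zero hw).mul h.1.contDiffAt

end KernelSmooth

section Leibniz

variable {n : ℕ}

lemma dd_mul {f g : SpT n → ℝ} (hf : Differentiable ℝ f) (hg : Differentiable ℝ g) (e : SpT n) :
    dd e (fun w => f w * g w) = fun w => f w * dd e g w + g w * dd e f w := by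
  ext w
  unfold dd
  rw [((hf w).hasFDerivAt.fun_mul (hg w).hasFDerivAt).fderiv]
  simp

lemma dd_add {f g : SpT n → ℝ} (hf : Differentiable ℝ f) (hg : Differentiable ℝ g) (e : SpT n) :
    dd e (fun w => f w + g w) = fun w => dd e f w + dd e g w := by
  ext w
  unfold dd
  rw [((hf w).hasFDerivAt.fun_add (hg w).hasFDerivAt).fderiv]
  simp

lemma dd_reflect {f : SpT n → ℝ} (hf : Differentiable ℝ f) (z e : SpT n) :
    dd e (fun w => f (z - w)) = fun w => -dd e f (z - w) := by
  ext w
  have h2 : HasFDerivAt (fun w : SpT n => z - w) (-ContinuousLinearMap.id ℝ (SpT n)) w :=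
    (hasFDerivAt_id w).const_sub z
  have h3 := HasFDerivAt.comp (g := f) w (hf (z - w)).hasFDerivAt h2
  simp only [Function.comp_def] at h3
  unfold dd
  rw [h3.fderiv]
  simp

lemma dd_neg (f : SpT n → ℝ) (e : SpT n) : dd e (fun w => -f w) = fun w => -dd e f w := by
  ext w
  unfold dd
  rw [fderiv_fun_neg]; simp

lemma smooth_diff {f : SpT n → ℝ} (hf : ContDiff ℝ (⊤ : ℕ∞) f) : Differentiable ℝ f :=
  hf.differentiable (by simp)

lemma smooth_dd {f : SpT n → ℝ} (hf : ContDiff ℝ (⊤ : ℕ∞) f) (e : SpT n) :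
    ContDiff ℝ (⊤ : ℕ∞) (dd e f) :=
  (hf.fderiv_right (by simp)).clm_apply contDiff_const

lemma sl_mul {f g : SpT n → ℝ} (hf : ContDiff ℝ (⊤ : ℕ∞) f) (hg : ContDiff ℝ (⊤ : ℕ∞) g)
    (w : SpT n) : sl (fun w => f w * g w) w =
      f w * sl g w + g w * sl f w + 2 * ∑ i, dd (ei i) f w * dd (ei i) g w := by
  simp only [sl, Finset.mul_sum, ← Finset.sum_add_distrib]
  refine Finset.sum_congr rfl fun i _ => ?_
  have hf' := smooth_dd hf (ei i)
  have hg' := smooth_dd hg (ei i)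
  rw [dd_mul (smooth_diff hf) (smooth_diff hg),
    dd_add (smooth_diff (hf.mul hg')) (smooth_diff (hg.mul hf')),
    dd_mul (smooth_diff hf) (smooth_diff hg'), dd_mul (smooth_diff hg) (smooth_diff hf')]
  ring

lemma HL_mul_reflect {f g : SpT n → ℝ} (hf : ContDiff ℝ (⊤ : ℕ∞) f)
    (hg : ContDiff ℝ (⊤ : ℕ∞) g) (z w : SpT n) : HL (fun w => f (z - w) * g w) w =
      f (z - w) * HL g w + (-dd et f (z - w) - sl f (z - w)) * g w +
        2 * ∑ i, dd (ei i) f (z - w) * dd (ei i) g w := by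
  have hfz : ContDiff ℝ (⊤ : ℕ∞) fun w => f (z - w) := hf.comp (contDiff_const.sub contDiff_id)
  have e1 : sl (fun w => f (z - w)) w = sl f (z - w) := by
    simp only [sl, dd_reflect (smooth_diff hf), dd_neg, dd_reflect (smooth_diff (smooth_dd hf _)),
      neg_neg]
  unfold HL
  rw [sl_mul hfz hg, dd_mul (smooth_diff hfz) (smooth_diff hg), e1]
  simp only [dd_reflect (smooth_diff hf), neg_mul, Finset.sum_neg_distrib]
  ring

end Leibniz

section Param

variable {n : ℕ}

lemma cv_test_dd {R S : ℝ} {k ρ : SpT n → ℝ} (hk : IsTest R k) (hρ : IsTest S ρ) (e : SpT n) :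
    cv k (dd e ρ) = cv (dd e k) ρ := by
  have h1 := fderiv_cv_test hk.1.continuous.locallyIntegrable hρ e
  have h2 := fderiv_cv_test hρ.1.continuous.locallyIntegrable hk e
  rw [cv_comm ρ k] at h2
  rw [cv_comm (dd e k)]
  exact h1.symm.trans h2

lemma cv_sum_left {ι : Type*} (s : Finset ι) {k : ι → SpT n → ℝ} {f : SpT n → ℝ} {C : ℝ}
    (hk : ∀ i, Integrable (k i)) (hf : BM f C) (z : SpT n) :
    cv (fun w => ∑ i ∈ s, k i w) f z = ∑ i ∈ s, cv (k i) f z := by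
  unfold cv
  rw [← integral_finsetSum _ fun i _ => integrable_cv (hk i) hf z]
  simp only [Finset.sum_mul]

lemma cv_sum_right {ι : Type*} (s : Finset ι) {k : SpT n → ℝ} {f : ι → SpT n → ℝ} {C : ι → ℝ}
    (hk : Integrable k) (hf : ∀ i, BM (f i) (C i)) (z : SpT n) :
    cv k (fun w => ∑ i ∈ s, f i w) z = ∑ i ∈ s, cv k (f i) z := by
  unfold cv
  rw [← integral_finsetSum _ fun i _ => integrable_cv hk (hf i) z]
  simp only [Finset.mul_sum]

lemma sum_ei (h : Sp n) : ((h, 0) : SpT n) = ∑ i, h i • ei i := by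
  refine Prod.ext ?_ ?_
  · rw [Prod.fst_sum]
    simp only [ei, Prod.smul_fst]
    ext j
    simp [Pi.single_apply]
  · rw [Prod.snd_sum]; simp [ei]

lemma fderiv_space (f : SpT n → ℝ) (w : SpT n) (h : Sp n) :
    fderiv ℝ f w (h, 0) = ∑ i, h i * dd (ei i) f w := by
  rw [sum_ei, map_sum]; simp [dd]

/-- Parabolic scaling of an integrable profile. -/
lemma integrable_scaled {g : Sp n → ℝ} (hg : Integrable g) (hgm : Measurable g) {m : ℝ → ℝ}
    (hm : IntegrableOn m (Ioi 0)) (hmm : Measurable m) :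
    Integrable fun w : SpT n =>
      if 0 < w.2 then m w.2 * ((√w.2 ^ n)⁻¹ * g ((√w.2)⁻¹ • w.1)) else 0 := by
  have h1 : Measurable fun w : SpT n => g ((√w.2)⁻¹ • w.1) := hgm.comp (by fun_prop)
  have hmeas : Measurable fun w : SpT n =>
      if 0 < w.2 then m w.2 * ((√w.2 ^ n)⁻¹ * g ((√w.2)⁻¹ • w.1)) else 0 := by
    refine Measurable.ite (measurableSet_lt measurable_const measurable_snd) ?_ measurable_const
    exact (hmm.comp measurable_snd).mul (by fun_prop)
  refine (integrable_prod_iff' (hmeas.aestronglyMeasurable (μ := volume))).2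
    ⟨Eventually.of_forall fun r => ?_, ?_⟩
  · by_cases hr : 0 < r
    · simp only [hr, if_true]
      exact ((hg.comp_smul (inv_ne_zero (sqrt_pos.2 hr).ne')).const_mul _).const_mul _
    · simp only [hr, if_false]
      exact integrable_zero _ _ _
  · have : (fun r : ℝ => ∫ y : Sp n,
        ‖if 0 < r then m r * ((√r ^ n)⁻¹ * g ((√r)⁻¹ • y)) else 0‖) =
        (Ioi (0 : ℝ)).indicator fun r => |m r| * ∫ z, |g z| := by
      ext r
      by_cases hr : 0 < r
      · have hs : 0 < √r := sqrt_pos.2 hr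
        rw [indicator_of_mem (mem_Ioi.2 hr)]
        simp only [hr, if_true, norm_eq_abs, abs_mul]
        rw [integral_const_mul, integral_const_mul,
          Measure.integral_comp_smul (volume : Measure (Sp n)) (fun y => |g y|) (√r)⁻¹]
        rw [finrank_euclideanSpace_fin, smul_eq_mul, inv_pow, inv_inv, abs_inv,
          ← mul_assoc (|√r ^ n|⁻¹), inv_mul_cancel₀ (by positivity), one_mul]
      · rw [indicator_of_notMem (by simpa using hr)]
        simp [hr]
    rw [this, integrable_indicator_iff measurableSet_Ioi]
    exact hm.abs.mul_const _

lemma dd_hkN_of_pos {w : SpT n} (hw : 0 < w.2) (e : Sp n) :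
    dd (e, 0) (hkN 0) w =
      (√w.2)⁻¹ * ((√w.2 ^ n)⁻¹ * (-(1 / 2) * inner ℝ ((√w.2)⁻¹ • w.1) e * gs ((√w.2)⁻¹ • w.1))) := by
  have h1 : HasFDerivAt (hkN 0) (fderiv ℝ (hkN 0) w) w :=
    ((contDiffAt_hkN_of_pos hw).differentiableAt (by simp)).hasFDerivAt
  have h2 : HasFDerivAt (fun y : Sp n => (y, w.2)) (ContinuousLinearMap.inl ℝ (Sp n) ℝ) w.1 :=
    hasFDerivAt_prodMk_left w.1 w.2
  have h3 := HasFDerivAt.comp (g := (hkN 0 : SpT n → ℝ)) (f := fun y : Sp n => (y, w.2)) w.1 h1 h2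
  have h4 : HasFDerivAt (fun y : Sp n => (√w.2)⁻¹ • y)
      ((√w.2)⁻¹ • ContinuousLinearMap.id ℝ (Sp n)) w.1 := (hasFDerivAt_id w.1).const_smul (√w.2)⁻¹
  have h5 : HasFDerivAt gs (fderiv ℝ gs ((√w.2)⁻¹ • w.1)) ((√w.2)⁻¹ • w.1) :=
    (contDiff_gs.differentiable (by simp) _).hasFDerivAt
  have h6 := (HasFDerivAt.comp (g := gs) w.1 h5 h4).const_mul (√w.2 ^ n)⁻¹
  have e0 : (fun y : Sp n => (√w.2 ^ n)⁻¹ * (gs ∘ fun y => (√w.2)⁻¹ • y) y) =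
      (hkN 0 ∘ fun y : Sp n => (y, w.2)) := by
    ext y; simp [hkN, hw]
  rw [e0] at h6
  have := congrArg (fun L : Sp n →L[ℝ] ℝ => L e) (h3.unique h6)
  simp only [ContinuousLinearMap.comp_apply, ContinuousLinearMap.inl_apply,
    _root_.smul_apply, ContinuousLinearMap.id_apply, map_smul, fderiv_gs,
    smul_eq_mul] at this
  unfold dd
  rw [this]; ring

end Param

section Parametrix

variable {n : ℕ}

/-- A compactly supported parametrix of the heat operator: `J` is a truncated heat kernel, `κ` a
smooth error, and `Ji i` the spatial partial derivatives of `J`. -/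
structure IsParam (R : ℝ) (J κ : SpT n → ℝ) (Ji : Fin n → SpT n → ℝ) : Prop where
  integrable : Integrable J
  supp : SuppIn R J
  test : IsTest R κ
  inv : ∀ S ρ, IsTest S ρ → ∀ z, cv J (HL ρ) z + cv κ ρ z = ρ z
  integrable_partial : ∀ i, Integrable (Ji i)
  measurable_partial : ∀ i, Measurable (Ji i)
  supp_partial : ∀ i, SuppIn R (Ji i)
  segment : ∀ (h : Sp n) (y : SpT n), J (y + (h, 0)) - J y =
    ∫ σ in (0 : ℝ)..1, ∑ i, h i * Ji i (y + σ • ((h, 0) : SpT n))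

lemma integrableOn_inv_sqrt_indicator (R : ℝ) :
    IntegrableOn ((Iio R).indicator fun r : ℝ => (√r)⁻¹) (Ioi 0) := by
  rw [IntegrableOn, integrable_indicator_iff measurableSet_Iio, IntegrableOn,
    Measure.restrict_restrict measurableSet_Iio]
  by_cases hR : 0 < R
  · have h := (intervalIntegral.intervalIntegrable_rpow' (a := 0) (b := R)
      (by norm_num : (-1 : ℝ) < -(1 / 2))).1
    refine (h.mono_set (fun r hr => ⟨hr.2, le_of_lt hr.1⟩ : Iio R ∩ Ioi 0 ⊆ Ioc 0 R)).congr_fun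
      (fun r hr => ?_) (measurableSet_Iio.inter measurableSet_Ioi)
    have : 0 < r := hr.2
    show r ^ (-(1 / 2) : ℝ) = (√r)⁻¹
    rw [rpow_neg this.le, sqrt_eq_rpow]
  · have : Iio R ∩ Ioi 0 = ∅ := by
      ext r; simp only [mem_inter_iff, mem_Iio, mem_Ioi, mem_empty_iff_false, iff_false]
      intro h; linarith [h.1, h.2]
    simp [this]

lemma exists_param {R : ℝ} (hR : 0 < R) :
    ∃ (J κ : SpT n → ℝ) (Ji : Fin n → SpT n → ℝ), IsParam R J κ Ji := by
  let η' : ContDiffBump (0 : SpT n) := ⟨R / 2, R, by positivity, by linarith⟩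
  set η : SpT n → ℝ := fun w => η' w with hη
  have hηt : IsTest R η := ⟨η'.contDiff, fun w hw =>
    η'.zero_of_le_dist (by simpa [η', dist_eq_norm] using hw)⟩
  have hη1 : ∀ w : SpT n, ‖w‖ < R / 2 → η w = 1 := fun w hw =>
    η'.one_of_mem_closedBall (by simpa [η'] using hw.le)
  have hlocal : ∀ e (w : SpT n), ‖w‖ < R / 2 → dd e η w = 0 := fun e w hw => by
    have : η =ᶠ[nhds w] fun _ => 1 := by
      filter_upwards [(isOpen_lt continuous_norm continuous_const).mem_nhds hw] with v hv
      exact hη1 v hv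
    unfold dd; rw [this.fderiv_eq]; simp
  have hlocal2 : ∀ i (w : SpT n), ‖w‖ < R / 2 → dd (ei i) (dd (ei i) η) w = 0 := fun i w hw => by
    have : dd (ei i) η =ᶠ[nhds w] fun _ => 0 := by
      filter_upwards [(isOpen_lt continuous_norm continuous_const).mem_nhds hw] with v hv
      exact hlocal _ v hv
    unfold dd at this ⊢; rw [this.fderiv_eq]; simp
  set A : SpT n → ℝ := fun w => -1 * dd et η w - sl η w with hA
  have hAt : IsTest R A := ((hηt.dd et).const_mul (-1)).sub hηt.sl
  have hA0 : ∀ w : SpT n, ‖w‖ < R / 2 → A w = 0 := fun w hw => by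
    simp [hA, sl, hlocal _ w hw, hlocal2 _ w hw]
  have hAΓ : IsTest R fun w => hkN 0 w * A w := isTest_hkN_mul (by positivity) hAt hA0
  set K : Fin n → SpT n → ℝ := fun i w => hkN 0 w * dd (ei i) η w with hK
  have hKt : ∀ i, IsTest R (K i) := fun i =>
    isTest_hkN_mul (by positivity) (hηt.dd (ei i)) (hlocal (ei i))
  set J : SpT n → ℝ := fun w => hkN 0 w * η w with hJ
  have hηbm := hηt.bm
  obtain ⟨C, hC⟩ := hηbm
  have hT : ∀ w : SpT n, R ≤ w.2 → R ≤ ‖w‖ := fun w hw =>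
    hw.trans ((le_abs_self _).trans (norm_snd_le w))
  have hJi : Integrable J := integrable_hkN_mul 0 hC fun w hw => hηt.2 w (hT w hw)
  set S : SpT n → ℝ := fun w => ∑ i, dd (ei i) (K i) w with hS
  have hSt : IsTest R S := ⟨ContDiff.sum fun i _ => ((hKt i).dd (ei i)).1,
    fun w hw => Finset.sum_eq_zero fun i _ => ((hKt i).dd (ei i)).2 w hw⟩
  have hJpos : ∀ w : SpT n, 0 < w.2 → ContDiffAt ℝ (⊤ : ℕ∞) J w := fun w hw =>
    (contDiffAt_hkN_of_pos hw).mul hηt.1.contDiffAt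
  have hddJ : ∀ i (w : SpT n), 0 < w.2 →
      dd (ei i) J w = hkN 0 w * dd (ei i) η w + η w * dd (ei i) (hkN 0) w := fun i w hw => by
    have h1 := ((contDiffAt_hkN_of_pos hw).differentiableAt (by simp)).hasFDerivAt
    have h2 := (smooth_diff hηt.1 w).hasFDerivAt
    unfold dd
    rw [hJ, (h1.fun_mul h2).fderiv]; simp
  refine ⟨J, fun w => hkN 0 w * A w + 2 * S w, fun i w => if 0 < w.2 then dd (ei i) J w else 0,
    hJi, fun w hw => by simp [hJ, hηt.2 w hw], hAΓ.add (hSt.const_mul 2), ?_, ?_, ?_, ?_, ?_⟩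
  · intro Q ρ hρ z
    obtain ⟨Cρ, hCρ⟩ := hρ.bm
    obtain ⟨CH, hCH⟩ := hρ.HL.bm
    set ρ' : SpT n → ℝ := fun w => η (z - w) * ρ w with hρ'
    have hρt : IsTest Q ρ' := ⟨(hηt.1.comp (contDiff_const.sub contDiff_id)).mul hρ.1,
      fun w hw => by simp [hρ', hρ.2 w hw]⟩
    have key := congrFun (cv_hkN_HL hρt 0) z
    have e0 : ρ' z = ρ z := by simp [hρ', hη1 0 (by simpa using hR)]
    rw [e0] at key
    rw [← key, cv_add_left hAΓ.integrable (hSt.const_mul 2).integrable hCρ, cv_smul_left,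
      cv_sum_left _ (fun i => ((hKt i).dd (ei i)).integrable) hCρ]
    simp only [← cv_test_dd (hKt _) hρ]
    choose Ci hCi using fun i => (hρ.dd (ei i)).bm
    have hI1 := integrable_cv hAΓ.integrable hCρ z
    have hI2 : Integrable fun w => 2 * ∑ i, K i w * dd (ei i) ρ (z - w) :=
      (integrable_finsetSum _ fun i _ => integrable_cv (hKt i).integrable (hCi i) z).const_mul 2
    have hI3 : Integrable fun w => hkN 0 w * A w * ρ (z - w) +
      2 * ∑ i, K i w * dd (ei i) ρ (z - w) := hI1.add hI2
    unfold cv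
    rw [← integral_finsetSum _ fun i _ => integrable_cv (hKt i).integrable (hCi i) z,
      ← integral_const_mul, ← integral_add hI1 hI2, ← integral_add (integrable_cv hJi hCH z) hI3]
    congr 1; ext w
    have e1 : HL ρ' (z - w) = η w * HL ρ (z - w) + (-dd et η w - sl η w) * ρ (z - w) +
        2 * ∑ i, dd (ei i) η w * dd (ei i) ρ (z - w) := by
      have := HL_mul_reflect hηt.1 hρ.1 z (z - w)
      rwa [sub_sub_cancel] at this
    simp only [zero_mul, add_zero, e1]
    have e2 : ∑ i, K i w * dd (ei i) ρ (z - w) =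
        hkN 0 w * ∑ i, dd (ei i) η w * dd (ei i) ρ (z - w) := by
      rw [Finset.mul_sum]; exact Finset.sum_congr rfl fun i _ => by simp only [hK]; ring
    rw [e2]
    simp only [hJ, hA]
    ring
  · intro i
    have hb := (integrable_scaled (integrable_norm_gs (n := n))
      (continuous_norm.mul continuous_gs).measurable (integrableOn_inv_sqrt_indicator R)
      ((by fun_prop : Measurable fun r : ℝ => (√r)⁻¹).indicator measurableSet_Iio)).const_mul C
    refine (hb.add (hKt i).integrable.abs).mono' ?_ (Eventually.of_forall fun w => ?_)
    · exact (Measurable.ite (measurableSet_lt measurable_const measurable_snd)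
        (measurable_fderiv_apply_const ℝ J (ei i)) measurable_const).aestronglyMeasurable
    by_cases hw : 0 < w.2
    · simp only [hw, if_true, Pi.add_apply]
      rw [hddJ i w hw, norm_eq_abs, add_comm]
      refine (abs_add_le _ _).trans (add_le_add ?_ le_rfl)
      have hg := gs_nonneg ((√w.2)⁻¹ • w.1)
      by_cases hwR : w.2 < R
      · rw [indicator_of_mem (mem_Iio.2 hwR), ei, dd_hkN_of_pos hw, abs_mul]
        refine mul_le_mul (hC.2 w) ?_ (abs_nonneg _) hC.nonneg
        rw [abs_mul, abs_mul, abs_of_nonneg (by positivity : 0 ≤ (√w.2)⁻¹),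
          abs_of_nonneg (by positivity : 0 ≤ (√w.2 ^ n)⁻¹)]
        gcongr
        rw [abs_mul, abs_of_nonneg hg, abs_mul]
        gcongr
        have := abs_real_inner_le_norm ((√w.2)⁻¹ • w.1) (EuclideanSpace.single i (1 : ℝ))
        rw [PiLp.norm_single, norm_one, mul_one] at this
        rw [abs_of_neg (by norm_num : (-(1 / 2) : ℝ) < 0)]
        linarith [norm_nonneg ((√w.2)⁻¹ • w.1)]
      · rw [hηt.2 w (hT w (not_lt.1 hwR)), zero_mul, abs_zero]
        rw [indicator_of_notMem (by simpa using hwR), zero_mul, mul_zero]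
    · simp only [hw, if_false, Pi.add_apply, mul_zero, zero_add, norm_zero]
      exact abs_nonneg _
  · intro i
    exact Measurable.ite (measurableSet_lt measurable_const measurable_snd)
        (measurable_fderiv_apply_const ℝ J (ei i)) measurable_const
  · intro i w hw
    by_cases hp : 0 < w.2
    · simp only [hp, if_true]
      rw [hddJ i w hp, hηt.2 w hw, (hηt.dd (ei i)).2 w hw]; ring
    · simp [hp]
  · intro h y
    have h2 : ∀ σ : ℝ, (y + σ • ((h, 0) : SpT n)).2 = y.2 := by simp
    by_cases hy : 0 < y.2
    · simp only [h2, hy, if_true]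
      have hl : ∀ σ : ℝ, HasDerivAt (fun σ : ℝ => y + σ • ((h, 0) : SpT n)) ((h, 0) : SpT n) σ :=
        fun σ => by simpa using ((hasDerivAt_id σ).smul_const ((h, 0) : SpT n)).const_add y
      have hd : ∀ σ : ℝ, HasDerivAt (fun σ : ℝ => J (y + σ • ((h, 0) : SpT n)))
          (∑ i, h i * dd (ei i) J (y + σ • ((h, 0) : SpT n))) σ := fun σ => by
        rw [← fderiv_space]
        have hp : 0 < (y + σ • ((h, 0) : SpT n)).2 := by rw [h2]; exact hy
        exact ((hJpos _ hp).differentiableAt (by simp)).hasFDerivAt.comp_hasDerivAt σ (hl σ)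
      have hc : Continuous fun σ : ℝ => ∑ i, h i * dd (ei i) J (y + σ • ((h, 0) : SpT n)) := by
        refine continuous_finsetSum _ fun i _ => continuous_const.mul ?_
        refine continuous_iff_continuousAt.2 fun σ => ?_
        have hp : 0 < (y + σ • ((h, 0) : SpT n)).2 := by rw [h2]; exact hy
        have h3 : ContinuousAt (fderiv ℝ J) (y + σ • ((h, 0) : SpT n)) :=
          ((hJpos _ hp).fderiv_right (m := 0) (by simp)).continuousAt
        have h4 : ContinuousAt (dd (ei i) J) (y + σ • ((h, 0) : SpT n)) :=
          h3.clm_apply continuousAt_const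
        exact ContinuousAt.comp (f := fun σ : ℝ => y + σ • ((h, 0) : SpT n)) h4
          (hl σ).continuousAt
      rw [intervalIntegral.integral_eq_sub_of_hasDerivAt (fun σ _ => hd σ)
        (hc.intervalIntegrable 0 1)]
      simp
    · have h3 : (y + ((h, 0) : SpT n)).2 = y.2 := by simp
      simp only [h2, hy, if_false, mul_zero, Finset.sum_const_zero, intervalIntegral.integral_zero]
      simp [hJ, hkN, hy]

end Parametrix

section LocalRepresentation

variable {n : ℕ}

lemma dd_cv_test {R : ℝ} {k ρ : SpT n → ℝ} (hk : LocallyIntegrable k) (h : IsTest R ρ)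
    (e : SpT n) : dd e (cv k ρ) = cv k (dd e ρ) := fderiv_cv_test hk h e

lemma sl_cv_test {R : ℝ} {k ρ : SpT n → ℝ} (hk : LocallyIntegrable k) (h : IsTest R ρ)
    (z : SpT n) : sl (cv k ρ) z = ∑ i, cv k (dd (ei i) (dd (ei i) ρ)) z := by
  simp only [sl, dd_cv_test hk h, dd_cv_test hk (h.dd _)]

lemma HL_cv_test {R : ℝ} {k ρ : SpT n → ℝ} (hk : Integrable k) (h : IsTest R ρ) :
    HL (cv k ρ) = cv k (HL ρ) := by
  ext z
  obtain ⟨C1, h1⟩ := (h.dd et).bm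
  obtain ⟨C2, h2⟩ := h.sl.bm
  choose C3 h3 using fun i => ((h.dd (ei i)).dd (ei i)).bm
  have e1 : cv k (HL ρ) z = cv k (dd et ρ) z - cv k (sl ρ) z := cv_sub_right hk h1 h2 z
  have e2 : cv k (sl ρ) z = ∑ i, cv k (dd (ei i) (dd (ei i) ρ)) z := cv_sum_right _ hk h3 z
  unfold HL
  rw [dd_cv_test hk.locallyIntegrable h, sl_cv_test hk.locallyIntegrable h]
  exact (e1.trans (by rw [e2])).symm

/-- Representation of a local weak solution of the heat equation by a parametrix. -/
lemma IsParam.rep {R ε C D : ℝ} {J κ : SpT n → ℝ} {Ji : Fin n → SpT n → ℝ}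
    (hP : IsParam R J κ Ji) (hε : 0 < ε) {v f : SpT n → ℝ} (hv : BM v C) (hf : BM f D)
    {z : SpT n} (hw : ∀ ρ, IsTest (R + ε) ρ → cv (HL ρ) v z = cv ρ f z)
    (hz : ContinuousAt v z) : v z = cv J f z + cv κ v z := by
  obtain ⟨ρ, h1, h2, h3, h4⟩ := exists_mollifier_seq (G := SpT n)
  have t1 := h4 v C z hv hz
  have t2 := h4 (cv J f) _ z (bm_cv hP.integrable hf) (continuous_cv hP.integrable hf).continuousAt
  have t3 := h4 (cv κ v) _ z (bm_cv hP.test.integrable hv)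
    (continuous_cv hP.test.integrable hv).continuousAt
  refine tendsto_nhds_unique t1 ((t2.add t3).congr' ?_)
  have hlim : Tendsto (fun m : ℕ => 1 / ((m : ℝ) + 1)) atTop (nhds 0) :=
    tendsto_one_div_add_atTop_nhds_zero_nat
  filter_upwards [hlim.eventually (Iio_mem_nhds hε)] with m hm
  have hm' : 1 / ((m : ℝ) + 1) ≤ ε := le_of_lt hm
  have hT : IsTest (R + ε) (cv J (ρ m)) :=
    (isTest_cv hP.integrable hP.supp (h1 m)).mono (by linarith)
  have e1 : HL (cv J (ρ m)) = fun w => ρ m w - cv κ (ρ m) w := by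
    rw [HL_cv_test hP.integrable (h1 m)]
    ext w; linarith [hP.inv _ _ (h1 m) w]
  have e2 := hw _ hT
  rw [e1, cv_sub_left (h1 m).integrable
    (integrable_cv_kernel hP.test.integrable (h1 m).integrable) hv,
    cv_assoc hP.test.integrable (h1 m).integrable hv,
    cv_assoc hP.integrable (h1 m).integrable hf] at e2
  rw [cv_left_comm (h1 m).integrable hP.integrable hf,
    cv_left_comm (h1 m).integrable hP.test.integrable hv]
  linarith

end LocalRepresentation

section Segments

lemma hasFDerivAt_of_segment {E : Type*} [NormedAddCommGroup E] [NormedSpace ℝ E] {u : E → ℝ}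
    {D : E → E →L[ℝ] ℝ} (hD : Continuous D) {x : E}
    (h : ∀ᶠ y in nhds (0 : E), u (x + y) - u x = ∫ σ in (0 : ℝ)..1, D (x + σ • y) y) :
    HasFDerivAt u (D x) x := by
  rw [hasFDerivAt_iff_isLittleO_nhds_zero, Asymptotics.isLittleO_iff]
  intro c hc
  obtain ⟨δ, hδ, hball⟩ := Metric.continuousAt_iff.1 (hD.continuousAt (x := x)) c hc
  filter_upwards [h, Metric.ball_mem_nhds 0 hδ] with y hy hyδ
  have hyn : ‖y‖ < δ := by simpa using hyδ
  have hc1 : Continuous fun σ : ℝ => D (x + σ • y) y :=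
    (hD.comp (by fun_prop)).clm_apply continuous_const
  have e : u (x + y) - u x - D x y = ∫ σ in (0 : ℝ)..1, (D (x + σ • y) y - D x y) := by
    rw [intervalIntegral.integral_sub (hc1.intervalIntegrable _ _)
      (continuous_const.intervalIntegrable _ _), hy]
    simp
  rw [e]
  have := intervalIntegral.norm_integral_le_of_norm_le_const (a := (0 : ℝ)) (b := 1)
    (f := fun σ => D (x + σ • y) y - D x y) (C := c * ‖y‖) fun σ hσ => by
      rw [uIoc_of_le zero_le_one] at hσ
      rw [← _root_.sub_apply]
      refine (ContinuousLinearMap.le_opNorm _ _).trans ?_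
      have : ‖D (x + σ • y) - D x‖ < c := by
        rw [← dist_eq_norm]
        refine hball ?_
        rw [dist_eq_norm, add_sub_cancel_left, norm_smul, norm_eq_abs, abs_of_pos hσ.1]
        exact (mul_le_of_le_one_left (norm_nonneg y) hσ.2).trans_lt hyn
      exact mul_le_mul_of_nonneg_right this.le (norm_nonneg y)
  simpa using this

lemma contDiffOn_one_of_hasFDerivAt {E F : Type*} [NormedAddCommGroup E] [NormedSpace ℝ E]
    [NormedAddCommGroup F] [NormedSpace ℝ F]
    {u : E → F} {D : E → E →L[ℝ] F} (hD : Continuous D) {s : Set E} (hs : IsOpen s)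
    (h : ∀ x ∈ s, HasFDerivAt u (D x) x) : ContDiffOn ℝ 1 u s := by
  have : ContDiffOn ℝ (0 + 1) u s := by
    rw [contDiffOn_succ_iff_fderiv_of_isOpen hs]
    refine ⟨fun x hx => (h x hx).differentiableAt.differentiableWithinAt, by simp, ?_⟩
    exact contDiffOn_zero.2 (hD.continuousOn.congr fun x hx => (h x hx).fderiv)
  simpa using this

variable {n : ℕ}

/-- The spatial gradient with prescribed components. -/
def grad (V : Fin n → SpT n → ℝ) (t : ℝ) (x : Sp n) : Sp n →L[ℝ] ℝ :=
  ∑ i, V i (x, t) • (EuclideanSpace.proj i : Sp n →L[ℝ] ℝ)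

lemma grad_apply (V : Fin n → SpT n → ℝ) (t : ℝ) (x h : Sp n) :
    grad V t x h = ∑ i, h i * V i (x, t) := by
  simp [grad, mul_comm]

lemma continuous_grad {V : Fin n → SpT n → ℝ} (hV : ∀ i, Continuous (V i)) (t : ℝ) :
    Continuous (grad V t) := by
  unfold grad
  refine continuous_finsetSum _ fun i _ => ?_
  have := hV i
  fun_prop

/-- `V` is the spatial gradient of `v` on `B`, in integrated form. -/
def SegOn (B : Set (SpT n)) (v : SpT n → ℝ) (V : Fin n → SpT n → ℝ) : Prop :=
  ∀ (z : SpT n) (h : Sp n), z ∈ B → z + (h, 0) ∈ B →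
    v (z + (h, 0)) - v z = ∫ σ in (0 : ℝ)..1, ∑ i, h i * V i (z + σ • ((h, 0) : SpT n))

lemma SegOn.hasFDerivAt {B : Set (SpT n)} (hB : IsOpen B) {v : SpT n → ℝ}
    {V : Fin n → SpT n → ℝ} (hV : ∀ i, Continuous (V i)) (h : SegOn B v V) {x : Sp n} {t : ℝ}
    (hz : (x, t) ∈ B) : HasFDerivAt (fun x => v (x, t)) (grad V t x) x := by
  refine hasFDerivAt_of_segment (continuous_grad hV t) ?_
  have hc : Continuous fun y : Sp n => (x, t) + ((y, 0) : SpT n) := by fun_prop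
  have := (hc.continuousAt (x := (0 : Sp n))).eventually (hB.mem_nhds (by simpa using hz))
  filter_upwards [this] with y hy
  have := h (x, t) y hz hy
  simpa [grad_apply] using this

/-- Gradients of differentiable functions in integrated form. -/
lemma segOn_of_hasFDerivAt {B : Set (SpT n)} (hB : Convex ℝ B) {v : SpT n → ℝ}
    {V : Fin n → SpT n → ℝ} (hV : ∀ i, Continuous (V i))
    (h : ∀ x t, (x, t) ∈ B → HasFDerivAt (fun x => v (x, t)) (grad V t x) x) : SegOn B v V := by
  rintro ⟨x, t⟩ y hz hz'
  have hd : ∀ σ ∈ uIcc (0 : ℝ) 1, HasDerivAt (fun σ : ℝ => v ((x, t) + σ • ((y, 0) : SpT n)))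
      (∑ i, y i * V i ((x, t) + σ • ((y, 0) : SpT n))) σ := by
    intro σ hσ
    rw [uIcc_of_le zero_le_one] at hσ
    have hmem := hB.add_smul_mem hz hz' hσ
    have e : (x, t) + σ • ((y, 0) : SpT n) = (x + σ • y, t) := by simp
    rw [e] at hmem ⊢
    have hl : HasDerivAt (fun σ : ℝ => x + σ • y) y σ := by
      simpa using ((hasDerivAt_id σ).smul_const y).const_add x
    have := (h _ _ hmem).comp_hasDerivAt σ hl
    rw [grad_apply] at this
    simpa [Function.comp_def] using this
  have hc : Continuous fun σ : ℝ => ∑ i, y i * V i ((x, t) + σ • ((y, 0) : SpT n)) := by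
    refine continuous_finsetSum _ fun i _ => ?_
    have := hV i
    fun_prop
  rw [intervalIntegral.integral_eq_sub_of_hasDerivAt hd (hc.intervalIntegrable _ _)]
  simp

lemma SegOn.cv {k v : SpT n → ℝ} {V : Fin n → SpT n → ℝ} {z₀ : SpT n} {r R C : ℝ} {D : Fin n → ℝ}
    (hk : Integrable k) (hkR : SuppIn R k) (hv : BM v C) (hV : ∀ i, BM (V i) (D i))
    (h : SegOn (Metric.ball z₀ (r + R)) v V) :
    SegOn (Metric.ball z₀ r) (cv k v) fun i => cv k (V i) := by
  intro z y hz hz'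
  have hbm : BM (fun w => ∑ i, y i * V i w) (∑ i, |y i| * D i) := by
    refine ⟨Finset.measurable_sum _ fun i _ => (hV i).1.const_mul _, fun w => ?_⟩
    refine (Finset.abs_sum_le_sum_abs _ _).trans (Finset.sum_le_sum fun i _ => ?_)
    rw [abs_mul]
    exact mul_le_mul_of_nonneg_left ((hV i).2 w) (abs_nonneg _)
  have key := cv_function_segment hk hkR hv hbm (h := ((y, 0) : SpT n)) (z := z) fun w hw => by
    refine h w y ?_ ?_
    · rw [Metric.mem_ball] at *
      linarith [dist_triangle w z z₀]
    · rw [Metric.mem_ball] at *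
      have : dist (w + (y, 0)) (z + (y, 0)) = dist w z := dist_add_right _ _ _
      linarith [dist_triangle (w + (y, 0)) (z + (y, 0)) z₀]
  rw [key]
  congr 1; ext σ
  have hb : ∀ i, BM (fun w => y i * V i w) (|y i| * D i) := fun i =>
    ⟨(hV i).1.const_mul _, fun w => by
      rw [abs_mul]; exact mul_le_mul_of_nonneg_left ((hV i).2 w) (abs_nonneg _)⟩
  rw [cv_sum_right _ hk hb]
  exact Finset.sum_congr rfl fun i _ => cv_smul_right _ _ _ _

lemma segOn_kernel {k F : SpT n → ℝ} {K : Fin n → SpT n → ℝ} {C : ℝ} (hk : Integrable k)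
    (hK : ∀ i, Integrable (K i)) (hKm : ∀ i, Measurable (K i)) (hF : BM F C)
    (h : SegOn univ k K) : SegOn univ (cv k F) fun i => cv (K i) F := by
  intro z y _ _
  have hi : ∀ i, Integrable fun w => y i * K i w := fun i => (hK i).const_mul _
  have key := cv_kernel_segment (k' := fun w => ∑ i, y i * K i w) hk
    (integrable_finsetSum _ fun i _ => hi i)
    (Finset.measurable_sum _ fun i _ => (hKm i).const_mul _) hF ((y, 0) : SpT n)
    (fun w => h w y trivial trivial) z
  rw [key]
  congr 1; ext σ
  rw [cv_sum_left _ hi hF]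
  exact Finset.sum_congr rfl fun i _ => cv_smul_left _ _ _ _

lemma SegOn.add {B : Set (SpT n)} {v w : SpT n → ℝ} {V W : Fin n → SpT n → ℝ}
    (hV : ∀ i, Continuous (V i)) (hW : ∀ i, Continuous (W i)) (h : SegOn B v V)
    (h' : SegOn B w W) : SegOn B (fun z => v z + w z) fun i z => V i z + W i z := by
  intro z y hz hz'
  have c : ∀ U : Fin n → SpT n → ℝ, (∀ i, Continuous (U i)) →
      Continuous fun σ : ℝ => ∑ i, y i * U i (z + σ • ((y, 0) : SpT n)) := fun U hU => by
    refine continuous_finsetSum _ fun i _ => ?_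
    have := hU i
    fun_prop
  simp only [mul_add, Finset.sum_add_distrib]
  rw [intervalIntegral.integral_add ((c V hV).intervalIntegrable _ _)
    ((c W hW).intervalIntegrable _ _), ← h z y hz hz', ← h' z y hz hz']
  ring

lemma SegOn.mono {B B' : Set (SpT n)} {v : SpT n → ℝ} {V : Fin n → SpT n → ℝ} (h : SegOn B v V)
    (hB : B' ⊆ B) : SegOn B' v V := fun z y hz hz' => h z y (hB hz) (hB hz')

lemma SegOn.congr {B : Set (SpT n)} {v w : SpT n → ℝ} {V : Fin n → SpT n → ℝ} (h : SegOn B v V)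
    (hB : ∀ z ∈ B, w z = v z) : SegOn B w V := fun z y hz hz' => by
  rw [hB z hz, hB _ hz', h z y hz hz']

lemma hasFDerivAt_slice {f : SpT n → ℝ} (hf : Differentiable ℝ f) (x : Sp n) (t : ℝ) :
    HasFDerivAt (fun x => f (x, t)) (grad (fun i => dd (ei i) f) t x) x := by
  have h1 := (hf (x, t)).hasFDerivAt
  have h2 : HasFDerivAt (fun y : Sp n => (y, t)) (ContinuousLinearMap.inl ℝ (Sp n) ℝ) x :=
    hasFDerivAt_prodMk_left x t
  have h3 := HasFDerivAt.comp (g := f) (f := fun y : Sp n => (y, t)) x h1 h2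
  have e : (fderiv ℝ f (x, t)).comp (ContinuousLinearMap.inl ℝ (Sp n) ℝ) =
      grad (fun i => dd (ei i) f) t x := by
    refine ContinuousLinearMap.ext fun y => ?_
    rw [grad_apply]
    simp only [ContinuousLinearMap.comp_apply, ContinuousLinearMap.inl_apply]
    rw [fderiv_space]
  rwa [e] at h3

lemma IsTest.segOn {R : ℝ} {ρ : SpT n → ℝ} (h : IsTest R ρ) :
    SegOn univ ρ fun i => _root_.dd (ei i) ρ :=
  segOn_of_hasFDerivAt convex_univ (fun i => (h.dd (ei i)).1.continuous) fun x t _ =>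
    hasFDerivAt_slice (smooth_diff h.1) x t

end Segments

section InteriorRegularity

variable {n : ℕ}

lemma contDiff_test_cv {R C : ℝ} {ρ v : SpT n → ℝ} (h : IsTest R ρ) (hv : BM v C) :
    ContDiff ℝ (⊤ : ℕ∞) (cv ρ v) := by
  rw [cv_comm]
  exact contDiff_cv_test hv.locallyIntegrable h

lemma dd_test_cv {R C : ℝ} {ρ v : SpT n → ℝ} (h : IsTest R ρ) (hv : BM v C) (e : SpT n) :
    dd e (cv ρ v) = cv (dd e ρ) v := by
  rw [cv_comm, dd_cv_test hv.locallyIntegrable h, cv_comm]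

lemma grad_single (V : Fin n → SpT n → ℝ) (t : ℝ) (x : Sp n) (i : Fin n) :
    grad V t x (EuclideanSpace.single i 1) = V i (x, t) := by
  rw [grad_apply]
  simp

lemma SegOn.dd_eq {B : Set (SpT n)} (hB : IsOpen B) {F : SpT n → ℝ} {V : Fin n → SpT n → ℝ}
    (hV : ∀ i, Continuous (V i)) (hF : Differentiable ℝ F) (h : SegOn B F V) {z : SpT n}
    (hz : z ∈ B) (i : Fin n) : dd (ei i) F z = V i z := by
  have h1 := h.hasFDerivAt hB hV (x := z.1) (t := z.2) hz
  have h2 := hasFDerivAt_slice hF z.1 z.2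
  have := congrArg (fun L : Sp n →L[ℝ] ℝ => L (EuclideanSpace.single i 1)) (h2.unique h1)
  simpa only [grad_single] using this

lemma segOn_comp {h : ℝ → ℝ} (hh : ContDiff ℝ 1 h) {v : SpT n → ℝ} {V : Fin n → SpT n → ℝ}
    (hv : Continuous v) (hV : ∀ i, Continuous (V i)) (hs : SegOn univ v V) :
    SegOn univ (fun z => h (v z)) fun i z => deriv h (v z) * V i z := by
  have hd : Continuous (deriv h) := hh.continuous_deriv le_rfl
  refine segOn_of_hasFDerivAt convex_univ (fun i => (hd.comp hv).mul (hV i)) fun x t _ => ?_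
  have h1 := hs.hasFDerivAt isOpen_univ hV (x := x) (t := t) trivial
  have h2 := ((hh.differentiable one_ne_zero) (v (x, t))).hasDerivAt.comp_hasFDerivAt x h1
  have e : deriv h (v (x, t)) • grad V t x =
      grad (fun i z => deriv h (v z) * V i z) t x := by
    refine ContinuousLinearMap.ext fun y => ?_
    simp only [_root_.smul_apply, grad_apply, smul_eq_mul, Finset.mul_sum]
    exact Finset.sum_congr rfl fun i _ => by ring
  rwa [e] at h2

lemma BM.add {G : Type*} [MeasurableSpace G] {f g : G → ℝ} {C D : ℝ} (hf : BM f C) (hg : BM g D) :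
    BM (fun z => f z + g z) (C + D) :=
  ⟨hf.1.add hg.1, fun z => (abs_add_le _ _).trans (add_le_add (hf.2 z) (hg.2 z))⟩

lemma BM.mul {G : Type*} [MeasurableSpace G] {f g : G → ℝ} {C D : ℝ} (hf : BM f C) (hg : BM g D) :
    BM (fun z => f z * g z) (C * D) :=
  ⟨hf.1.mul hg.1, fun z => by
    rw [abs_mul]
    exact mul_le_mul (hf.2 z) (hg.2 z) (abs_nonneg _) ((abs_nonneg _).trans (hf.2 z))⟩

lemma BM.sum {G ι : Type*} [MeasurableSpace G] [Fintype ι] {f : ι → G → ℝ} {C : ι → ℝ}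
    (hf : ∀ i, BM (f i) (C i)) : BM (fun z => ∑ i, f i z) (∑ i, C i) :=
  ⟨Finset.measurable_sum _ fun i _ => (hf i).1, fun z =>
    (Finset.abs_sum_le_sum_abs _ _).trans (Finset.sum_le_sum fun i _ => (hf i).2 z)⟩

lemma BM.exists_comp {G : Type*} [MeasurableSpace G] {h : ℝ → ℝ} (hh : Continuous h) {v : G → ℝ}
    {C : ℝ} (hv : BM v C) : ∃ D, BM (fun z => h (v z)) D := by
  obtain ⟨D, hD⟩ := (isCompact_Icc (a := -C) (b := C)).exists_bound_of_continuousOn hh.continuousOn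
  exact ⟨D, hh.measurable.comp hv.1, fun z => hD _ (abs_le.1 (hv.2 z))⟩

/-- A twice spatially differentiable weak solution has a classical time derivative. -/
lemma time_segment {R C D : ℝ} (hR : 0 < R) {v f S : SpT n → ℝ} {V : Fin n → SpT n → ℝ}
    {W : Fin n → Fin n → SpT n → ℝ} {E : Fin n → ℝ} {E' : Fin n → Fin n → ℝ} {z₀ : SpT n}
    (hv : BM v C) (hf : BM f D) (hVb : ∀ i, BM (V i) (E i)) (hWb : ∀ i j, BM (W i j) (E' i j))
    (hSc : Continuous S)
    (hV : SegOn (Metric.ball z₀ (3 * R)) v V) (hW : ∀ i, SegOn (Metric.ball z₀ (3 * R)) (V i) (W i))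
    (hvc : ∀ z ∈ Metric.ball z₀ R, ContinuousAt v z)
    (hw : ∀ z ∈ Metric.ball z₀ (2 * R), ∀ ρ, IsTest R ρ → cv (HL ρ) v z = cv ρ f z)
    (hS : ∀ z ∈ Metric.ball z₀ (3 * R), ∑ i, W i i z + f z = S z) {τ : ℝ} (hτ : |τ| < R) :
    v (z₀ + (0, τ)) - v z₀ = ∫ σ in (0 : ℝ)..1, τ * S (z₀ + σ • ((0, τ) : SpT n)) := by
  obtain ⟨ρ, h1, h2, h3, h4⟩ := exists_mollifier_seq (G := SpT n)
  set S' : SpT n → ℝ := fun z => ∑ i, W i i z + f z with hS'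
  have hS'b := (BM.sum fun i => hWb i i).add hf
  have hball : ∀ σ : ℝ, σ ∈ Icc (0 : ℝ) 1 → z₀ + σ • ((0, τ) : SpT n) ∈ Metric.ball z₀ R := by
    intro σ hσ
    rw [Metric.mem_ball, dist_eq_norm, add_sub_cancel_left, norm_smul]
    have : ‖((0, τ) : SpT n)‖ = |τ| := by simp [Prod.norm_def]
    rw [this, norm_eq_abs, abs_of_nonneg hσ.1]
    exact (mul_le_of_le_one_left (abs_nonneg _) hσ.2).trans_lt hτ
  have hev : ∀ᶠ m : ℕ in atTop, 1 / ((m : ℝ) + 1) ≤ R := by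
    filter_upwards [(tendsto_one_div_add_atTop_nhds_zero_nat (𝕜 := ℝ)).eventually
      (Iio_mem_nhds hR)] with m hm
    exact le_of_lt hm
  have key : ∀ᶠ m : ℕ in atTop, cv (ρ m) v (z₀ + (0, τ)) - cv (ρ m) v z₀ =
      ∫ σ in (0 : ℝ)..1, τ * cv (ρ m) S' (z₀ + σ • ((0, τ) : SpT n)) := by
    filter_upwards [hev] with m hm
    have hT := (h1 m).mono hm
    have hi := hT.integrable
    have a1 : SegOn (Metric.ball z₀ (2 * R)) (cv (ρ m) v) fun i => cv (ρ m) (V i) :=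
      SegOn.cv hi hT.2 hv hVb (by convert hV using 2; ring)
    have a2 : ∀ i, SegOn (Metric.ball z₀ (2 * R)) (cv (ρ m) (V i)) fun j => cv (ρ m) (W i j) :=
      fun i => SegOn.cv hi hT.2 (hVb i) (hWb i) (by convert hW i using 2; ring)
    have b1 : ∀ z ∈ Metric.ball z₀ (2 * R), ∀ i, cv (dd (ei i) (ρ m)) v z = cv (ρ m) (V i) z :=
      fun z hz i => by
        rw [← dd_test_cv hT hv]
        exact a1.dd_eq Metric.isOpen_ball (fun i => continuous_cv hi (hVb i))
          (smooth_diff (contDiff_test_cv hT hv)) hz i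
    have b2 : ∀ z ∈ Metric.ball z₀ (2 * R), ∀ i,
        cv (dd (ei i) (dd (ei i) (ρ m))) v z = cv (ρ m) (W i i) z := fun z hz i => by
      rw [← dd_test_cv (hT.dd _) hv]
      exact ((a2 i).congr fun z hz => b1 z hz i).dd_eq Metric.isOpen_ball
        (fun j => continuous_cv hi (hWb i j))
        (smooth_diff (contDiff_test_cv (hT.dd _) hv)) hz i
    have b3 : ∀ z ∈ Metric.ball z₀ (2 * R), dd et (cv (ρ m) v) z = cv (ρ m) S' z := fun z hz => by
      have c1 : cv (HL (ρ m)) v z = cv (dd et (ρ m)) v z - cv (sl (ρ m)) v z :=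
        cv_sub_left (hT.dd et).integrable hT.sl.integrable hv z
      have c2 : cv (sl (ρ m)) v z = ∑ i, cv (dd (ei i) (dd (ei i) (ρ m))) v z :=
        cv_sum_left _ (fun i => ((hT.dd _).dd _).integrable) hv z
      rw [hw z hz _ hT] at c1
      rw [dd_test_cv hT hv, cv_add_right hi (BM.sum fun i => hWb i i) hf,
        cv_sum_right _ hi (fun i => hWb i i)]
      rw [c2, Finset.sum_congr rfl fun i _ => b2 z hz i] at c1
      linarith
    have hd : ∀ σ ∈ uIcc (0 : ℝ) 1, HasDerivAt
        (fun σ : ℝ => cv (ρ m) v (z₀ + σ • ((0, τ) : SpT n)))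
        (τ * cv (ρ m) S' (z₀ + σ • ((0, τ) : SpT n))) σ := by
      intro σ hσ
      rw [uIcc_of_le zero_le_one] at hσ
      have hl : HasDerivAt (fun σ : ℝ => z₀ + σ • ((0, τ) : SpT n)) ((0, τ) : SpT n) σ := by
        simpa using ((hasDerivAt_id σ).smul_const ((0, τ) : SpT n)).const_add z₀
      have := ((smooth_diff (contDiff_test_cv hT hv))
        (z₀ + σ • ((0, τ) : SpT n))).hasFDerivAt.comp_hasDerivAt σ hl
      have e : ((0, τ) : SpT n) = τ • et := by simp [et]
      rw [← b3 _ (Metric.ball_subset_ball (by linarith) (hball σ hσ))]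
      simp only [Function.comp_def] at this
      have e2 := (fderiv ℝ (cv (ρ m) v) (z₀ + σ • ((0, τ) : SpT n))).map_smul τ et
      rw [← e] at e2
      exact this.congr_deriv e2
    have hc : Continuous fun σ : ℝ => τ * cv (ρ m) S' (z₀ + σ • ((0, τ) : SpT n)) := by
      have := continuous_cv hi hS'b
      fun_prop
    rw [intervalIntegral.integral_eq_sub_of_hasDerivAt hd (hc.intervalIntegrable _ _)]
    simp
  have l1 := h4 v C (z₀ + (0, τ)) hv (hvc _ (by simpa using hball 1 (by simp)))
  have l2 := h4 v C z₀ hv (hvc _ (by simpa using hball 0 (by simp)))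
  refine tendsto_nhds_unique ((l1.sub l2).congr' key) ?_
  refine intervalIntegral.tendsto_integral_filter_of_dominated_convergence
    (fun _ => |τ| * (∑ i, E' i i + D)) ?_ ?_ (by simp) ?_
  · refine Eventually.of_forall fun m => ?_
    have := continuous_cv (h1 m).integrable hS'b
    exact (by fun_prop : Continuous _).aestronglyMeasurable
  · refine Eventually.of_forall fun m => Eventually.of_forall fun σ _ => ?_
    rw [norm_mul, norm_eq_abs, norm_eq_abs]
    refine mul_le_mul_of_nonneg_left ?_ (abs_nonneg _)
    refine (abs_cv_le (h1 m).integrable hS'b _).trans_eq ?_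
    simp only [abs_of_nonneg (h2 m _), h3 m, mul_one]
  · refine Eventually.of_forall fun σ hσ => ?_
    rw [uIoc_of_le zero_le_one] at hσ
    have hm := Metric.ball_subset_ball (by linarith : R ≤ 3 * R) (hball σ ⟨hσ.1.le, hσ.2⟩)
    rw [← hS _ hm]
    refine (h4 S' _ _ hS'b ?_).const_mul τ
    refine hSc.continuousAt.congr ?_
    filter_upwards [Metric.isOpen_ball.mem_nhds hm] with w hw using (hS w hw).symm

/-- Continuous weak solutions of `v_t = Δ v + h(v)` are classical. -/
lemma interior_regularity {R C D : ℝ} (hR : 0 < R) {v f : SpT n → ℝ} {h : ℝ → ℝ}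
    (hh : ContDiff ℝ 1 h) (hv : BM v C) (hf : BM f D) {z₀ : SpT n}
    (hvc : ∀ z ∈ Metric.ball z₀ (4 * R), ContinuousAt v z)
    (hw : ∀ z ∈ Metric.ball z₀ (4 * R), ∀ ρ, IsTest (2 * R) ρ → cv (HL ρ) v z = cv ρ f z)
    (hfv : ∀ z ∈ Metric.ball z₀ (4 * R), f z = h (v z)) :
    ContDiffAt ℝ 2 (fun x => v (x, z₀.2)) z₀.1 ∧
      HasDerivAt (fun t => v (z₀.1, t)) (lap (fun x => v (x, z₀.2)) z₀.1 + f z₀) z₀.2 := by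
  obtain ⟨J, κ, Ji, hP⟩ := exists_param (n := n) hR
  have hsub : Metric.ball z₀ (3 * R) ⊆ Metric.ball z₀ (4 * R) :=
    Metric.ball_subset_ball (by linarith)
  have hrep : ∀ z ∈ Metric.ball z₀ (4 * R), v z = cv J f z + cv κ v z := fun z hz =>
    hP.rep hR hv hf (fun ρ hρ => hw z hz ρ (hρ.mono (by linarith))) (hvc z hz)
  set v' : SpT n → ℝ := fun z => cv J f z + cv κ v z with hv'
  have hκi := hP.test.integrable
  have hv'c : Continuous v' := (continuous_cv hP.integrable hf).add (continuous_cv hκi hv)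
  have hv'b := (bm_cv hP.integrable hf).add (bm_cv hκi hv)
  set V : Fin n → SpT n → ℝ := fun i z => cv (Ji i) f z + cv (dd (ei i) κ) v z with hV
  have hκ1 : ∀ i, Integrable (dd (ei i) κ) := fun i => (hP.test.dd _).integrable
  have hVc : ∀ i, Continuous (V i) := fun i =>
    (continuous_cv (hP.integrable_partial i) hf).add (continuous_cv (hκ1 i) hv)
  have hVb := fun i => (bm_cv (hP.integrable_partial i) hf).add (bm_cv (hκ1 i) hv)
  have hJs : SegOn univ J Ji := fun z y _ _ => hP.segment y z
  have hVs : SegOn univ v' V :=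
    (segOn_kernel hP.integrable hP.integrable_partial hP.measurable_partial hf hJs).add
      (fun i => continuous_cv (hP.integrable_partial i) hf) (fun i => continuous_cv (hκ1 i) hv)
      (segOn_kernel hκi hκ1 (fun i => (hP.test.dd _).1.continuous.measurable) hv hP.test.segOn)
  have hdc : Continuous (deriv h) := hh.continuous_deriv le_rfl
  obtain ⟨H1, hH1⟩ := BM.exists_comp hdc hv'b
  obtain ⟨H0, hH0⟩ := BM.exists_comp hh.continuous hv'b
  set g : Fin n → SpT n → ℝ := fun i z => deriv h (v' z) * V i z with hg
  have hgb := fun i => hH1.mul (hVb i)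
  have hgs : SegOn (Metric.ball z₀ (4 * R)) f g :=
    ((segOn_comp hh hv'c hVc hVs).mono (subset_univ _)).congr fun z hz => by
      rw [hfv z hz, hrep z hz]
  set W : Fin n → Fin n → SpT n → ℝ :=
    fun i j z => cv (Ji i) (g j) z + cv (dd (ei j) (dd (ei i) κ)) v z with hW
  have hκ2 : ∀ i j, Integrable (dd (ei j) (dd (ei i) κ)) := fun i j =>
    ((hP.test.dd _).dd _).integrable
  have hWc : ∀ i j, Continuous (W i j) := fun i j =>
    (continuous_cv (hP.integrable_partial i) (hgb j)).add (continuous_cv (hκ2 i j) hv)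
  have hWb := fun i j => (bm_cv (hP.integrable_partial i) (hgb j)).add (bm_cv (hκ2 i j) hv)
  have hWs : ∀ i, SegOn (Metric.ball z₀ (3 * R)) (V i) (W i) := fun i =>
    (SegOn.cv (hP.integrable_partial i) (hP.supp_partial i) hf hgb
      (by convert hgs using 2; ring)).add
      (fun j => continuous_cv (hP.integrable_partial i) (hgb j))
      (fun j => continuous_cv (hκ2 i j) hv)
      ((segOn_kernel (hκ1 i) (hκ2 i) (fun j => ((hP.test.dd _).dd _).1.continuous.measurable) hv
        (hP.test.dd _).segOn).mono (subset_univ _))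
  have hVs' : SegOn (Metric.ball z₀ (3 * R)) v V :=
    (hVs.mono (subset_univ _)).congr fun z hz => hrep z (hsub hz)
  obtain ⟨x₀, t₀⟩ := z₀
  have hslice : ∀ x ∈ Metric.ball x₀ (3 * R), (x, t₀) ∈ Metric.ball (x₀, t₀) (3 * R) := by
    intro x hx
    rw [Metric.mem_ball, Prod.dist_eq] at *
    simpa [hR] using hx
  have hx₀ : x₀ ∈ Metric.ball x₀ (3 * R) := Metric.mem_ball_self (by linarith)
  have d1 : ∀ x ∈ Metric.ball x₀ (3 * R), HasFDerivAt (fun x => v (x, t₀)) (grad V t₀ x) x :=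
    fun x hx => hVs'.hasFDerivAt Metric.isOpen_ball hVc (hslice x hx)
  have d2 : ∀ i, ∀ x ∈ Metric.ball x₀ (3 * R),
      HasFDerivAt (fun x => V i (x, t₀)) (grad (W i) t₀ x) x :=
    fun i x hx => (hWs i).hasFDerivAt Metric.isOpen_ball (hWc i) (hslice x hx)
  have hC2 : ContDiffOn ℝ (1 + 1) (fun x => v (x, t₀)) (Metric.ball x₀ (3 * R)) := by
    rw [contDiffOn_succ_iff_fderiv_of_isOpen Metric.isOpen_ball]
    refine ⟨fun x hx => (d1 x hx).differentiableAt.differentiableWithinAt, by simp, ?_⟩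
    have : ContDiffOn ℝ 1 (grad V t₀) (Metric.ball x₀ (3 * R)) := by
      unfold grad
      refine ContDiffOn.sum fun i _ => ContDiffOn.fun_smul ?_ contDiffOn_const
      exact contDiffOn_one_of_hasFDerivAt (continuous_grad (hWc i) t₀) Metric.isOpen_ball (d2 i)
    exact this.congr fun x hx => (d1 x hx).fderiv
  have hlap : lap (fun x => v (x, t₀)) x₀ = ∑ i, W i i (x₀, t₀) := by
    unfold lap
    refine Finset.sum_congr rfl fun i _ => ?_
    have : (fun y => fderiv ℝ (fun x => v (x, t₀)) y (EuclideanSpace.single i 1)) =ᶠ[nhds x₀]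
        fun y => V i (y, t₀) := by
      filter_upwards [Metric.isOpen_ball.mem_nhds hx₀] with y hy
      rw [(d1 y hy).fderiv, grad_single]
    rw [this.fderiv_eq, (d2 i x₀ hx₀).fderiv, grad_single]
  refine ⟨by simpa [one_add_one_eq_two] using hC2.contDiffAt (Metric.isOpen_ball.mem_nhds hx₀), ?_⟩
  set S : SpT n → ℝ := fun z => ∑ i, W i i z + h (v' z) with hS
  have hSc : Continuous S :=
    (continuous_finsetSum _ fun i _ => hWc i i).add (hh.continuous.comp hv'c)
  have hseg : ∀ τ : ℝ, |τ| < R → v ((x₀, t₀) + (0, τ)) - v (x₀, t₀) =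
      ∫ σ in (0 : ℝ)..1, τ * S ((x₀, t₀) + σ • ((0, τ) : SpT n)) := fun τ hτ =>
    time_segment hR hv hf hVb hWb hSc hVs' hWs
      (fun z hz => hvc z (Metric.ball_subset_ball (by linarith) hz))
      (fun z hz ρ hρ => hw z (Metric.ball_subset_ball (by linarith) hz) ρ
        (hρ.mono (by linarith)))
      (fun z hz => by
        have : f z = h (v' z) := (hfv z (hsub hz)).trans (congrArg h (hrep z (hsub hz)))
        rw [this]) hτ
  have hz₀ : (x₀, t₀) ∈ Metric.ball (x₀, t₀) (4 * R) := Metric.mem_ball_self (by linarith)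
  have e0 : lap (fun x => v (x, t₀)) x₀ + f (x₀, t₀) = S (x₀, t₀) := by
    have : f (x₀, t₀) = h (v' (x₀, t₀)) := (hfv _ hz₀).trans (congrArg h (hrep _ hz₀))
    rw [hlap, this]
  show HasDerivAt (fun t => v (x₀, t)) (lap (fun x => v (x, t₀)) x₀ + f (x₀, t₀)) t₀
  rw [e0, hasDerivAt_iff_hasFDerivAt]
  refine hasFDerivAt_of_segment (D := fun t => ContinuousLinearMap.toSpanSingleton ℝ (S (x₀, t)))
    ?_ ?_
  · have : Continuous fun t : ℝ => S (x₀, t) := by fun_prop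
    exact (ContinuousLinearMap.toSpanSingletonCLE (𝕜 := ℝ) (E := ℝ)).continuous.comp this
  · filter_upwards [Metric.ball_mem_nhds (0 : ℝ) hR] with τ hτ
    have := hseg τ (by simpa using hτ)
    simpa using this

end InteriorRegularity

section Duhamel

variable {n : ℕ}

/-- The heat potential only depends on the past of the source. -/
lemma cv_hkN_congr_past (N : ℝ) {f g : SpT n → ℝ} {z : SpT n}
    (h : ∀ w : SpT n, w.2 < z.2 → f w = g w) : cv (hkN N) f z = cv (hkN N) g z := by
  unfold cv
  congr 1; ext w
  by_cases hw : 0 < w.2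
  · rw [h (z - w) (by simpa using hw)]
  · have : w = (w.1, w.2) := rfl
    rw [this, hkN_of_nonpos N (not_lt.1 hw)]; simp

/-- Time-disintegrated heat potential of a source supported in positive times. -/
lemma cv_hkN_eq {N C : ℝ} (hN : 0 < N) {F S : SpT n → ℝ} (hF : BM F C) {x : Sp n} {t : ℝ}
    (ht : 0 ≤ t) (h0 : ∀ w : SpT n, w.2 < 0 → F w = 0)
    (hS : ∀ w : SpT n, 0 ≤ w.2 → w.2 ≤ t → F w = S w) :
    cv (hkN N) F (x, t) =
      ∫ r in (0 : ℝ)..t, exp (-N * r) * ∫ z, gs z * S (x - √r • z, t - r) := by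
  have h1 := integral_hkN_mul N (integrable_cv (integrable_hkN hN) hF (x, t))
  unfold cv
  rw [h1, intervalIntegral.integral_of_le ht,
    setIntegral_eq_of_subset_of_forall_sdiff_eq_zero measurableSet_Ioi
      (fun r hr => hr.1 : Ioc 0 t ⊆ Ioi (0 : ℝ))]
  · refine setIntegral_congr_fun measurableSet_Ioc fun r hr => ?_
    have : ∀ z : Sp n, F ((x, t) - (√r • z, r)) = S (x - √r • z, t - r) := fun z =>
      hS (x - √r • z, t - r) (by show 0 ≤ t - r; linarith [hr.2]) (by show t - r ≤ t; linarith [hr.1])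
    simp only [this]
  · intro r hr
    have hr' : t < r := by
      by_contra hc
      exact hr.2 ⟨hr.1, not_lt.1 hc⟩
    have : ∀ z : Sp n, F ((x, t) - (√r • z, r)) = 0 := fun z =>
      h0 _ (by show t - r < 0; linarith)
    simp only [this, mul_zero, integral_zero]

lemma fderiv_exp_mul_comp_sub (N : ℝ) {f : SpT n → ℝ} (hf : ContDiff ℝ 1 f) (z w : SpT n) :
    ‖fderiv ℝ (fun w => exp (-N * w.2) * f (z - w)) w‖ ≤
      exp (-N * w.2) * (|N| * |f (z - w)| + ‖fderiv ℝ f (z - w)‖) := by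
  refine ContinuousLinearMap.opNorm_le_bound _ (by positivity) fun e => ?_
  have := dd_exp_mul_comp_sub N hf z e w
  unfold dd at this
  rw [this, norm_neg, norm_mul, norm_eq_abs, abs_of_pos (exp_pos _), mul_assoc (exp _)]
  refine mul_le_mul_of_nonneg_left ?_ (exp_pos _).le
  refine (norm_add_le _ _).trans ?_
  have h1 : |e.2| ≤ ‖e‖ := norm_snd_le e
  have h2 := (fderiv ℝ f (z - w)).le_opNorm e
  have h3 : ‖N * e.2 * f (z - w)‖ = |N| * |f (z - w)| * |e.2| := by
    simp only [norm_eq_abs, abs_mul]; ring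
  rw [h3, add_mul]
  exact add_le_add (mul_le_mul_of_nonneg_left h1 (by positivity)) h2

/-- Duhamel's formula, with killing rate `N`, for a `C²` function. -/
lemma duhamel {N T K C : ℝ} (hN : 0 < N) {W F : SpT n → ℝ} (hW : ContDiff ℝ 2 W)
    (h0 : ∀ y, ∀ r ∈ Icc 0 T, |W (y, r)| ≤ K)
    (h1 : ∀ y, ∀ r ∈ Icc 0 T, ‖fderiv ℝ W (y, r)‖ ≤ K)
    (h2 : ∀ y, ∀ r ∈ Icc 0 T, ∀ i, |dd (ei i) (dd (ei i) W) (y, r)| ≤ K)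
    (hF : BM F C) (hFn : ∀ w : SpT n, w.2 < 0 → F w = 0)
    (hFp : ∀ w : SpT n, w.2 ∈ Icc 0 T → F w = HL W w + N * W w) {x : Sp n} {t : ℝ}
    (ht : t ∈ Icc 0 T) :
    W (x, t) = pN N (fun y => W (y, 0)) (x, t) + cv (hkN N) F (x, t) := by
  have hW1 : ContDiff ℝ 1 W := hW.of_le (by norm_num)
  set χ : SpT n → ℝ := fun w => exp (-N * w.2) * W ((x, t) - w) with hχ
  have hχc : ContDiff ℝ 2 χ := by
    refine ContDiff.mul ?_ (hW.comp (contDiff_const.sub contDiff_id))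
    exact Real.contDiff_exp.comp (contDiff_const.mul contDiff_snd)
  have hK : 0 ≤ K := (abs_nonneg _).trans (h0 0 t ht)
  have hr' : ∀ r ∈ Icc 0 t, t - r ∈ Icc 0 T := fun r hr => ⟨by linarith [hr.2], by linarith [hr.1, ht.2]⟩
  have hexp : ∀ r ∈ Icc 0 t, exp (-N * r) ≤ 1 := fun r hr =>
    exp_le_one_iff.2 (by nlinarith [hr.1])
  have hdi : ∀ i, dd (ei i) χ = fun w => exp (-N * w.2) * (fun u => -dd (ei i) W u) ((x, t) - w) := by
    intro i; ext w
    rw [hχ, dd_exp_mul_comp_sub N hW1]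
    simp [ei]
  have hdW : ∀ i, ContDiff ℝ 1 (dd (ei i) W) := fun i => contDiff_dd (m := 1) hW (by norm_num) (ei i)
  have hdii : ∀ i w, dd (ei i) (dd (ei i) χ) w =
      exp (-N * w.2) * dd (ei i) (dd (ei i) W) ((x, t) - w) := by
    intro i w
    rw [hdi, dd_exp_mul_comp_sub N (hdW i).neg]
    have : dd (ei i) (fun u => -dd (ei i) W u) ((x, t) - w) =
        -dd (ei i) (dd (ei i) W) ((x, t) - w) := by
      show fderiv ℝ (fun u => -dd (ei i) W u) _ _ = _
      rw [fderiv_fun_neg]; rfl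
    rw [this]; simp [ei]
  have hsl : ∀ w, sl χ w = exp (-N * w.2) * sl W ((x, t) - w) := fun w => by
    unfold sl; rw [Finset.mul_sum]; exact Finset.sum_congr rfl fun i _ => hdii i w
  have hdt : ∀ w, dd et χ w = -(exp (-N * w.2) * (N * W ((x, t) - w) + dd et W ((x, t) - w))) :=
    fun w => by rw [hχ, dd_exp_mul_comp_sub N hW1]; simp [et]
  have key := dynkin hχc (T := t) (C := N * K + K) ht.1 ?_ ?_ ?_
  · have e1 : χ 0 = W (x, t) := by simp [hχ]
    have e2 : (∫ z, gs z * χ (√t • z, t)) = pN N (fun y => W (y, 0)) (x, t) := by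
      unfold pN
      have ht' : 0 ≤ (x, t).2 := ht.1
      rw [if_pos ht', ← integral_const_mul]
      congr 1; ext z
      simp only [hχ, Prod.mk_sub_mk, sub_self]
      ring
    have e3 := cv_hkN_eq (x := x) (S := fun w => HL W w + N * W w) hN hF ht.1 hFn
      fun w hw hw' => hFp w ⟨hw, hw'.trans ht.2⟩
    rw [e1, e2] at key
    have e4 : (∫ r in (0 : ℝ)..t, ∫ z, gs z * (dd et χ (√r • z, r) + sl χ (√r • z, r))) =
        -cv (hkN N) F (x, t) := by
      rw [e3, ← intervalIntegral.integral_neg]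
      congr 1; ext r
      rw [← integral_const_mul, ← integral_neg]
      congr 1; ext z
      rw [hdt, hsl]
      simp only [HL, Prod.mk_sub_mk]
      ring
    rw [e4] at key
    linarith
  · intro y r hr
    simp only [hχ]
    rw [abs_mul, abs_of_pos (exp_pos _)]
    have := h0 (x - y) (t - r) (hr' r hr)
    have h3 : exp (-N * r) * |W (x - y, t - r)| ≤ 1 * K :=
      mul_le_mul (hexp r hr) this (abs_nonneg _) zero_le_one
    simp only [Prod.mk_sub_mk]
    nlinarith
  · intro y r hr
    refine (fderiv_exp_mul_comp_sub N hW1 (x, t) (y, r)).trans ?_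
    have a0 := h0 (x - y) (t - r) (hr' r hr)
    have a1 := h1 (x - y) (t - r) (hr' r hr)
    rw [abs_of_pos hN]
    simp only [Prod.mk_sub_mk]
    refine (mul_le_mul (hexp r hr) (add_le_add (mul_le_mul_of_nonneg_left a0 hN.le) a1)
      (by positivity) zero_le_one).trans_eq (one_mul _)
  · intro y r hr i
    rw [hdii, abs_mul, abs_of_pos (exp_pos _)]
    have := h2 (x - y) (t - r) (hr' r hr) i
    have h3 := mul_le_mul (hexp r hr) this (abs_nonneg _) zero_le_one
    simp only [Prod.mk_sub_mk]
    nlinarith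

lemma dd_space {Θ : Sp n → ℝ} (hΘ : Differentiable ℝ Θ) (i : Fin n) (w : SpT n) :
    dd (ei i) (fun w : SpT n => Θ w.1) w = fderiv ℝ Θ w.1 (EuclideanSpace.single i 1) := by
  have h := HasFDerivAt.comp (g := Θ) (f := Prod.fst) w (hΘ w.1).hasFDerivAt hasFDerivAt_fst
  unfold dd
  rw [show (fun w : SpT n => Θ w.1) = Θ ∘ Prod.fst from rfl, h.fderiv]
  simp [ei]

lemma duhamel_separated {N T : ℝ} (hN : 0 < N) {Θ : Sp n → ℝ} (hΘ : ContDiff ℝ 2 Θ)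
    (hc : HasCompactSupport Θ) (a b : ℝ) (hT : 0 ≤ T) {F : SpT n → ℝ}
    (hF : F = {w : SpT n | w.2 ∈ Icc 0 T}.indicator fun w =>
      b - lap Θ w.1 + N * (a + b * w.2 + Θ w.1)) :
    (∃ C, BM F C) ∧ ∀ x, ∀ t ∈ Icc 0 T,
      a + b * t + Θ x = pN N (fun y => a + Θ y) (x, t) + cv (hkN N) F (x, t) := by
  have hΘd : Differentiable ℝ Θ := hΘ.differentiable (by norm_num)
  set Θi : Fin n → Sp n → ℝ := fun i y => fderiv ℝ Θ y (EuclideanSpace.single i 1) with hΘi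
  have hΘi1 : ∀ i, ContDiff ℝ 1 (Θi i) := fun i =>
    (hΘ.fderiv_right (m := 1) (by norm_num)).clm_apply contDiff_const
  have hΘid : ∀ i, Differentiable ℝ (Θi i) := fun i => (hΘi1 i).differentiable (by norm_num)
  set Θii : Fin n → Sp n → ℝ := fun i y => fderiv ℝ (Θi i) y (EuclideanSpace.single i 1) with hΘii
  have hΘiic : ∀ i, Continuous (Θii i) := fun i =>
    ((hΘi1 i).continuous_fderiv (by norm_num)).clm_apply continuous_const
  have hfc : HasCompactSupport (fderiv ℝ Θ) := hc.fderiv ℝ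
  have hΘis : ∀ i, HasCompactSupport (Θi i) := fun i =>
    hfc.comp_left (g := fun L : Sp n →L[ℝ] ℝ => L (EuclideanSpace.single i 1)) (by simp)
  have hΘiis : ∀ i, HasCompactSupport (Θii i) := fun i =>
    ((hΘis i).fderiv ℝ).comp_left (g := fun L : Sp n →L[ℝ] ℝ => L (EuclideanSpace.single i 1))
      (by simp)
  obtain ⟨C0, hC0⟩ := hc.exists_bound_of_continuous hΘ.continuous
  obtain ⟨C1, hC1⟩ := hfc.exists_bound_of_continuous (hΘ.continuous_fderiv (by norm_num))
  choose C2 hC2 using fun i => (hΘiis i).exists_bound_of_continuous (hΘiic i)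
  have hC00 : 0 ≤ C0 := (norm_nonneg _).trans (hC0 0)
  have hC10 : 0 ≤ C1 := (norm_nonneg _).trans (hC1 0)
  have hC20 : ∀ i, 0 ≤ C2 i := fun i => (norm_nonneg _).trans (hC2 i 0)
  have hlap : lap Θ = fun y => ∑ i, Θii i y := rfl
  have hlapb : ∀ y, |lap Θ y| ≤ ∑ i, C2 i := fun y =>
    (Finset.abs_sum_le_sum_abs _ _).trans (Finset.sum_le_sum fun i _ => hC2 i y)
  have hlapm : Measurable (lap Θ) := by
    rw [hlap]; exact Finset.measurable_sum _ fun i _ => (hΘiic i).measurable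
  set W : SpT n → ℝ := fun w => (a + b * w.2) + Θ w.1 with hW
  have hWc : ContDiff ℝ 2 W :=
    (contDiff_const.add (contDiff_const.mul contDiff_snd)).add (hΘ.comp contDiff_fst)
  have hWd : ∀ w, HasFDerivAt W (b • ContinuousLinearMap.snd ℝ (Sp n) ℝ +
      (fderiv ℝ Θ w.1).comp (ContinuousLinearMap.fst ℝ (Sp n) ℝ)) w := fun w => by
    have h1 := HasFDerivAt.comp (g := Θ) (f := Prod.fst) w (hΘd w.1).hasFDerivAt hasFDerivAt_fst
    have h2 : HasFDerivAt (fun w : SpT n => a + b * w.2)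
        (b • ContinuousLinearMap.snd ℝ (Sp n) ℝ) w := (hasFDerivAt_snd.const_mul b).const_add a
    exact h2.fun_add h1
  have hWt : ∀ w, dd et W w = b := fun w => by
    unfold dd; rw [(hWd w).fderiv]; simp [et]
  have hWi : ∀ i, dd (ei i) W = fun w => Θi i w.1 := fun i => by
    ext w; unfold dd; rw [(hWd w).fderiv]; simp [ei, hΘi]
  have hWii : ∀ i w, dd (ei i) (dd (ei i) W) w = Θii i w.1 := fun i w => by
    rw [hWi, dd_space (hΘid i)]
  have hWsl : ∀ w, sl W w = lap Θ w.1 := fun w => Finset.sum_congr rfl fun i _ => hWii i w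
  have hbm : ∃ C, BM F C := by
    refine ⟨|b| + ∑ i, C2 i + N * (|a| + |b| * T + C0), ?_, fun w => ?_⟩
    · rw [hF]
      refine Measurable.indicator ?_ (measurable_snd measurableSet_Icc)
      have := hlapm
      have := hΘ.continuous.measurable
      fun_prop
    · rw [hF]
      have hs : 0 ≤ ∑ i, C2 i := Finset.sum_nonneg fun i _ => hC20 i
      by_cases hw : w ∈ {w : SpT n | w.2 ∈ Icc 0 T}
      · rw [indicator_of_mem hw]
        have h1 := hlapb w.1
        have h2 : |Θ w.1| ≤ C0 := hC0 w.1
        have h3 : |b * w.2| ≤ |b| * T := by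
          rw [abs_mul, abs_of_nonneg hw.1]
          exact mul_le_mul_of_nonneg_left hw.2 (abs_nonneg _)
        refine (abs_add_le _ _).trans (add_le_add ((abs_sub _ _).trans (add_le_add le_rfl h1)) ?_)
        rw [abs_mul, abs_of_pos hN]
        refine mul_le_mul_of_nonneg_left ?_ hN.le
        exact (abs_add_le _ _).trans (add_le_add ((abs_add_le _ _).trans (add_le_add le_rfl h3)) h2)
      · rw [indicator_of_notMem hw, abs_zero]
        positivity
  refine ⟨hbm, fun x t ht => ?_⟩
  obtain ⟨C, hC⟩ := hbm
  have hs : ∀ i, C2 i ≤ ∑ i, C2 i := fun i =>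
    Finset.single_le_sum (fun i _ => hC20 i) (Finset.mem_univ i)
  have hs0 : 0 ≤ ∑ i, C2 i := Finset.sum_nonneg fun i _ => hC20 i
  have hbT : 0 ≤ |b| * T := by positivity
  have key := duhamel (K := |a| + |b| * T + C0 + |b| + C1 + ∑ i, C2 i) hN hWc ?_ ?_ ?_ hC ?_ ?_ ht (x := x)
  · simpa [hW] using key
  · intro y r hr
    have h2 : |Θ y| ≤ C0 := hC0 y
    have h3 : |b * r| ≤ |b| * T := by
      rw [abs_mul, abs_of_nonneg hr.1]
      exact mul_le_mul_of_nonneg_left hr.2 (abs_nonneg _)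
    have := (abs_add_le (a + b * r) (Θ y)).trans (add_le_add (abs_add_le _ _) le_rfl)
    simp only [hW]
    linarith [abs_nonneg b]
  · intro y r hr
    rw [(hWd _).fderiv]
    have h1 : ‖b • ContinuousLinearMap.snd ℝ (Sp n) ℝ‖ ≤ |b| := by
      rw [norm_smul, norm_eq_abs]
      exact mul_le_of_le_one_right (abs_nonneg _) (ContinuousLinearMap.norm_snd_le _ _ _)
    have h2 : ‖(fderiv ℝ Θ y).comp (ContinuousLinearMap.fst ℝ (Sp n) ℝ)‖ ≤ C1 := by
      refine (ContinuousLinearMap.opNorm_comp_le _ _).trans ?_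
      exact (mul_le_of_le_one_right (norm_nonneg _) (ContinuousLinearMap.norm_fst_le _ _ _)).trans
        (hC1 y)
    have := norm_add_le (b • ContinuousLinearMap.snd ℝ (Sp n) ℝ)
      ((fderiv ℝ Θ y).comp (ContinuousLinearMap.fst ℝ (Sp n) ℝ))
    linarith [abs_nonneg a]
  · intro y r hr i
    rw [hWii]
    have : |Θii i y| ≤ C2 i := hC2 i y
    linarith [hs i, abs_nonneg a, abs_nonneg b]
  · intro w hw
    rw [hF, indicator_of_notMem]
    exact fun h => absurd h.1 (not_le.2 hw)
  · intro w hw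
    rw [hF, indicator_of_mem (by exact hw)]
    rw [HL, hWt, hWsl]

/-- Potential of a constant source. -/
lemma cv_hkN_const {N T : ℝ} (hN : 0 < N) (hT : 0 ≤ T) (c : ℝ) {z : SpT n} (hz : z.2 ∈ Icc 0 T) :
    cv (hkN N) ({w : SpT n | w.2 ∈ Icc 0 T}.indicator fun _ => N * c) z =
      (1 - exp (-N * z.2)) * c := by
  have h := (duhamel_separated (T := T) (n := n) hN (Θ := fun _ => 0) contDiff_const
    HasCompactSupport.zero c 0 hT rfl).2 z.1 z.2 hz
  have e : lap (fun _ : Sp n => (0 : ℝ)) = fun _ => 0 := by ext; simp [lap]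
  simp only [e, zero_mul, add_zero, sub_zero, zero_add] at h
  rw [pN_const _ _ _ hz.1] at h
  have e2 : ((z.1, z.2) : SpT n) = z := rfl
  rw [e2] at h
  linarith

/-- Comparison principle for integral inequalities with the killed heat kernel. -/
lemma nonpos_of_le_potential {N T K D : ℝ} (hN : 0 < N) (hT : 0 ≤ T) {z F : SpT n → ℝ}
    (hK : 0 ≤ K) (hzK : ∀ w : SpT n, w.2 ∈ Icc 0 T → z w ≤ K) (hF : BM F D)
    (hFn : ∀ w : SpT n, w.2 < 0 → F w = 0)
    (hzF : ∀ w : SpT n, w.2 ∈ Icc 0 T → z w ≤ cv (hkN N) F w)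
    (hFz : ∀ Z, 0 ≤ Z → (∀ w : SpT n, w.2 ∈ Icc 0 T → z w ≤ Z) →
      ∀ w : SpT n, w.2 ∈ Icc 0 T → F w ≤ N * Z) :
    ∀ w : SpT n, w.2 ∈ Icc 0 T → z w ≤ 0 := by
  set θ := 1 - exp (-N * T) with hθ
  have hθ0 : 0 ≤ θ := by
    have : exp (-N * T) ≤ 1 := exp_le_one_iff.2 (by nlinarith)
    linarith
  have hθ1 : θ < 1 := by linarith [exp_pos (-N * T)]
  have step : ∀ Z, 0 ≤ Z → (∀ w : SpT n, w.2 ∈ Icc 0 T → z w ≤ Z) →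
      ∀ w : SpT n, w.2 ∈ Icc 0 T → z w ≤ θ * Z := by
    intro Z hZ h w hw
    refine (hzF w hw).trans ?_
    have e1 : cv (hkN N) F w = cv (hkN N) ({w : SpT n | w.2 ∈ Icc 0 T}.indicator F) w := by
      refine cv_hkN_congr_past N fun y hy => ?_
      by_cases hy0 : 0 ≤ y.2
      · rw [indicator_of_mem]; exact ⟨hy0, hy.le.trans hw.2⟩
      · rw [indicator_of_notMem (fun h => hy0 h.1), hFn y (not_le.1 hy0)]
    have hms : MeasurableSet {w : SpT n | w.2 ∈ Icc 0 T} := measurable_snd measurableSet_Icc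
    have b1 : BM ({w : SpT n | w.2 ∈ Icc 0 T}.indicator F) D :=
      ⟨hF.1.indicator hms, fun y => (norm_indicator_le_norm_self F y).trans (hF.2 y)⟩
    have b2 : BM ({w : SpT n | w.2 ∈ Icc 0 T}.indicator fun _ => N * Z) (N * Z) :=
      ⟨measurable_const.indicator hms, fun y =>
        (norm_indicator_le_norm_self (fun _ => N * Z) y).trans
          (le_of_eq (by rw [norm_eq_abs, abs_of_nonneg (mul_nonneg hN.le hZ)]))⟩
    rw [e1]
    refine (cv_mono (integrable_hkN hN) (hkN_nonneg N) b1 b2 (fun y => ?_) w).trans ?_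
    · by_cases hy : y ∈ {w : SpT n | w.2 ∈ Icc 0 T}
      · rw [indicator_of_mem hy, indicator_of_mem hy]; exact hFz Z hZ h y hy
      · rw [indicator_of_notMem hy, indicator_of_notMem hy]
    · rw [cv_hkN_const hN hT Z hw]
      refine mul_le_mul_of_nonneg_right ?_ hZ
      have : exp (-N * T) ≤ exp (-N * w.2) := exp_le_exp.2 (by nlinarith [hw.2])
      linarith
  have iter : ∀ m : ℕ, ∀ w : SpT n, w.2 ∈ Icc 0 T → z w ≤ θ ^ m * K := by
    intro m
    induction m with
    | zero => simpa using hzK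
    | succ m ih =>
      intro w hw
      have := step _ (mul_nonneg (pow_nonneg hθ0 m) hK) ih w hw
      rw [pow_succ']; linarith
  intro w hw
  have hl : Tendsto (fun m : ℕ => θ ^ m * K) atTop (nhds (0 * K)) :=
    (tendsto_pow_atTop_nhds_zero_of_lt_one hθ0 hθ1).mul_const K
  rw [zero_mul] at hl
  exact ge_of_tendsto' hl fun m => iter m w hw

end Duhamel

section Approx
variable {n : ℕ}

/-- Reaction terms admitting `0` and `1` as equilibria. -/
structure Reaction (h : ℝ → ℝ) (Λ : ℝ) : Prop where
  pos : 0 < Λ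
  contDiff : ContDiff ℝ 1 h
  zero : h 0 = 0
  one : h 1 = 0
  nonneg : ∀ x ∈ Icc (0 : ℝ) 1, 0 ≤ h x
  le : ∀ x ∈ Icc (0 : ℝ) 1, h x ≤ Λ
  mono : ∀ N, Λ ≤ N → MonotoneOn (fun x => N * x + h x) (Icc 0 1)

/-- The nonlocal boundary value `κ ∫_Ω v^l`. -/
def bval (Ω : Set (Sp n)) (κ l : ℝ) (v : SpT n → ℝ) (t : ℝ) : ℝ := κ * ∫ y in Ω, v (y, t) ^ l

/-- Source of the penalised problem: reaction inside `U`, relaxation to the boundary value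
outside. -/
def src (Ω : Set (Sp n)) (κ l : ℝ) (h : ℝ → ℝ) (N : ℝ) (U : Set (Sp n)) (v : SpT n → ℝ) :
    SpT n → ℝ :=
  {w : SpT n | 0 ≤ w.2}.indicator fun w =>
    (Prod.fst ⁻¹' U : Set (SpT n)).indicator (fun w => N * v w + h (v w)) w +
      (Prod.fst ⁻¹' Uᶜ : Set (SpT n)).indicator (fun w => N * bval Ω κ l v w.2) w

variable {Ω U : Set (Sp n)} {κ l Λ N : ℝ} {h : ℝ → ℝ} {v v' : SpT n → ℝ} {v0 : Sp n → ℝ}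

lemma src_neg {w : SpT n} (hw : w.2 < 0) : src Ω κ l h N U v w = 0 :=
  indicator_of_notMem (by simpa using hw) _

lemma src_mem {w : SpT n} (hw : 0 ≤ w.2) (hU : w.1 ∈ U) :
    src Ω κ l h N U v w = N * v w + h (v w) := by
  rw [src, indicator_of_mem (by exact hw), indicator_of_mem (by exact hU),
    indicator_of_notMem (by simpa using hU), add_zero]

lemma src_notMem {w : SpT n} (hw : 0 ≤ w.2) (hU : w.1 ∉ U) :
    src Ω κ l h N U v w = N * bval Ω κ l v w.2 := by
  rw [src, indicator_of_mem (by exact hw), indicator_of_notMem (by exact hU),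
    indicator_of_mem (by simpa using hU), zero_add]

lemma measurable_bval (hv : Measurable v) : Measurable (bval Ω κ l v) := by
  have h1 : Measurable fun z : ℝ × Sp n => v (z.2, z.1) ^ l :=
    (hv.comp (measurable_snd.prodMk measurable_fst)).pow_const l
  exact (h1.stronglyMeasurable.integral_prod_right (ν := volume.restrict Ω)).measurable.const_mul κ

lemma integrableOn_rpow (hΩ : volume Ω ≠ ⊤) (hl : 0 < l) (hv : Measurable v)
    (hv1 : ∀ w, v w ∈ Icc (0 : ℝ) 1) (t : ℝ) : IntegrableOn (fun y => v (y, t) ^ l) Ω := by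
  refine Measure.integrableOn_of_bounded (M := 1) hΩ ?_ ?_
  · exact ((hv.comp (measurable_id.prodMk measurable_const)).pow_const l).aestronglyMeasurable
  · refine Eventually.of_forall fun y => ?_
    rw [norm_eq_abs, abs_of_nonneg (rpow_nonneg (hv1 _).1 _)]
    exact rpow_le_one (hv1 _).1 (hv1 _).2 hl.le

lemma bval_mono (hΩ : volume Ω ≠ ⊤) (hl : 0 < l) (hκ : 0 ≤ κ) (hv : Measurable v)
    (hv1 : ∀ w, v w ∈ Icc (0 : ℝ) 1) (hv' : Measurable v') (hv1' : ∀ w, v' w ∈ Icc (0 : ℝ) 1)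
    (hvv : ∀ w, v w ≤ v' w) (t : ℝ) : bval Ω κ l v t ≤ bval Ω κ l v' t :=
  mul_le_mul_of_nonneg_left (integral_mono (integrableOn_rpow hΩ hl hv hv1 t)
    (integrableOn_rpow hΩ hl hv' hv1' t) fun _ => rpow_le_rpow (hv1 _).1 (hvv _) hl.le) hκ

lemma bval_mem (hΩ : volume Ω ≠ ⊤) (hl : 0 < l) (hκ : 0 ≤ κ) (hκ1 : κ * (volume Ω).toReal ≤ 1)
    (hv : Measurable v) (hv1 : ∀ w, v w ∈ Icc (0 : ℝ) 1) (t : ℝ) :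
    bval Ω κ l v t ∈ Icc (0 : ℝ) 1 := by
  constructor
  · exact mul_nonneg hκ (integral_nonneg fun _ => rpow_nonneg (hv1 _).1 _)
  · refine le_trans ?_ hκ1
    refine mul_le_mul_of_nonneg_left ?_ hκ
    have := integral_mono (integrableOn_rpow hΩ hl hv hv1 t)
      (integrableOn_const (C := (1 : ℝ)) hΩ) fun _ => rpow_le_one (hv1 _).1 (hv1 _).2 hl.le
    simpa [Measure.real] using this

lemma tendsto_bval (hΩ : volume Ω ≠ ⊤) (hl : 0 < l) {V : ℕ → SpT n → ℝ}
    (hV : ∀ m, Measurable (V m)) (hV1 : ∀ m w, V m w ∈ Icc (0 : ℝ) 1) {t : ℝ}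
    (hlim : ∀ y ∈ Ω, Tendsto (fun m => V m (y, t)) atTop (nhds (v (y, t)))) (hΩm : MeasurableSet Ω) :
    Tendsto (fun m => bval Ω κ l (V m) t) atTop (nhds (bval Ω κ l v t)) := by
  refine Tendsto.const_mul κ ?_
  refine tendsto_integral_of_dominated_convergence (fun _ => (1 : ℝ))
    (fun m => (integrableOn_rpow hΩ hl (hV m) (hV1 m) t).1) (integrableOn_const hΩ)
    (fun m => Eventually.of_forall fun y => ?_) ?_
  · rw [norm_eq_abs, abs_of_nonneg (rpow_nonneg (hV1 _ _).1 _)]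
    exact rpow_le_one (hV1 _ _).1 (hV1 _ _).2 hl.le
  · exact (ae_restrict_iff' hΩm).2 (Eventually.of_forall fun y hy =>
      (hlim y hy).rpow_const (Or.inr hl.le))

/-- Standing assumptions on the penalised problem. -/
structure Setup (Ω : Set (Sp n)) (κ l : ℝ) (h : ℝ → ℝ) (Λ : ℝ) (v0 : Sp n → ℝ) : Prop where
  react : Reaction h Λ
  open' : IsOpen Ω
  fin : volume Ω ≠ ⊤
  one_lt : 1 < l
  κ_nonneg : 0 ≤ κ
  κ_le : κ * (volume Ω).toReal ≤ 1
  cont : Continuous v0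
  mem : ∀ x, v0 x ∈ Icc (0 : ℝ) 1

namespace Setup

lemma l_pos (S : Setup Ω κ l h Λ v0) : 0 < l := zero_lt_one.trans S.one_lt

lemma abs_init (S : Setup Ω κ l h Λ v0) (x : Sp n) : |v0 x| ≤ 1 := abs_le.2 ⟨by linarith [(S.mem x).1], (S.mem x).2⟩

lemma src_nonneg (S : Setup Ω κ l h Λ v0) (hN : 0 ≤ N) (hv : Measurable v) (hv1 : ∀ w, v w ∈ Icc (0 : ℝ) 1) (w : SpT n) :
    0 ≤ src Ω κ l h N U v w := by
  rcases lt_or_ge w.2 0 with hw | hw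
  · rw [src_neg hw]
  by_cases hU : w.1 ∈ U
  · rw [src_mem hw hU]
    have := S.react.nonneg _ (hv1 w)
    have := mul_nonneg hN (hv1 w).1
    linarith
  · rw [src_notMem hw hU]
    exact mul_nonneg hN (bval_mem S.fin S.l_pos S.κ_nonneg S.κ_le hv hv1 _).1

lemma src_le (S : Setup Ω κ l h Λ v0) (hN : Λ ≤ N) (hv : Measurable v) (hv1 : ∀ w, v w ∈ Icc (0 : ℝ) 1) (w : SpT n) :
    src Ω κ l h N U v w ≤ N := by
  have hN0 : 0 < N := S.react.pos.trans_le hN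
  rcases lt_or_ge w.2 0 with hw | hw
  · rw [src_neg hw]; exact hN0.le
  by_cases hU : w.1 ∈ U
  · rw [src_mem hw hU]
    have := S.react.mono N hN (hv1 w) (right_mem_Icc.2 zero_le_one) (hv1 w).2
    simpa [S.react.one] using this
  · rw [src_notMem hw hU]
    exact mul_le_of_le_one_right hN0.le (bval_mem S.fin S.l_pos S.κ_nonneg S.κ_le hv hv1 _).2

lemma src_mono (S : Setup Ω κ l h Λ v0) (hN : Λ ≤ N) (hv : Measurable v) (hv1 : ∀ w, v w ∈ Icc (0 : ℝ) 1)
    (hv' : Measurable v') (hv1' : ∀ w, v' w ∈ Icc (0 : ℝ) 1) (hvv : ∀ w, v w ≤ v' w) (w : SpT n) :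
    src Ω κ l h N U v w ≤ src Ω κ l h N U v' w := by
  have hN0 : 0 < N := S.react.pos.trans_le hN
  rcases lt_or_ge w.2 0 with hw | hw
  · rw [src_neg hw, src_neg hw]
  by_cases hU : w.1 ∈ U
  · rw [src_mem hw hU, src_mem hw hU]
    exact S.react.mono N hN (hv1 w) (hv1' w) (hvv w)
  · rw [src_notMem hw hU, src_notMem hw hU]
    exact mul_le_mul_of_nonneg_left (bval_mono S.fin S.l_pos S.κ_nonneg hv hv1 hv' hv1' hvv _) hN0.le

lemma measurable_src (S : Setup Ω κ l h Λ v0) (hU : MeasurableSet U) (hv : Measurable v) :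
    Measurable (src Ω κ l h N U v) := by
  refine Measurable.indicator ?_ (measurable_snd measurableSet_Ici)
  refine Measurable.add ?_ ?_
  · exact ((hv.const_mul N).add (S.react.contDiff.continuous.measurable.comp hv)).indicator
      (measurable_fst hU)
  · exact (((measurable_bval hv).comp measurable_snd).const_mul N).indicator
      (measurable_fst hU.compl)

lemma bm_src (S : Setup Ω κ l h Λ v0) (hN : Λ ≤ N) (hU : MeasurableSet U) (hv : Measurable v)
    (hv1 : ∀ w, v w ∈ Icc (0 : ℝ) 1) : BM (src Ω κ l h N U v) N :=
  ⟨S.measurable_src hU hv, fun w => abs_le.2 ⟨by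
    linarith [S.src_nonneg (U := U) (S.react.pos.trans_le hN).le hv hv1 w, S.react.pos.trans_le hN],
    S.src_le hN hv hv1 w⟩⟩

end Setup

/-- A mild solution of the penalised problem. -/
structure IsApprox (Ω : Set (Sp n)) (κ l : ℝ) (h : ℝ → ℝ) (v0 : Sp n → ℝ) (N : ℝ) (U : Set (Sp n))
    (v : SpT n → ℝ) : Prop where
  meas : Measurable v
  mem : ∀ w, v w ∈ Icc (0 : ℝ) 1
  neg : ∀ w : SpT n, w.2 < 0 → v w = 0
  eq : ∀ w, v w = pN N v0 w + cv (hkN N) (src Ω κ l h N U v) w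

lemma exists_isApprox (S : Setup Ω κ l h Λ v0) (hN : Λ ≤ N) (hU : MeasurableSet U) :
    ∃ v, IsApprox Ω κ l h v0 N U v := by
  have hN0 : 0 < N := S.react.pos.trans_le hN
  let Φ : (SpT n → ℝ) → SpT n → ℝ := fun v w => pN N v0 w + cv (hkN N) (src Ω κ l h N U v) w
  have Φneg : ∀ v (w : SpT n), w.2 < 0 → Φ v w = 0 := by
    intro v w hw
    have : cv (hkN N) (src Ω κ l h N U v) w = cv (hkN N) (fun _ => 0) w :=
      cv_hkN_congr_past N fun y hy => src_neg (hy.trans hw)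
    simp only [Φ, this, pN_neg _ _ hw]
    simp [cv]
  have Φmeas : ∀ v, Measurable v → (∀ w, v w ∈ Icc (0 : ℝ) 1) → Measurable (Φ v) := by
    intro v hv hv1
    exact (measurable_pN N S.cont S.abs_init).add
      (bm_cv (integrable_hkN hN0) (S.bm_src hN hU hv hv1)).1
  have Φmem : ∀ v, Measurable v → (∀ w, v w ∈ Icc (0 : ℝ) 1) → ∀ w, Φ v w ∈ Icc (0 : ℝ) 1 := by
    intro v hv hv1 w
    rcases lt_or_ge w.2 0 with hw | hw
    · rw [Φneg v w hw]; exact ⟨le_rfl, zero_le_one⟩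
    constructor
    · refine add_nonneg ?_ ?_
      · have := pN_mono N continuous_const (C := 1) (f := fun _ : Sp n => (0 : ℝ)) (by simp)
          S.cont S.abs_init (fun x => (S.mem x).1) w
        rw [pN_const _ _ _ hw] at this
        simpa using this
      · exact integral_nonneg fun y => mul_nonneg (hkN_nonneg N y)
          (S.src_nonneg hN0.le hv hv1 _)
    · have h1 := pN_mono N S.cont S.abs_init (g := fun _ : Sp n => (1 : ℝ)) continuous_const (by simp)
          (fun x => (S.mem x).2) w
      rw [pN_const _ _ _ hw] at h1
      have h2 := cv_hkN_const (n := n) hN0 hw 1 (z := w) ⟨hw, le_rfl⟩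
      have hms : MeasurableSet {y : SpT n | y.2 ∈ Icc 0 w.2} := measurable_snd measurableSet_Icc
      have e1 : cv (hkN N) (src Ω κ l h N U v) w =
          cv (hkN N) ({y : SpT n | y.2 ∈ Icc 0 w.2}.indicator (src Ω κ l h N U v)) w := by
        refine cv_hkN_congr_past N fun y hy => ?_
        by_cases hy0 : 0 ≤ y.2
        · rw [indicator_of_mem]; exact ⟨hy0, hy.le⟩
        · rw [indicator_of_notMem (fun h => hy0 h.1), src_neg (not_le.1 hy0)]
      have bs := S.bm_src hN hU hv hv1
      have h3 : cv (hkN N) (src Ω κ l h N U v) w ≤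
          cv (hkN N) ({y : SpT n | y.2 ∈ Icc 0 w.2}.indicator fun _ => N * 1) w := by
        rw [e1]
        refine cv_mono (integrable_hkN hN0) (hkN_nonneg N)
          (C := N) (D := N)
          ⟨bs.1.indicator hms, fun y =>
            (norm_indicator_le_norm_self (src Ω κ l h N U v) y).trans (bs.2 y)⟩
          ⟨measurable_const.indicator hms, fun y =>
            (norm_indicator_le_norm_self (fun _ => N * 1) y).trans
              (le_of_eq (by rw [norm_eq_abs, mul_one, abs_of_nonneg hN0.le]))⟩ (fun y => ?_) w
        refine indicator_le_indicator ?_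
        rw [mul_one]; exact S.src_le hN hv hv1 y
      rw [h2] at h3
      simp only [Φ]
      linarith
  let V : ℕ → SpT n → ℝ := fun m => Φ^[m] (fun _ => 0)
  have Vs : ∀ m, V (m + 1) = Φ (V m) := fun m => Function.iterate_succ_apply' Φ m _
  have VP : ∀ m, Measurable (V m) ∧ ∀ w, V m w ∈ Icc (0 : ℝ) 1 := by
    intro m
    induction m with
    | zero => exact ⟨measurable_const, fun w => ⟨le_rfl, zero_le_one⟩⟩
    | succ m ih => rw [Vs]; exact ⟨Φmeas _ ih.1 ih.2, Φmem _ ih.1 ih.2⟩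
  have Vmono : ∀ m w, V m w ≤ V (m + 1) w := by
    intro m
    induction m with
    | zero => exact fun w => ((VP 1).2 w).1
    | succ m ih =>
      intro w
      rw [Vs m, Vs (m + 1)]
      exact add_le_add le_rfl (cv_mono (integrable_hkN hN0) (hkN_nonneg N)
        (S.bm_src hN hU (VP m).1 (VP m).2) (S.bm_src hN hU (VP (m + 1)).1 (VP (m + 1)).2)
        (S.src_mono hN (VP m).1 (VP m).2 (VP _).1 (VP _).2 ih) w)
  let v : SpT n → ℝ := fun w => ⨆ m, V m w
  have hlim : ∀ w, Tendsto (fun m => V m w) atTop (nhds (v w)) := fun w =>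
    tendsto_atTop_ciSup (monotone_nat_of_le_succ fun m => Vmono m w)
      ⟨1, by rintro _ ⟨m, rfl⟩; exact ((VP m).2 w).2⟩
  have hvm : Measurable v := measurable_of_tendsto_metrizable (fun m => (VP m).1)
    (tendsto_pi_nhds.2 hlim)
  have hv1 : ∀ w, v w ∈ Icc (0 : ℝ) 1 := fun w =>
    isClosed_Icc.mem_of_tendsto (hlim w) (Eventually.of_forall fun m => (VP m).2 w)
  have hsrc : ∀ w, Tendsto (fun m => src Ω κ l h N U (V m) w) atTop
      (nhds (src Ω κ l h N U v w)) := by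
    intro w
    rcases lt_or_ge w.2 0 with hw | hw
    · simp only [src_neg hw]; exact tendsto_const_nhds
    by_cases hU : w.1 ∈ U
    · simp only [src_mem hw hU]
      exact ((hlim w).const_mul N).add ((S.react.contDiff.continuous.tendsto _).comp (hlim w))
    · simp only [src_notMem hw hU]
      exact (tendsto_bval S.fin S.l_pos (fun m => (VP m).1) (fun m => (VP m).2)
        (fun y _ => hlim _) S.open'.measurableSet).const_mul N
  have heq : ∀ w, v w = Φ v w := by
    intro w
    have h1 : Tendsto (fun m => V (m + 1) w) atTop (nhds (v w)) :=
      (hlim w).comp (tendsto_add_atTop_nat 1)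
    refine tendsto_nhds_unique h1 ?_
    simp only [Vs]
    refine Tendsto.const_add _ ?_
    refine tendsto_integral_of_dominated_convergence (fun y => hkN N y * N)
      (fun m => (integrable_cv (integrable_hkN hN0) (S.bm_src hN hU (VP m).1 (VP m).2) w).1)
      ((integrable_hkN hN0).mul_const N)
      (fun m => Eventually.of_forall fun y => ?_)
      (Eventually.of_forall fun y => (hsrc _).const_mul _)
    rw [norm_mul, norm_eq_abs, abs_of_nonneg (hkN_nonneg N y)]
    exact mul_le_mul_of_nonneg_left ((S.bm_src hN hU (VP m).1 (VP m).2).2 _) (hkN_nonneg N y)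
  exact ⟨v, hvm, hv1, fun w hw => by rw [heq, Φneg v w hw], heq⟩

end Approx

section ApproxWeak
variable {n : ℕ} {Ω U : Set (Sp n)} {κ l Λ N : ℝ} {h : ℝ → ℝ} {v : SpT n → ℝ} {v0 : Sp n → ℝ}

lemma continuous_pN_sub (N : ℝ) {f : Sp n → ℝ} {C : ℝ} (hf : Continuous f) (h : ∀ x, |f x| ≤ C) :
    Continuous fun w => pN N f w - pN 0 f w := by
  have h1 : ContinuousOn (fun w => pN N f w - pN 0 f w) {w : SpT n | 0 ≤ w.2} :=
    (continuousOn_pN N hf h).sub (continuousOn_pN 0 hf h)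
  have h2 : ContinuousOn (fun w => pN N f w - pN 0 f w) {w : SpT n | w.2 ≤ 0} := by
    refine (continuousOn_const (c := (0 : ℝ))).congr fun w hw => ?_
    rcases lt_or_eq_of_le (show w.2 ≤ 0 from hw) with h' | h'
    · simp only [pN_neg _ _ h', sub_self]
    · obtain ⟨x, t⟩ := w
      obtain rfl : t = 0 := h'
      simp only [pN_zero_time, sub_self]
  have := h1.union_of_isClosed h2 (isClosed_le continuous_const continuous_snd)
    (isClosed_le continuous_snd continuous_const)
  rw [← continuousOn_univ]
  refine this.mono fun w _ => ?_
  rcases le_total 0 w.2 with h | h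
  · exact Or.inl h
  · exact Or.inr h

lemma IsApprox.bm (A : IsApprox Ω κ l h v0 N U v) : BM v 1 :=
  ⟨A.meas, fun z => abs_le.2 ⟨by linarith [(A.mem z).1], (A.mem z).2⟩⟩

lemma IsApprox.continuous_sub (A : IsApprox Ω κ l h v0 N U v) (S : Setup Ω κ l h Λ v0) (hN : Λ ≤ N)
    (hU : MeasurableSet U) : Continuous fun w => v w - pN 0 v0 w := by
  have h1 := (continuous_pN_sub N S.cont S.abs_init).add
    (continuous_cv (integrable_hkN (S.react.pos.trans_le hN)) (S.bm_src hN hU A.meas A.mem))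
  refine h1.congr fun w => ?_
  rw [A.eq w, Pi.add_apply]; ring

lemma IsApprox.zero (A : IsApprox Ω κ l h v0 N U v) (x : Sp n) : v (x, 0) = v0 x := by
  have : cv (hkN N) (src Ω κ l h N U v) (x, 0) = cv (hkN N) (fun _ => 0) (x, 0) :=
    cv_hkN_congr_past N fun y hy => src_neg hy
  rw [A.eq, pN_zero_time, this]
  simp [cv]

lemma cv_HL_pN {R C : ℝ} {ρ : SpT n → ℝ} (hρ : IsTest R ρ) {f : Sp n → ℝ} (hf : Continuous f)
    (h : ∀ x, |f x| ≤ C) (z : SpT n) : cv (HL ρ) (pN 0 f) z = ∫ y, f y * ρ (z.1 - y, z.2) := by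
  have h1 := cv_hkN_HL hρ 0
  simp only [zero_mul, add_zero] at h1
  exact cv_pN hρ.HL h1 hf h z

/-- Weak formulation of the penalised problem. -/
lemma IsApprox.weak (A : IsApprox Ω κ l h v0 N U v) (S : Setup Ω κ l h Λ v0) (hN : Λ ≤ N)
    (hU : MeasurableSet U) {R : ℝ} {ρ : SpT n → ℝ} (hρ : IsTest R ρ) (z : SpT n) :
    cv (HL ρ) v z = (∫ y, v0 y * ρ (z.1 - y, z.2)) +
      cv ρ (fun w => src Ω κ l h N U v w - N * v w) z := by
  have hN0 := S.react.pos.trans_le hN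
  have bs := S.bm_src hN hU A.meas A.mem
  have bN : BM (fun w => N * v w) (N * 1) :=
    ⟨A.meas.const_mul N, fun z => by
      rw [abs_mul, abs_of_pos hN0]
      exact mul_le_mul_of_nonneg_left (A.bm.2 z) hN0.le⟩
  have h1 : cv (fun w => HL ρ w + N * ρ w) v z =
      cv (fun w => HL ρ w + N * ρ w) (pN N v0) z +
        cv (fun w => HL ρ w + N * ρ w) (cv (hkN N) (src Ω κ l h N U v)) z := by
    rw [← cv_add_right (hρ.HLN N).integrable (bm_pN hN0.le S.cont S.abs_init)
      (bm_cv (integrable_hkN hN0) bs)]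
    congr 1; exact funext A.eq
  rw [weak_cv_hkN hN0 hρ bs, cv_pN (hρ.HLN N) (cv_hkN_HL hρ N) S.cont S.abs_init,
    cv_add_left hρ.HL.integrable (hρ.const_mul N).integrable A.bm, cv_smul_left] at h1
  rw [cv_sub_right hρ.integrable bs bN, cv_smul_right]
  linarith

/-- Interior uniform equicontinuity of solutions of the penalised problems. -/
lemma exists_approx_modulus (S : Setup Ω κ l h Λ v0) {R : ℝ} (hR : 0 < R) :
    ∃ m : SpT n → ℝ, Tendsto m (nhds 0) (nhds 0) ∧
      ∀ N U v, Λ ≤ N → MeasurableSet U → IsApprox Ω κ l h v0 N U v →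
        ∀ z z' : SpT n, Metric.ball z.1 R ⊆ U → Metric.ball z'.1 R ⊆ U →
          |(v z - pN 0 v0 z) - (v z' - pN 0 v0 z')| ≤ m (z - z') := by
  obtain ⟨J, κ', Ji, hP⟩ := exists_param (n := n) hR
  refine ⟨fun w => Λ * om J w + 1 * om κ' w, ?_, fun N U v hN hU A z z' hz hz' => ?_⟩
  · simpa using ((tendsto_om hP.integrable).const_mul Λ).add
      ((tendsto_om hP.test.integrable).const_mul 1)
  have hN0 := S.react.pos.trans_le hN
  have bs := S.bm_src hN hU A.meas A.mem
  have bp := bm_pN (n := n) le_rfl S.cont S.abs_init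
  have bN : BM (fun w => src Ω κ l h N U v w - N * v w) (N + N * 1) :=
    ⟨bs.1.sub (A.meas.const_mul N), fun z => (abs_sub _ _).trans (add_le_add (bs.2 z) (by
      rw [abs_mul, abs_of_pos hN0]
      exact mul_le_mul_of_nonneg_left (A.bm.2 z) hN0.le))⟩
  have bw : BM (fun w => v w - pN 0 v0 w) 1 := by
    refine ⟨A.meas.sub bp.1, fun w => ?_⟩
    have h0 : 0 ≤ pN 0 v0 w := by
      rcases lt_or_ge w.2 0 with hw | hw
      · rw [pN_neg _ _ hw]
      · have := pN_mono 0 continuous_const (C := 1) (f := fun _ : Sp n => (0 : ℝ)) (by simp)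
          S.cont S.abs_init (fun x => (S.mem x).1) w
        rw [pN_const _ _ _ hw] at this
        simpa using this
    have h1 := (abs_le.1 (bp.2 w)).2
    have := A.mem w
    exact abs_le.2 ⟨by linarith [this.1], by linarith [this.2]⟩
  set F' : SpT n → ℝ := (U ×ˢ Ici (0 : ℝ)).indicator fun w => h (v w) with hF'
  have bF : BM F' Λ := by
    refine ⟨(S.react.contDiff.continuous.measurable.comp A.meas).indicator
      (hU.prod measurableSet_Ici), fun w => ?_⟩
    refine (norm_indicator_le_norm_self (fun w => h (v w)) w).trans ?_
    rw [norm_eq_abs, abs_of_nonneg (S.react.nonneg _ (A.mem w))]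
    exact S.react.le _ (A.mem w)
  have rep : ∀ z : SpT n, Metric.ball z.1 R ⊆ U →
      v z - pN 0 v0 z = cv J F' z + cv κ' (fun w => v w - pN 0 v0 w) z := by
    intro z hz
    have h1 := hP.rep one_pos bw bN (z := z) (fun ρ hρ => by
      rw [cv_sub_right hρ.HL.integrable A.bm bp, A.weak S hN hU hρ,
        cv_HL_pN hρ S.cont S.abs_init]
      ring) (A.continuous_sub S hN hU).continuousAt
    rw [h1]
    congr 1
    refine cv_congr_ball hP.supp fun y hy => ?_
    have hyU : y.1 ∈ U := hz (by
      rw [Metric.mem_ball] at hy ⊢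
      exact (le_max_left _ _).trans_lt hy)
    rcases lt_or_ge y.2 0 with hw | hw
    · rw [src_neg hw, A.neg y hw, hF', indicator_of_notMem (fun h => absurd h.2 (not_le.2 hw))]
      ring
    · rw [src_mem hw hyU, hF', indicator_of_mem (by exact ⟨hyU, hw⟩)]
      ring
  rw [rep z hz, rep z' hz']
  have e1 := abs_cv_sub_le hP.integrable bF z z'
  have e2 := abs_cv_sub_le hP.test.integrable bw z z'
  rw [add_sub_add_comm]
  exact (abs_add_le _ _).trans (add_le_add e1 e2)

/-- Away from the initial time and inside `U`, the equation holds in the weak sense. -/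
lemma IsApprox.weak_interior (A : IsApprox Ω κ l h v0 N U v) (S : Setup Ω κ l h Λ v0) (hN : Λ ≤ N)
    (hU : MeasurableSet U) {R : ℝ} {ρ : SpT n → ℝ} (hρ : IsTest R ρ) {z : SpT n} (hz : R ≤ z.2)
    (hzU : Metric.ball z.1 R ⊆ U) :
    cv (HL ρ) v z = cv ρ (fun w => h (v w)) z := by
  rw [A.weak S hN hU hρ]
  have : ∀ y, v0 y * ρ (z.1 - y, z.2) = 0 := by
    intro y
    rw [hρ.2, mul_zero]
    rw [Prod.norm_def]
    refine le_max_of_le_right ?_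
    rw [norm_eq_abs]; exact hz.trans (le_abs_self _)
  simp only [this, integral_zero, zero_add]
  refine cv_congr_ball hρ.2 fun y hy => ?_
  rw [Metric.mem_ball, Prod.dist_eq, max_lt_iff, Real.dist_eq] at hy
  have hy2 : 0 ≤ y.2 := by linarith [(abs_lt.1 hy.2).1]
  rw [src_mem hy2 (hzU hy.1)]
  ring

end ApproxWeak

section Barrier
variable {n : ℕ}

/-- Potentials of sets of small measure are uniformly small. -/
lemma exists_small_potential {ε : ℝ} (hε : 0 < ε) : ∃ η > 0, ∀ A : Set (Sp n), MeasurableSet A →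
    volume A ≤ ENNReal.ofReal η → ∀ z : SpT n,
      cv (hkN 1) ((A ×ˢ Ici (0 : ℝ)).indicator fun _ => 1) z ≤ ε := by
  have hk := integrable_hkN (n := n) one_pos
  let B : ℕ → Set (SpT n) := fun m => {w | hkN 1 w ≤ m ∧ |w.2| ≤ m}
  have hB : ∀ m, MeasurableSet (B m) := fun m =>
    (measurableSet_le (measurable_hkN 1) measurable_const).inter
      (measurableSet_le measurable_snd.abs measurable_const)
  have hlim : Tendsto (fun m => ∫ w, (B m)ᶜ.indicator (hkN 1) w) atTop
      (nhds (∫ _ : SpT n, (0 : ℝ))) := by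
    refine tendsto_integral_of_dominated_convergence (hkN 1)
      (fun m => (hk.indicator (hB m).compl).1) hk
      (fun m => Eventually.of_forall fun w => ?_) (Eventually.of_forall fun w => ?_)
    · refine (norm_indicator_le_norm_self _ w).trans (le_of_eq ?_)
      rw [norm_eq_abs, abs_of_nonneg (hkN_nonneg 1 w)]
    · obtain ⟨M, hM⟩ := exists_nat_ge (max (hkN 1 w) |w.2|)
      refine tendsto_const_nhds.congr' ?_
      filter_upwards [eventually_ge_atTop M] with m hm
      rw [indicator_of_notMem]
      have hm' : (M : ℝ) ≤ m := by exact_mod_cast hm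
      simp only [mem_compl_iff, not_not]
      exact ⟨(le_max_left _ _).trans (hM.trans hm'), (le_max_right _ _).trans (hM.trans hm')⟩
  rw [integral_zero] at hlim
  obtain ⟨m, hm⟩ := (hlim.eventually (gt_mem_nhds (half_pos hε))).exists
  refine ⟨ε / (2 * (m * (2 * m) + 1)), by positivity, fun A hA hvol z => ?_⟩
  have hAtop : volume A ≠ ⊤ := ne_top_of_le_ne_top ENNReal.ofReal_ne_top hvol
  set E : Set (SpT n) := ((fun y => z.1 - y) ⁻¹' A) ×ˢ Icc (-(m : ℝ)) m with hE
  have hpre : volume ((fun y => z.1 - y) ⁻¹' A) = volume A :=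
    (Measure.measurePreserving_sub_left volume z.1).measure_preimage hA.nullMeasurableSet
  have hEm : MeasurableSet E := (measurable_const_sub z.1 hA).prod measurableSet_Icc
  have hEv : volume E = volume A * ENNReal.ofReal (2 * m) := by
    show (volume.prod volume) E = _
    rw [hE, Measure.prod_prod, hpre, Real.volume_Icc]
    congr 2; ring
  have hEi : Integrable (E.indicator fun _ => (m : ℝ)) := by
    rw [integrable_indicator_iff hEm]
    exact integrableOn_const (by rw [hEv]; exact ENNReal.mul_ne_top hAtop ENNReal.ofReal_ne_top)
  have hpt : ∀ w : SpT n, hkN 1 w * (A ×ˢ Ici (0 : ℝ)).indicator (fun _ => (1 : ℝ)) (z - w) ≤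
      (B m)ᶜ.indicator (hkN 1) w + E.indicator (fun _ => (m : ℝ)) w := by
    intro w
    have h0 := hkN_nonneg 1 w
    have hE0 : 0 ≤ E.indicator (fun _ => (m : ℝ)) w := indicator_nonneg (fun _ _ => by positivity) w
    have hB0 : 0 ≤ (B m)ᶜ.indicator (hkN 1) w := indicator_nonneg (fun _ _ => hkN_nonneg 1 _) w
    by_cases hA' : z - w ∈ A ×ˢ Ici (0 : ℝ)
    · rw [indicator_of_mem hA', mul_one]
      by_cases hw : w ∈ B m
      · rw [indicator_of_mem (s := E) (a := w) ⟨hA'.1, abs_le.1 hw.2⟩]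
        linarith [hw.1]
      · rw [indicator_of_mem (s := (B m)ᶜ) (a := w) hw]; linarith
    · rw [indicator_of_notMem hA', mul_zero]; linarith
  have hb : BM ((A ×ˢ Ici (0 : ℝ)).indicator fun _ => (1 : ℝ)) 1 :=
    ⟨measurable_const.indicator (hA.prod measurableSet_Ici), fun y =>
      (norm_indicator_le_norm_self (fun _ => (1 : ℝ)) y).trans (by simp)⟩
  have h1 := integral_mono (integrable_cv hk hb z) ((hk.indicator (hB m).compl).add hEi) hpt
  simp only [Pi.add_apply] at h1
  rw [integral_add (hk.indicator (hB m).compl) hEi, integral_indicator_const _ hEm, Measure.real, hEv,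
    ENNReal.toReal_mul, ENNReal.toReal_ofReal (by positivity), smul_eq_mul] at h1
  have h2 : (volume A).toReal ≤ ε / (2 * (m * (2 * m) + 1)) :=
    ENNReal.toReal_le_of_le_ofReal (by positivity) hvol
  have h3 : (volume A).toReal * (2 * m) * m ≤ ε / 2 := by
    calc (volume A).toReal * (2 * m) * m ≤ ε / (2 * (m * (2 * m) + 1)) * (2 * m) * m := by gcongr
      _ = ε / 2 * ((m * (2 * m)) / (m * (2 * m) + 1)) := by field_simp
      _ ≤ ε / 2 * 1 := by
        gcongr
        rw [div_le_one (by positivity)]; linarith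
      _ = ε / 2 := mul_one _
  unfold cv
  linarith

/-- Change of the killing rate in a potential. -/
lemma cv_hkN_one_eq {N C : ℝ} (hN : 0 < N) {f : SpT n → ℝ} (hf : BM f C) :
    (∃ D, BM (fun w => f w + (N - 1) * cv (hkN 1) f w) D) ∧
    ∀ z, cv (hkN 1) f z = cv (hkN N) (fun w => f w + (N - 1) * cv (hkN 1) f w) z := by
  have hk := integrable_hkN (n := n) one_pos
  have b1 := bm_cv hk hf
  have b2 : BM (fun w => (N - 1) * cv (hkN 1) f w) _ :=
    BM.mul (f := fun _ => N - 1) ⟨measurable_const, fun _ => le_rfl⟩ b1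
  have b3 := hf.add b2
  refine ⟨⟨_, b3⟩, fun z => eq_cv_hkN_of_weak hN b1 b3 (fun R ρ hρ z => ?_)
    (continuous_cv hk hf).continuousAt⟩
  have h1 := congrFun (weak_cv_hkN one_pos hρ hf) z
  rw [cv_add_left hρ.HL.integrable (hρ.const_mul 1).integrable b1, cv_smul_left] at h1
  rw [cv_add_left hρ.HL.integrable (hρ.const_mul N).integrable b1, cv_smul_left,
    cv_add_right hρ.integrable hf b2, cv_smul_right]
  linarith

lemma pN_le_pN (N : ℝ) {f g : Sp n → ℝ} {C D : ℝ} (hf : Continuous f) (h : ∀ x, |f x| ≤ C)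
    (hg : Continuous g) (h' : ∀ x, |g x| ≤ D) (hfg : ∀ x, f x ≤ g x) (w : SpT n) :
    pN N f w ≤ pN N g w :=
  pN_mono N hf (C := max C D) (fun x => (h x).trans (le_max_left _ _)) hg
    (fun x => (h' x).trans (le_max_right _ _)) hfg w

/-- The boundary barrier. -/
lemma barrier {N t₀ Λ L L' ε C δ lam K D G : ℝ} {v H : SpT n → ℝ} {v0 Θ φ : Sp n → ℝ}
    {g : ℝ → ℝ} {U A : Set (Sp n)} (hN : 1 ≤ N) (ht₀ : 0 ≤ t₀)
    (hv : BM v 1) (hH : BM H D) (hHn : ∀ w : SpT n, w.2 < 0 → H w = 0) (hv0 : Continuous v0)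
    (hv01 : ∀ x, |v0 x| ≤ 1)
    (hveq : ∀ w : SpT n, v w = pN N v0 w + cv (hkN N) H w)
    (hHU : ∀ w : SpT n, w.2 ∈ Icc 0 t₀ → w.1 ∈ U → H w ≤ N * v w + Λ)
    (hHB : ∀ w : SpT n, w.2 ∈ Icc 0 t₀ → w.1 ∉ U → H w ≤ N * g w.2)
    (hg : ∀ s ∈ Icc 0 t₀, g s ≤ G + ε + L * (t₀ - s))
    (hv0g : ∀ x, v0 x ≤ g 0 + ε + C * φ x)
    (hΘ : ContDiff ℝ 2 Θ) (hΘc : HasCompactSupport Θ) (hC : 0 ≤ C) (hL' : 0 ≤ L')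
    (hΘφ : ∀ x, φ x - δ ≤ Θ x ∧ Θ x ≤ φ x) (hφ : ∀ x, 0 ≤ φ x)
    (hlap : ∀ x ∈ U, lap Θ x = -lam * φ x) (hK : ∀ x, lap Θ x ≤ K) (hCδ : C * δ ≤ ε)
    (hA : MeasurableSet A) (hε : 0 ≤ ε)
    (hψ : ∀ z : SpT n, L' * cv (hkN 1) ((A ×ˢ Ici (0 : ℝ)).indicator fun _ => 1) z ≤ ε)
    (hψ2 : ∀ z : SpT n, cv (hkN 1) ((A ×ˢ Ici (0 : ℝ)).indicator fun _ => 1) z ≤ 1 / 2)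
    (hLL : 2 * (L + Λ) ≤ L') (hAC : ∀ x ∈ U, x ∉ A → L' ≤ C * lam * φ x)
    (hlam : 0 ≤ C * lam) (hNε : L + C * K ≤ N * ε) (x : Sp n) :
    v (x, t₀) ≤ G + 4 * ε + C * φ x := by
  have hN0 : 0 < N := by linarith
  set f : SpT n → ℝ := (A ×ˢ Ici (0 : ℝ)).indicator fun _ => 1 with hf
  have bf : BM f 1 := ⟨measurable_const.indicator (hA.prod measurableSet_Ici), fun y =>
      (norm_indicator_le_norm_self (fun _ => (1 : ℝ)) y).trans (by simp)⟩
  have f0 : ∀ w, 0 ≤ f w := fun w => indicator_nonneg (fun _ _ => zero_le_one) w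
  set ψ := cv (hkN 1) f with hψd
  have ψ0 : ∀ w, 0 ≤ ψ w := fun w => integral_nonneg fun y => mul_nonneg (hkN_nonneg 1 y) (f0 _)
  obtain ⟨⟨D₂, b₂⟩, e₂⟩ := cv_hkN_one_eq hN0 bf
  rw [← hψd] at b₂ e₂
  set F₂ : SpT n → ℝ := fun w => f w + (N - 1) * ψ w with hF₂
  have F₂n : ∀ w : SpT n, w.2 < 0 → F₂ w = 0 := by
    intro w hw
    have h1 : f w = 0 := indicator_of_notMem (fun h => absurd h.2 (not_le.2 hw)) _
    have h2 : ψ w = cv (hkN 1) (fun _ => 0) w :=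
      cv_hkN_congr_past 1 fun y hy => indicator_of_notMem
        (fun h => absurd h.2 (not_le.2 (hy.trans hw))) _
    simp only [hF₂, h1, h2]
    simp [cv]
  set Θ' : Sp n → ℝ := fun x => C * Θ x with hΘ'
  have hΘ'c : HasCompactSupport Θ' := hΘc.mul_left
  have hΘ'd : ContDiff ℝ 2 Θ' := contDiff_const.mul hΘ
  have hlap' : ∀ x, lap Θ' x = C * lap Θ x := by
    intro x
    have h1 : ∀ y, fderiv ℝ Θ' y = C • fderiv ℝ Θ y := fun y => by
      rw [hΘ']; exact fderiv_const_mul (hΘ.differentiable (by norm_num)).differentiableAt C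
    simp only [lap, h1, _root_.smul_apply, smul_eq_mul]
    rw [Finset.mul_sum]
    refine Finset.sum_congr rfl fun i _ => ?_
    rw [fderiv_const_mul]
    · simp
    · exact (((hΘ.fderiv_right (m := 1) (by norm_num)).clm_apply contDiff_const).differentiable
        (by norm_num)).differentiableAt
  set a := G + 3 * ε + L * t₀ with ha
  set F₁ : SpT n → ℝ := {w | w.2 ∈ Icc 0 t₀}.indicator fun w =>
    -L - lap Θ' w.1 + N * (a + -L * w.2 + Θ' w.1) with hF₁
  obtain ⟨⟨D₁, b₁⟩, e₁⟩ := duhamel_separated hN0 hΘ'd hΘ'c a (-L) ht₀ hF₁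
  obtain ⟨CΘ, hCΘ⟩ := hΘ'c.exists_bound_of_continuous hΘ'd.continuous
  have bL : BM (fun w => L' * F₂ w) (|L'| * D₂) :=
    BM.mul (f := fun _ => L') ⟨measurable_const, fun _ => le_rfl⟩ b₂
  set FF : SpT n → ℝ := fun w => H w + -1 * (F₁ w + L' * F₂ w) with hFF
  have bS := b₁.add bL
  have bS' : BM (fun w => -1 * (F₁ w + L' * F₂ w)) (1 * (D₁ + |L'| * D₂)) :=
    BM.mul (f := fun _ => -1) ⟨measurable_const, fun _ => by simp⟩ bS
  have bFF : BM FF _ := hH.add bS'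
  have hk := integrable_hkN (n := n) hN0
  set W : SpT n → ℝ := fun w => a + -L * w.2 + Θ' w.1 + L' * ψ w with hW
  have key := nonpos_of_le_potential (T := t₀) (z := fun w => v w - W w) (F := FF)
    (K := 1 + |a| + |L| * t₀ + CΘ + ε) hN0 ht₀ (by
      have := (norm_nonneg _).trans (hCΘ 0); positivity) ?_ bFF ?_ ?_ ?_ (x, t₀) ⟨ht₀, le_rfl⟩
  · simp only [hW, ha, hΘ'] at key
    have h1 := hψ (x, t₀)
    have h2 := mul_le_mul_of_nonneg_left (hΘφ x).2 hC
    linarith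
  · intro w hw
    have h1 := (abs_le.1 (hv.2 w)).2
    have h2 := (abs_le.1 (hCΘ w.1)).1
    have h3 := mul_nonneg hL' (ψ0 w)
    have h4 := neg_abs_le a
    have h5 : L * w.2 ≤ |L| * t₀ := by
      calc L * w.2 ≤ |L| * w.2 := mul_le_mul_of_nonneg_right (le_abs_self L) hw.1
        _ ≤ |L| * t₀ := mul_le_mul_of_nonneg_left hw.2 (abs_nonneg _)
    simp only [hW]
    linarith
  · intro w hw
    have h1 : F₁ w = 0 := indicator_of_notMem (fun h => absurd h.1 (not_le.2 hw)) _
    simp only [hFF, h1, F₂n w hw, hHn w hw]; ring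
  · intro w hw
    have h1 := e₁ w.1 w.2 hw
    have h2 := e₂ w
    have h3 : cv (hkN N) FF w = cv (hkN N) H w - (cv (hkN N) F₁ w + L' * cv (hkN N) F₂ w) := by
      rw [hFF, cv_add_right hk hH bS', cv_smul_right, cv_add_right hk b₁ bL, cv_smul_right]; ring
    have h4 : pN N v0 w ≤ pN N (fun y => a + Θ' y) w := by
      refine pN_le_pN N hv0 hv01 (D := |a| + CΘ) (by fun_prop) (fun y => ?_) (fun y => ?_) w
      · exact (abs_add_le _ _).trans (add_le_add le_rfl (hCΘ y))
      · have := hv0g y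
        have := hg 0 ⟨le_rfl, ht₀⟩
        have := mul_le_mul_of_nonneg_left (hΘφ y).1 hC
        simp only [ha, hΘ']
        linarith
    have h5 := hveq w
    have e : ((w.1, w.2) : SpT n) = w := rfl
    rw [e] at h1
    simp only [hW]
    rw [h3, h5, h1, h2]
    linarith
  · intro Z hZ hzZ w hw
    have hF₁w : F₁ w = -L - lap Θ' w.1 + N * (a + -L * w.2 + Θ' w.1) :=
      indicator_of_mem (by exact hw) _
    have hzw := mul_le_mul_of_nonneg_left (hzZ w hw) hN0.le
    simp only [hW] at hzw
    simp only [hFF, hF₁w, hlap']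
    by_cases hU : w.1 ∈ U
    · have h1 := hHU w hw hU
      rw [hlap _ hU]
      have h2 : L + Λ + L' * ψ w ≤ C * lam * φ w.1 + L' * f w := by
        have h3 := mul_le_mul_of_nonneg_left (hψ2 w) hL'
        by_cases hwA : w.1 ∈ A
        · have : f w = 1 := indicator_of_mem (by exact ⟨hwA, hw.1⟩) _
          rw [this]
          have := mul_nonneg hlam (hφ w.1)
          linarith
        · have := hAC _ hU hwA
          have := mul_nonneg hL' (f0 w)
          linarith
      simp only [hF₂]
      nlinarith
    · have h1 := hHB w hw hU
      have h2 := mul_le_mul_of_nonneg_left (hg w.2 hw) hN0.le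
      have h3 := mul_le_mul_of_nonneg_left (hK w.1) hC
      have h4 : 0 ≤ L' * F₂ w := mul_nonneg hL' (add_nonneg (f0 w)
        (mul_nonneg (by linarith) (ψ0 w)))
      have h5 : -ε ≤ Θ' w.1 := by
        have := mul_le_mul_of_nonneg_left (hΘφ w.1).1 hC
        have := mul_nonneg hC (hφ w.1)
        simp only [hΘ']; linarith
      have h6 := mul_le_mul_of_nonneg_left h5 hN0.le
      have h7 := mul_nonneg hN0.le hZ
      simp only [ha]
      nlinarith

end Barrier

section Eigen
variable {n : ℕ} {Ω : Set (Sp n)} {lam : ℝ} {φ : Sp n → ℝ}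

/-- A positive Dirichlet eigenfunction, extended by zero. -/
structure Eig (Ω : Set (Sp n)) (lam : ℝ) (φ : Sp n → ℝ) : Prop where
  open' : IsOpen Ω
  bounded : Bornology.IsBounded Ω
  lam_pos : 0 < lam
  cont : Continuous φ
  pos : ∀ x ∈ Ω, 0 < φ x
  zero : ∀ x, x ∉ Ω → φ x = 0
  contDiffOn : ContDiffOn ℝ 2 φ Ω
  eq : ∀ x ∈ Ω, lap φ x = -lam * φ x

lemma Eig.nonneg (E : Eig Ω lam φ) (x : Sp n) : 0 ≤ φ x := by
  by_cases h : x ∈ Ω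
  · exact (E.pos x h).le
  · exact (E.zero x h).ge

lemma Eig.mem_of_pos (E : Eig Ω lam φ) {x : Sp n} (h : 0 < φ x) : x ∈ Ω := by
  by_contra hx; exact h.ne' (E.zero x hx)

lemma Eig.isCompact_superlevel (E : Eig Ω lam φ) {c : ℝ} (hc : 0 < c) : IsCompact {x | c ≤ φ x} :=
  Metric.isCompact_of_isClosed_isBounded (isClosed_le continuous_const E.cont)
    (E.bounded.subset fun _ hx => E.mem_of_pos (hc.trans_le hx))

lemma Eig.volume_ne_top (E : Eig Ω lam φ) : volume Ω ≠ ⊤ := E.bounded.measure_lt_top.ne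

lemma lap_congr {f g : Sp n → ℝ} {x : Sp n} (h : f =ᶠ[nhds x] g) : lap f x = lap g x := by
  unfold lap
  refine Finset.sum_congr rfl fun i _ => ?_
  have h1 : (fun y => fderiv ℝ f y (EuclideanSpace.single i 1)) =ᶠ[nhds x]
      fun y => fderiv ℝ g y (EuclideanSpace.single i 1) := by
    filter_upwards [h.fderiv (𝕜 := ℝ)] with y hy
    rw [hy]
  rw [h1.fderiv_eq]

/-- Smooth compactly supported truncations of the eigenfunction. -/
lemma Eig.exists_cutoff (E : Eig Ω lam φ) {δ : ℝ} (hδ : 0 < δ) : ∃ Θ : Sp n → ℝ,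
    ContDiff ℝ 2 Θ ∧ HasCompactSupport Θ ∧ (∀ x, φ x - δ ≤ Θ x ∧ Θ x ≤ φ x) ∧
      ∀ x ∈ {x | δ < φ x}, lap Θ x = -lam * φ x := by
  set τ : Sp n → ℝ := fun x => Real.smoothTransition ((φ x - δ / 2) / (δ / 2)) with hτ
  have hzero : ∀ x, φ x ≤ δ / 2 → τ x = 0 := fun x hx =>
    Real.smoothTransition.zero_of_nonpos (div_nonpos_of_nonpos_of_nonneg (by linarith) (by linarith))
  have hone : ∀ x, δ ≤ φ x → τ x = 1 := fun x hx =>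
    Real.smoothTransition.one_of_one_le (by rw [le_div_iff₀ (by linarith)]; linarith)
  refine ⟨fun x => φ x * τ x, ?_, ?_, fun x => ?_, fun x hx => ?_⟩
  · rw [contDiff_iff_contDiffAt]
    intro x
    rcases lt_or_ge (φ x) (δ / 2) with hx | hx
    · have : (fun x => φ x * τ x) =ᶠ[nhds x] fun _ => 0 := by
        filter_upwards [E.cont.continuousAt.eventually (gt_mem_nhds hx)] with y hy
        rw [hzero y hy.le, mul_zero]
      exact contDiffAt_const.congr_of_eventuallyEq this
    · have hxΩ : x ∈ Ω := E.mem_of_pos (by linarith)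
      have h1 : ContDiffAt ℝ 2 φ x := E.contDiffOn.contDiffAt (E.open'.mem_nhds hxΩ)
      refine h1.mul ?_
      exact (Real.smoothTransition.contDiff (n := 2)).contDiffAt.comp x
        ((h1.sub contDiffAt_const).div_const _)
  · refine HasCompactSupport.of_support_subset_isCompact (E.isCompact_superlevel (half_pos hδ)) ?_
    intro x hx
    by_contra h
    exact hx (by simp only [hzero x (not_le.1 h).le, mul_zero])
  · have h0 := E.nonneg x
    have h1 : 0 ≤ τ x := Real.smoothTransition.nonneg _
    have h2 : τ x ≤ 1 := Real.smoothTransition.le_one _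
    refine ⟨?_, mul_le_of_le_one_right h0 h2⟩
    show φ x - δ ≤ φ x * τ x
    rcases le_total δ (φ x) with h | h
    · rw [hone x h]; linarith
    · have := mul_nonneg h0 h1; linarith
  · have : (fun x => φ x * τ x) =ᶠ[nhds x] φ := by
      filter_upwards [E.cont.continuousAt.eventually (lt_mem_nhds hx)] with y hy
      rw [hone y (le_of_lt hy), mul_one]
    rw [lap_congr this, E.eq x (E.mem_of_pos (hδ.trans hx))]

lemma exists_lap_le {Θ : Sp n → ℝ} (h : ContDiff ℝ 2 Θ) (hc : HasCompactSupport Θ) :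
    ∃ K, 0 ≤ K ∧ ∀ x, |lap Θ x| ≤ K := by
  have : ∀ i : Fin n, ∃ C, ∀ x, ‖fderiv ℝ (fun y => fderiv ℝ Θ y (EuclideanSpace.single i 1)) x
      (EuclideanSpace.single i 1)‖ ≤ C := by
    intro i
    have h1 : ContDiff ℝ 1 fun y => fderiv ℝ Θ y (EuclideanSpace.single i (1 : ℝ)) :=
      (h.fderiv_right (m := 1) (by norm_num)).clm_apply contDiff_const
    have h2 : Continuous fun x => fderiv ℝ (fun y => fderiv ℝ Θ y (EuclideanSpace.single i 1)) x
      (EuclideanSpace.single i (1 : ℝ)) :=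
      (h1.continuous_fderiv (by norm_num)).clm_apply continuous_const
    exact ((hc.fderiv_apply ℝ _).fderiv_apply ℝ _).exists_bound_of_continuous h2
  choose C hC using this
  have hs : ∀ x, |lap Θ x| ≤ ∑ i, C i := fun x =>
    (Finset.abs_sum_le_sum_abs _ _).trans (Finset.sum_le_sum fun i _ => hC i x)
  exact ⟨_, (abs_nonneg _).trans (hs 0), hs⟩

/-- Boundary layers have small measure. -/
lemma Eig.exists_layer (E : Eig Ω lam φ) {ε : ℝ} (hε : 0 < ε) :
    ∃ η > 0, volume {x ∈ Ω | φ x ≤ η} ≤ ENNReal.ofReal ε := by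
  set s : ℕ → Set (Sp n) := fun m => {x ∈ Ω | φ x ≤ 1 / ((m : ℝ) + 1)} with hs
  have hm : ∀ m, MeasurableSet (s m) := fun m =>
    E.open'.measurableSet.inter (measurableSet_le E.cont.measurable measurable_const)
  have hanti : Antitone s := fun a b hab x hx =>
    ⟨hx.1, hx.2.trans (one_div_le_one_div_of_le (by positivity) (by gcongr))⟩
  have hemp : ⋂ m, s m = ∅ := by
    refine eq_empty_iff_forall_notMem.2 fun x hx => ?_
    have hxΩ := (mem_iInter.1 hx 0).1
    obtain ⟨m, hm⟩ := exists_nat_one_div_lt (E.pos x hxΩ)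
    exact absurd (mem_iInter.1 hx m).2 (not_le.2 hm)
  have hl := tendsto_measure_iInter_atTop (μ := volume) (fun m => (hm m).nullMeasurableSet) hanti
    ⟨0, ne_top_of_le_ne_top E.volume_ne_top (measure_mono fun x hx => hx.1)⟩
  rw [hemp, measure_empty] at hl
  obtain ⟨m, hm⟩ := (hl.eventually (ge_mem_nhds (ENNReal.ofReal_pos.2 hε))).exists
  exact ⟨1 / ((m : ℝ) + 1), by positivity, hm⟩

end Eigen

section Sequence
variable {n : ℕ} {Ω : Set (Sp n)} {lam κ l Λ : ℝ} {h : ℝ → ℝ} {φ v0 : Sp n → ℝ}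

/-- A sequence of penalised problems exhausting `Ω`. -/
structure IsSeq (Ω : Set (Sp n)) (κ l : ℝ) (h : ℝ → ℝ) (Λ lam : ℝ) (φ v0 : Sp n → ℝ) (N : ℕ → ℝ)
    (V : ℕ → SpT n → ℝ) : Prop where
  approx : ∀ j, IsApprox Ω κ l h v0 (N j) {x | 1 / ((j : ℝ) + 1) < φ x} (V j)
  le : ∀ j, Λ ≤ N j
  one_le : ∀ j, 1 ≤ N j
  cutoff : ∀ j : ℕ, ∃ (Θ : Sp n → ℝ) (K : ℝ), ContDiff ℝ 2 Θ ∧ HasCompactSupport Θ ∧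
    (∀ x, φ x - 1 / ((j : ℝ) + 1) ≤ Θ x ∧ Θ x ≤ φ x) ∧
    (∀ x ∈ {x | 1 / ((j : ℝ) + 1) < φ x}, lap Θ x = -lam * φ x) ∧ (∀ x, lap Θ x ≤ K) ∧ 0 ≤ K ∧
    j * (1 + K) ≤ N j

lemma Eig.measurableSet_superlevel (E : Eig Ω lam φ) (c : ℝ) : MeasurableSet {x | c < φ x} :=
  measurableSet_lt measurable_const E.cont.measurable

lemma exists_isSeq (E : Eig Ω lam φ) (S : Setup Ω κ l h Λ v0) :
    ∃ N V, IsSeq Ω κ l h Λ lam φ v0 N V := by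
  have h1 : ∀ j : ℕ, ∃ (N : ℝ) (V : SpT n → ℝ),
      IsApprox Ω κ l h v0 N {x | 1 / ((j : ℝ) + 1) < φ x} V ∧ Λ ≤ N ∧ 1 ≤ N ∧
      ∃ (Θ : Sp n → ℝ) (K : ℝ), ContDiff ℝ 2 Θ ∧ HasCompactSupport Θ ∧
        (∀ x, φ x - 1 / ((j : ℝ) + 1) ≤ Θ x ∧ Θ x ≤ φ x) ∧
        (∀ x ∈ {x | 1 / ((j : ℝ) + 1) < φ x}, lap Θ x = -lam * φ x) ∧ (∀ x, lap Θ x ≤ K) ∧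
        0 ≤ K ∧ j * (1 + K) ≤ N := by
    intro j
    obtain ⟨Θ, t1, t2, t3, t4⟩ := E.exists_cutoff (δ := 1 / ((j : ℝ) + 1)) (by positivity)
    obtain ⟨K, hK0, hK⟩ := exists_lap_le t1 t2
    have hΛ := S.react.pos
    have hj : 0 ≤ (j : ℝ) * (1 + K) := by positivity
    obtain ⟨V, hV⟩ := exists_isApprox S (N := Λ + 1 + j * (1 + K)) (by linarith)
      (E.measurableSet_superlevel (1 / ((j : ℝ) + 1)))
    exact ⟨_, V, hV, by linarith, by linarith, Θ, K, t1, t2, t3, t4,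
      fun x => (le_abs_self _).trans (hK x), hK0, by linarith⟩
  choose N V h1 h2 h3 h4 using h1
  exact ⟨N, V, h1, h2, h3, h4⟩

variable {N : ℕ → ℝ} {V : ℕ → SpT n → ℝ}

/-- Equicontinuity on compact subsets of `Ω × [0,∞)`. -/
lemma IsSeq.equicontinuous (Q : IsSeq Ω κ l h Λ lam φ v0 N V) (E : Eig Ω lam φ)
    (S : Setup Ω κ l h Λ v0) {K : Set (Sp n)} (hK : IsCompact K) (hKΩ : K ⊆ Ω) (T : ℝ) {ε : ℝ}
    (hε : 0 < ε) : ∃ δ > 0, ∃ J : ℕ, ∀ j ≥ J, ∀ z ∈ K ×ˢ Icc 0 T, ∀ z' ∈ K ×ˢ Icc 0 T,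
      dist z z' < δ → |V j z - V j z'| < ε := by
  obtain ⟨R, hR, hRΩ⟩ := hK.exists_cthickening_subset_open E.open' hKΩ
  obtain ⟨m, hm, hmod⟩ := exists_approx_modulus S hR
  have hcpt : IsCompact (Metric.cthickening R K) := hK.cthickening
  obtain ⟨c, hc, hcK⟩ : ∃ c > 0, ∀ x ∈ Metric.cthickening R K, c ≤ φ x := by
    rcases (Metric.cthickening R K).eq_empty_or_nonempty with he | hne
    · exact ⟨1, one_pos, by simp [he]⟩
    · obtain ⟨x₀, hx₀, hmin⟩ := hcpt.exists_isMinOn hne E.cont.continuousOn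
      exact ⟨φ x₀, E.pos _ (hRΩ hx₀), fun x hx => hmin hx⟩
  obtain ⟨J, hJ⟩ := exists_nat_one_div_lt hc
  have hunif : UniformContinuousOn (pN 0 v0) (K ×ˢ Icc 0 T) :=
    (hK.prod isCompact_Icc).uniformContinuousOn_of_continuous
      ((continuousOn_pN 0 S.cont S.abs_init).mono fun w hw => hw.2.1)
  obtain ⟨δ₁, hδ₁, hd₁⟩ := Metric.uniformContinuousOn_iff.1 hunif (ε / 2) (half_pos hε)
  obtain ⟨δ₂, hδ₂, hd₂⟩ := Metric.tendsto_nhds_nhds.1 hm (ε / 2) (half_pos hε)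
  refine ⟨min δ₁ δ₂, lt_min hδ₁ hδ₂, J, fun j hj z hz z' hz' hzz => ?_⟩
  have hball : ∀ x ∈ K, Metric.ball x R ⊆ {x | 1 / ((j : ℝ) + 1) < φ x} := by
    intro x hx y hy
    have h1 : y ∈ Metric.cthickening R K :=
      Metric.mem_cthickening_of_dist_le y x R K hx (le_of_lt hy)
    have h2 : 1 / ((j : ℝ) + 1) ≤ 1 / ((J : ℝ) + 1) :=
      one_div_le_one_div_of_le (by positivity) (by gcongr)
    exact (h2.trans_lt hJ).trans_le (hcK y h1)
  have e1 := hmod _ _ _ (Q.le j) (E.measurableSet_superlevel _) (Q.approx j) z z'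
    (hball _ hz.1) (hball _ hz'.1)
  have e2 := hd₁ z hz z' hz' (hzz.trans_le (min_le_left _ _))
  have e3 := hd₂ (x := z - z') (by rw [dist_zero_right, ← dist_eq_norm]
                                   exact hzz.trans_le (min_le_right _ _))
  rw [Real.dist_eq] at e2
  rw [Real.dist_eq, sub_zero] at e3
  have e4 := (le_abs_self _).trans_lt e3
  rw [abs_lt] at *
  have e5 := abs_le.1 (e1.trans e4.le)
  rw [abs_le] at e1
  constructor <;> linarith [e1.1, e1.2, e2.1, e2.2]

/-- Equicontinuity of the boundary values. -/
lemma IsSeq.bval_modulus (Q : IsSeq Ω κ l h Λ lam φ v0 N V) (E : Eig Ω lam φ)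
    (S : Setup Ω κ l h Λ v0) (T : ℝ) {ε : ℝ} (hε : 0 < ε) : ∃ L ≥ 0, ∃ J : ℕ, ∀ j ≥ J,
      ∀ s ∈ Icc 0 T, ∀ t ∈ Icc 0 T,
        |bval Ω κ l (V j) s - bval Ω κ l (V j) t| ≤ ε + L * |s - t| := by
  have hκ := S.κ_nonneg
  set ε' := ε / (2 * (κ + 1)) with hε'
  have hε'0 : 0 < ε' := by positivity
  obtain ⟨η, hη, hvol⟩ := E.exists_layer hε'0
  have hVol : 0 ≤ (volume Ω).toReal := ENNReal.toReal_nonneg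
  have hpow : UniformContinuousOn (fun x : ℝ => x ^ l) (Icc 0 1) :=
    isCompact_Icc.uniformContinuousOn_of_continuous
      (continuousOn_id.rpow_const fun _ _ => Or.inr S.l_pos.le)
  obtain ⟨δ₁, hδ₁, hd₁⟩ := Metric.uniformContinuousOn_iff.1 hpow (ε / 2) (half_pos hε)
  obtain ⟨δ, hδ, J, hJ⟩ := Q.equicontinuous E S (E.isCompact_superlevel hη)
    (fun x hx => E.mem_of_pos (lt_of_lt_of_le hη hx)) T hδ₁
  refine ⟨1 / δ, by positivity, J, fun j hj s hs t ht => ?_⟩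
  have A := Q.approx j
  have bm : ∀ t, bval Ω κ l (V j) t ∈ Icc (0 : ℝ) 1 :=
    bval_mem S.fin S.l_pos S.κ_nonneg S.κ_le A.meas A.mem
  rcases le_or_gt δ |s - t| with hst | hst
  · have h1 : (1 : ℝ) ≤ 1 / δ * |s - t| := by
      rw [one_div, inv_mul_eq_div, one_le_div hδ]; exact hst
    have := bm s; have := bm t
    rw [abs_le]
    constructor <;> linarith [(bm s).1, (bm s).2, (bm t).1, (bm t).2]
  · set P := {x ∈ Ω | φ x ≤ η} with hP
    have hPm : MeasurableSet P :=
      E.open'.measurableSet.inter (measurableSet_le E.cont.measurable measurable_const)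
    have hPv : volume P ≠ ⊤ := ne_top_of_le_ne_top ENNReal.ofReal_ne_top hvol
    have i1 := integrableOn_rpow S.fin S.l_pos A.meas A.mem s
    have i2 := integrableOn_rpow S.fin S.l_pos A.meas A.mem t
    have hbd : ∀ x ∈ Ω, ‖V j (x, s) ^ l - V j (x, t) ^ l‖ ≤ ε / 2 + P.indicator (fun _ => 1) x := by
      intro x hx
      have m1 := A.mem (x, s)
      have m2 := A.mem (x, t)
      by_cases hxP : x ∈ P
      · rw [indicator_of_mem hxP, norm_eq_abs, abs_le]
        have a1 := rpow_nonneg m1.1 l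
        have a2 := rpow_nonneg m2.1 l
        have a3 := rpow_le_one m1.1 m1.2 S.l_pos.le
        have a4 := rpow_le_one m2.1 m2.2 S.l_pos.le
        constructor <;> linarith
      · rw [indicator_of_notMem hxP, add_zero]
        have hxη : η ≤ φ x := by
          by_contra h'; exact hxP ⟨hx, (not_le.1 h').le⟩
        have h1 := hJ j hj (x, s) ⟨hxη, hs⟩ (x, t) ⟨hxη, ht⟩ (by
          rw [Prod.dist_eq, dist_self, Real.dist_eq]
          exact max_lt hδ hst)
        have h2 := hd₁ _ m1 _ m2 h1
        rw [Real.dist_eq] at h2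
        exact h2.le
    have hi1 : IntegrableOn (fun _ : Sp n => ε / 2) Ω := integrableOn_const S.fin
    have hi2 : IntegrableOn (P.indicator fun _ => (1 : ℝ)) Ω :=
      ((integrable_indicator_iff hPm).2 (integrableOn_const hPv)).integrableOn
    have hi : IntegrableOn (fun x => ε / 2 + P.indicator (fun _ => (1 : ℝ)) x) Ω := hi1.add hi2
    have h3 : |bval Ω κ l (V j) s - bval Ω κ l (V j) t| ≤
        κ * ∫ x in Ω, (ε / 2 + P.indicator (fun _ => (1 : ℝ)) x) := by
      rw [bval, bval, ← mul_sub, abs_mul, abs_of_nonneg hκ, ← integral_sub i1 i2]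
      refine mul_le_mul_of_nonneg_left ?_ hκ
      exact norm_integral_le_of_norm_le hi ((ae_restrict_iff' E.open'.measurableSet).2
        (Eventually.of_forall hbd))
    have h4 : ∫ x in Ω, (ε / 2 + P.indicator (fun _ => (1 : ℝ)) x) ≤
        (volume Ω).toReal * (ε / 2) + ε' := by
      rw [integral_add hi1 hi2, setIntegral_const, setIntegral_indicator hPm,
        setIntegral_const, smul_eq_mul, smul_eq_mul, mul_one, Measure.real, Measure.real]
      gcongr
      refine ENNReal.toReal_le_of_le_ofReal hε'0.le ((measure_mono inter_subset_right).trans hvol)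
    have h5 : κ * ((volume Ω).toReal * (ε / 2) + ε') ≤ ε := by
      have h6 : κ * (volume Ω).toReal * (ε / 2) ≤ 1 * (ε / 2) :=
        mul_le_mul_of_nonneg_right S.κ_le (by positivity)
      have h7 : κ * ε' ≤ ε / 2 := by
        have : (κ + 1) * ε' = ε / 2 := by rw [hε']; field_simp
        linarith
      linarith
    have h8 : 0 ≤ 1 / δ * |s - t| := by positivity
    have := mul_le_mul_of_nonneg_left h4 hκ
    linarith

/-- Uniform attainment of the boundary values. -/
lemma IsSeq.abs_sub_bval_le (Q : IsSeq Ω κ l h Λ lam φ v0 N V) (E : Eig Ω lam φ)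
    (S : Setup Ω κ l h Λ v0) (hv0 : ∀ x, x ∉ Ω → v0 x = κ * ∫ y in Ω, v0 y ^ l) (T : ℝ) {ε : ℝ}
    (hε : 0 < ε) : ∃ C, ∃ J : ℕ, ∀ j ≥ J, ∀ x, ∀ t ∈ Icc 0 T,
      |V j (x, t) - bval Ω κ l (V j) t| ≤ 4 * ε + C * φ x := by
  set g0 := κ * ∫ y in Ω, v0 y ^ l with hg0
  have hΛ := S.react.pos
  have hlam := E.lam_pos
  obtain ⟨L, hL, J₁, hJ₁⟩ := Q.bval_modulus E S T hε
  set L' := 2 * (L + Λ) with hL'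
  have hL'0 : 0 < L' := by positivity
  obtain ⟨η₀, hη₀, hψ⟩ := exists_small_potential (n := n) (ε := min (1 / 2) (ε / L'))
    (lt_min (by norm_num) (by positivity))
  obtain ⟨η, hη, hvol⟩ := E.exists_layer hη₀
  have hAm : MeasurableSet {x ∈ Ω | φ x ≤ η} :=
    E.open'.measurableSet.inter (measurableSet_le E.cont.measurable measurable_const)
  replace hψ := hψ _ hAm hvol
  obtain ⟨c, hc, hcv⟩ : ∃ c > 0, ∀ x, ε ≤ |v0 x - g0| → c ≤ φ x := by
    have hcont : Continuous fun x => |v0 x - g0| := (S.cont.sub continuous_const).abs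
    set B := {x | ε ≤ |v0 x - g0|} with hB
    have hBΩ : B ⊆ Ω := fun x hx => by
      by_contra h
      have : ε ≤ |v0 x - g0| := hx
      rw [hv0 x h, sub_self, abs_zero] at this
      linarith
    have hBc : IsCompact B := Metric.isCompact_of_isClosed_isBounded
      (isClosed_le continuous_const hcont) (E.bounded.subset hBΩ)
    rcases B.eq_empty_or_nonempty with he | hne
    · exact ⟨1, one_pos, fun x hx => absurd (show x ∈ B from hx) (by simp [he])⟩
    · obtain ⟨x₀, hx₀, hmin⟩ := hBc.exists_isMinOn hne E.cont.continuousOn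
      exact ⟨φ x₀, E.pos _ (hBΩ hx₀), fun x hx => hmin hx⟩
  set C := 1 / c + L' / (lam * η) with hC
  have hC0 : 0 ≤ C := by positivity
  have hCc : 1 / c ≤ C := le_add_of_nonneg_right (by positivity)
  have hCη : L' / (lam * η) ≤ C := le_add_of_nonneg_left (by positivity)
  obtain ⟨g0m0, g0m1⟩ : g0 ∈ Icc (0 : ℝ) 1 :=
    bval_mem (v := fun w : SpT n => v0 w.1) S.fin S.l_pos S.κ_nonneg S.κ_le
      (S.cont.measurable.comp measurable_fst) (fun w => S.mem _) 0
  have hinit : ∀ x, |v0 x - g0| ≤ ε + C * φ x := by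
    intro x
    have hφ := E.nonneg x
    rcases lt_or_ge |v0 x - g0| ε with hx | hx
    · have := mul_nonneg hC0 hφ; linarith
    · have h1 := hcv x hx
      have h2 : 1 ≤ C * φ x := by
        calc 1 = 1 / c * c := by field_simp
          _ ≤ C * φ x := by gcongr
      have h3 : |v0 x - g0| ≤ 1 := by
        have := S.mem x
        rw [abs_le]; constructor <;> linarith [this.1, this.2]
      linarith
  obtain ⟨J₂, hJ₂⟩ := exists_nat_ge ((C + L) / ε)
  refine ⟨C, max J₁ J₂, fun j hj x t ht => ?_⟩
  have A := Q.approx j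
  obtain ⟨Θ, K, t1, t2, t3, t4, t5, hK0, t6⟩ := Q.cutoff j
  have hN1 := Q.one_le j
  have hjε : C + L ≤ j * ε := by
    have : (C + L) / ε ≤ j := hJ₂.trans (by exact_mod_cast (le_max_right _ _).trans hj)
    rwa [div_le_iff₀ hε] at this
  have hCδ : C * (1 / ((j : ℝ) + 1)) ≤ ε := by
    rw [mul_one_div, div_le_iff₀ (by positivity)]; nlinarith
  have hNε : L + C * K ≤ N j * ε := by
    have := mul_le_mul_of_nonneg_right t6 hε.le
    have h2 : (1 + K) * (C + L) ≤ (1 + K) * (j * ε) :=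
      mul_le_mul_of_nonneg_left hjε (by linarith)
    have h3 := mul_nonneg hK0 hL
    nlinarith
  have hψ2 := fun z => (hψ z).trans (min_le_left _ _)
  have hψ1 : ∀ z : SpT n,
      L' * cv (hkN 1) (({x ∈ Ω | φ x ≤ η} ×ˢ Ici (0 : ℝ)).indicator fun _ => 1) z ≤ ε := by
    intro z
    have := mul_le_mul_of_nonneg_left ((hψ z).trans (min_le_right _ _)) hL'0.le
    rwa [mul_div_cancel₀ _ hL'0.ne'] at this
  have hAC : ∀ x ∈ {x | 1 / ((j : ℝ) + 1) < φ x}, x ∉ {x ∈ Ω | φ x ≤ η} →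
      L' ≤ C * lam * φ x := by
    intro x hx hxA
    have hxΩ : x ∈ Ω := E.mem_of_pos (lt_trans (by positivity) hx)
    have hxη : η ≤ φ x := by
      by_contra h'; exact hxA ⟨hxΩ, (not_le.1 h').le⟩
    calc L' = L' / (lam * η) * lam * η := by field_simp
      _ ≤ C * lam * φ x := by gcongr
  have hlC : 0 ≤ C * lam := by positivity
  have hg0j : bval Ω κ l (V j) 0 = g0 := by
    simp only [bval, hg0, A.zero]
  have hmodg : ∀ s ∈ Icc 0 t, |bval Ω κ l (V j) s - bval Ω κ l (V j) t| ≤ ε + L * (t - s) := by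
    intro s hs
    have := hJ₁ j ((le_max_left _ _).trans hj) s ⟨hs.1, hs.2.trans ht.2⟩ t ht
    rwa [abs_sub_comm s t, abs_of_nonneg (show (0:ℝ) ≤ t - s by linarith [hs.2])] at this
  have bs := S.bm_src (Q.le j) (E.measurableSet_superlevel (1 / ((j : ℝ) + 1))) A.meas A.mem
  have upper := barrier (v := V j) (v0 := v0) (g := bval Ω κ l (V j)) (G := bval Ω κ l (V j) t)
    (Λ := Λ) hN1 ht.1 A.bm bs (fun w hw => src_neg hw) S.cont S.abs_init A.eq
    (fun w hw hwU => by
      rw [src_mem hw.1 hwU]; linarith [S.react.le _ (A.mem w)])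
    (fun w hw hwU => (src_notMem hw.1 hwU).le)
    (fun s hs => by linarith [(abs_le.1 (hmodg s hs)).2])
    (fun x => by rw [hg0j]; linarith [(abs_le.1 (hinit x)).2])
    t1 t2 hC0 hL'0.le t3 E.nonneg t4 t5 hCδ hAm hε.le hψ1 hψ2 le_rfl hAC hlC hNε x
  have lower := barrier (v := fun w => -V j w) (v0 := fun x => -v0 x)
    (H := fun w => -src Ω κ l h (N j) {x | 1 / ((j : ℝ) + 1) < φ x} (V j) w)
    (g := fun s => -bval Ω κ l (V j) s) (G := -bval Ω κ l (V j) t)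
    (Λ := Λ) hN1 ht.1 ⟨A.meas.neg, fun w => by rw [abs_neg]; exact A.bm.2 w⟩
    ⟨bs.1.neg, fun w => by rw [abs_neg]; exact bs.2 w⟩ (fun w hw => by rw [src_neg hw, neg_zero])
    S.cont.neg (fun x => by rw [abs_neg]; exact S.abs_init x)
    (fun w => by
      rw [A.eq w, neg_add]
      congr 1
      · unfold pN
        split_ifs
        · simp only [mul_neg, integral_neg]
        · simp
      · unfold cv; simp only [mul_neg, integral_neg])
    (fun w hw hwU => by
      rw [src_mem hw.1 hwU]; linarith [S.react.nonneg _ (A.mem w)])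
    (fun w hw hwU => by rw [src_notMem hw.1 hwU]; linarith)
    (fun s hs => by linarith [(abs_le.1 (hmodg s hs)).1])
    (fun x => by rw [hg0j]; linarith [(abs_le.1 (hinit x)).1])
    t1 t2 hC0 hL'0.le t3 E.nonneg t4 t5 hCδ hAm hε.le hψ1 hψ2 le_rfl hAC hlC hNε x
  rw [abs_le]
  constructor <;> linarith

end Sequence

section Limit
variable {n : ℕ} {Ω : Set (Sp n)} {lam κ l Λ : ℝ} {h : ℝ → ℝ} {φ v0 : Sp n → ℝ}
  {N : ℕ → ℝ} {V : ℕ → SpT n → ℝ}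

/-- A sequence with values in `[0,1]` which is asymptotically equicontinuous at every point of `A`
has a subsequence converging pointwise on `A`. -/
lemma exists_subseq_tendsto {X : Type*} [PseudoMetricSpace X] [TopologicalSpace.SeparableSpace X]
    {F : ℕ → X → ℝ} (hF : ∀ j x, F j x ∈ Icc (0 : ℝ) 1)
    (heq : ∀ x, ∀ ε > 0, ∃ δ > 0, ∃ J : ℕ, ∀ j ≥ J, ∀ y, dist x y < δ → |F j x - F j y| < ε) :
    ∃ (σ : ℕ → ℕ) (f : X → ℝ), StrictMono σ ∧
      ∀ x, Tendsto (fun j => F (σ j) x) atTop (nhds (f x)) := by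
  obtain ⟨D, hDc, hD⟩ := TopologicalSpace.exists_countable_dense X
  have : Countable D := hDc.to_subtype
  have hcpt : IsCompact (Set.univ.pi fun _ : D => Icc (0 : ℝ) 1) :=
    isCompact_univ_pi fun _ => isCompact_Icc
  obtain ⟨f, -, σ, hσ, hf⟩ := hcpt.tendsto_subseq (x := fun j (d : D) => F j d)
    fun j d _ => hF j d
  rw [tendsto_pi_nhds] at hf
  have hc : ∀ x, CauchySeq fun j => F (σ j) x := by
    intro x
    rw [Metric.cauchySeq_iff]
    intro ε hε
    obtain ⟨δ, hδ, J, hJ⟩ := heq x (ε / 3) (by positivity)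
    obtain ⟨d, hdD, hd⟩ := hD.exists_dist_lt x hδ
    obtain ⟨M, hM⟩ := Metric.cauchySeq_iff.1 (hf ⟨d, hdD⟩).cauchySeq (ε / 3) (by positivity)
    refine ⟨max M J, fun i hi j hj => ?_⟩
    have h1 := hJ (σ i) ((le_max_right _ _).trans (hi.trans (hσ.id_le i))) d hd
    have h2 := hJ (σ j) ((le_max_right _ _).trans (hj.trans (hσ.id_le j))) d hd
    have h3 := hM i ((le_max_left _ _).trans hi) j ((le_max_left _ _).trans hj)
    rw [Real.dist_eq] at *
    simp only [Function.comp_apply] at h3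
    rw [abs_lt] at *
    constructor <;> linarith [h1.1, h1.2, h2.1, h2.2, h3.1, h3.2]
  choose f hf using fun x => cauchySeq_tendsto_of_complete (hc x)
  exact ⟨σ, f, hσ, hf⟩

lemma IsSeq.equicontinuousAt (Q : IsSeq Ω κ l h Λ lam φ v0 N V) (E : Eig Ω lam φ)
    (S : Setup Ω κ l h Λ v0) {z : SpT n} (hz : z ∈ Ω ×ˢ Ici (0 : ℝ)) {ε : ℝ} (hε : 0 < ε) :
    ∃ δ > 0, ∃ J : ℕ, ∀ j ≥ J, ∀ y ∈ Ω ×ˢ Ici (0 : ℝ), dist z y < δ → |V j z - V j y| < ε := by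
  obtain ⟨r, hr, hrΩ⟩ := Metric.nhds_basis_closedBall.mem_iff.1 (E.open'.mem_nhds hz.1)
  obtain ⟨δ, hδ, J, hJ⟩ := Q.equicontinuous E S (isCompact_closedBall z.1 r) hrΩ (z.2 + 1) hε
  have hz2 : (0 : ℝ) ≤ z.2 := hz.2
  refine ⟨min δ (min r 1), by positivity, J, fun j hj y hy hzy => ?_⟩
  have h1 : dist z.1 y.1 < r := (le_max_left _ _).trans_lt
    (hzy.trans_le ((min_le_right _ _).trans (min_le_left _ _)))
  have h2 : dist z.2 y.2 < 1 := (le_max_right _ _).trans_lt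
    (hzy.trans_le ((min_le_right _ _).trans (min_le_right _ _)))
  rw [Real.dist_eq, abs_lt] at h2
  exact hJ j hj z ⟨Metric.mem_closedBall_self hr.le, hz2, by linarith⟩ y
    ⟨by rw [Metric.mem_closedBall, dist_comm]; exact h1.le, hy.2, by linarith [h2.1]⟩
    (hzy.trans_le (min_le_left _ _))

/-- The limit of a subsequence of penalised solutions. -/
structure IsLim (Ω : Set (Sp n)) (V : ℕ → SpT n → ℝ) (v : SpT n → ℝ) (σ : ℕ → ℕ) : Prop where
  mono : StrictMono σ
  meas : Measurable v
  mem : ∀ z, v z ∈ Icc (0 : ℝ) 1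
  tendsto : ∀ z ∈ Ω ×ˢ Ici (0 : ℝ), Tendsto (fun j => V (σ j) z) atTop (nhds (v z))

lemma IsSeq.exists_isLim (Q : IsSeq Ω κ l h Λ lam φ v0 N V) (E : Eig Ω lam φ)
    (S : Setup Ω κ l h Λ v0) : ∃ v σ, IsLim Ω V v σ := by
  obtain ⟨σ, f, hσ, hf⟩ := exists_subseq_tendsto (X := (Ω ×ˢ Ici (0 : ℝ) : Set (SpT n)))
    (F := fun j z => V j z) (fun j z => (Q.approx j).mem z)
    (fun z ε hε => by
      obtain ⟨δ, hδ, J, hJ⟩ := Q.equicontinuousAt E S z.2 hε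
      exact ⟨δ, hδ, J, fun j hj y hy => hJ j hj y y.2 hy⟩)
  classical
  have hA : MeasurableSet (Ω ×ˢ Ici (0 : ℝ) : Set (SpT n)) :=
    E.open'.measurableSet.prod measurableSet_Ici
  let v : SpT n → ℝ := fun z => if hz : z ∈ Ω ×ˢ Ici (0 : ℝ) then f ⟨z, hz⟩ else 0
  have hv : ∀ z ∈ Ω ×ˢ Ici (0 : ℝ), Tendsto (fun j => V (σ j) z) atTop (nhds (v z)) := by
    intro z hz
    simp only [v, dif_pos hz]
    exact hf ⟨z, hz⟩
  have hv0 : ∀ z ∉ Ω ×ˢ Ici (0 : ℝ), v z = 0 := fun z hz => dif_neg hz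
  refine ⟨v, σ, hσ, ?_, ?_, hv⟩
  · refine measurable_of_tendsto_metrizable
      (f := fun j => (Ω ×ˢ Ici (0 : ℝ)).indicator (V (σ j)))
      (fun j => (Q.approx _).meas.indicator hA) ?_
    rw [tendsto_pi_nhds]
    intro z
    by_cases hz : z ∈ Ω ×ˢ Ici (0 : ℝ)
    · simpa only [indicator_of_mem hz] using hv z hz
    · simp only [indicator_of_notMem hz, hv0 z hz]
      exact tendsto_const_nhds
  · intro z
    by_cases hz : z ∈ Ω ×ˢ Ici (0 : ℝ)
    · exact isClosed_Icc.mem_of_tendsto (hv z hz)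
        (Eventually.of_forall fun j => (Q.approx _).mem z)
    · rw [hv0 z hz]; simp

variable {v : SpT n → ℝ} {σ : ℕ → ℕ}

lemma IsLim.continuousOn (L : IsLim Ω V v σ) (Q : IsSeq Ω κ l h Λ lam φ v0 N V) (E : Eig Ω lam φ)
    (S : Setup Ω κ l h Λ v0) : ContinuousOn v (Ω ×ˢ Ici (0 : ℝ)) := by
  intro z hz
  rw [Metric.continuousWithinAt_iff]
  intro ε hε
  obtain ⟨δ, hδ, J, hJ⟩ := Q.equicontinuousAt E S hz (half_pos hε)
  refine ⟨δ, hδ, fun {y} hy hyz => ?_⟩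
  have h1 : |v z - v y| ≤ ε / 2 := by
    refine le_of_tendsto ((L.tendsto z hz).sub (L.tendsto y hy)).abs ?_
    filter_upwards [eventually_ge_atTop J] with j hj
    exact (hJ (σ j) (hj.trans (L.mono.id_le j)) y hy (by rwa [dist_comm])).le
  rw [Real.dist_eq, abs_sub_comm]
  linarith

lemma IsLim.zero (L : IsLim Ω V v σ) (Q : IsSeq Ω κ l h Λ lam φ v0 N V) {x : Sp n} (hx : x ∈ Ω) :
    v (x, 0) = v0 x := by
  refine tendsto_nhds_unique (L.tendsto (x, 0) ⟨hx, le_refl (0 : ℝ)⟩) ?_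
  simp only [(Q.approx _).zero]
  exact tendsto_const_nhds

lemma IsLim.tendsto_bval (L : IsLim Ω V v σ) (Q : IsSeq Ω κ l h Λ lam φ v0 N V)
    (S : Setup Ω κ l h Λ v0) {t : ℝ} (ht : 0 ≤ t) :
    Tendsto (fun j => bval Ω κ l (V (σ j)) t) atTop (nhds (bval Ω κ l v t)) :=
  _root_.tendsto_bval (V := fun j => V (σ j)) S.fin S.l_pos (fun _ => (Q.approx _).meas)
    (fun _ => (Q.approx _).mem)
    (fun y hy => L.tendsto (y, t) ⟨hy, ht⟩) S.open'.measurableSet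

lemma IsLim.bval_modulus (L : IsLim Ω V v σ) (Q : IsSeq Ω κ l h Λ lam φ v0 N V) (E : Eig Ω lam φ)
    (S : Setup Ω κ l h Λ v0) (T : ℝ) {ε : ℝ} (hε : 0 < ε) :
    ∃ C ≥ 0, ∀ s ∈ Icc 0 T, ∀ t ∈ Icc 0 T,
      |bval Ω κ l v s - bval Ω κ l v t| ≤ ε + C * |s - t| := by
  obtain ⟨C, hC, J, hJ⟩ := Q.bval_modulus E S T hε
  refine ⟨C, hC, fun s hs t ht => ?_⟩
  refine le_of_tendsto ((L.tendsto_bval Q S hs.1).sub (L.tendsto_bval Q S ht.1)).abs ?_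
  filter_upwards [eventually_ge_atTop J] with j hj
  exact hJ (σ j) (hj.trans (L.mono.id_le j)) s hs t ht

lemma IsLim.continuousOn_bval (L : IsLim Ω V v σ) (Q : IsSeq Ω κ l h Λ lam φ v0 N V)
    (E : Eig Ω lam φ) (S : Setup Ω κ l h Λ v0) : ContinuousOn (bval Ω κ l v) (Ici 0) := by
  intro t ht
  rw [Metric.continuousWithinAt_iff]
  intro ε hε
  obtain ⟨C, hC, hmod⟩ := L.bval_modulus Q E S (t + 1) (half_pos hε)
  have ht0 : (0 : ℝ) ≤ t := ht
  refine ⟨min 1 (ε / (2 * (C + 1))), by positivity, fun {s} hs hst => ?_⟩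
  have h1 := hst.trans_le (min_le_left _ _)
  have h2 := hst.trans_le (min_le_right _ _)
  rw [Real.dist_eq] at *
  have h3 := hmod s ⟨hs, by linarith [(abs_lt.1 h1).2]⟩ t ⟨ht0, by linarith⟩
  rw [lt_div_iff₀ (by positivity)] at h2
  have h4 : 0 ≤ |s - t| := abs_nonneg _
  rcases h4.eq_or_lt with h5 | h5
  · rw [← h5] at h3; linarith
  · nlinarith

lemma IsLim.abs_sub_bval_le (L : IsLim Ω V v σ) (Q : IsSeq Ω κ l h Λ lam φ v0 N V)
    (E : Eig Ω lam φ) (S : Setup Ω κ l h Λ v0) (hv0 : ∀ x ∉ Ω, v0 x = κ * ∫ y in Ω, v0 y ^ l)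
    (T : ℝ) {ε : ℝ} (hε : 0 < ε) :
    ∃ C, ∀ x ∈ Ω, ∀ t ∈ Icc 0 T, |v (x, t) - bval Ω κ l v t| ≤ 4 * ε + C * φ x := by
  obtain ⟨C, J, hJ⟩ := Q.abs_sub_bval_le E S hv0 T hε
  refine ⟨C, fun x hx t ht => ?_⟩
  refine le_of_tendsto ((L.tendsto (x, t) ⟨hx, ht.1⟩).sub (L.tendsto_bval Q S ht.1)).abs ?_
  filter_upwards [eventually_ge_atTop J] with j hj
  exact hJ (σ j) (hj.trans (L.mono.id_le j)) x t ht

end Limit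

section Regularity
variable {n : ℕ} {Ω : Set (Sp n)} {lam κ l Λ : ℝ} {h : ℝ → ℝ} {φ v0 : Sp n → ℝ}
  {N : ℕ → ℝ} {V : ℕ → SpT n → ℝ} {v : SpT n → ℝ} {σ : ℕ → ℕ}

lemma tendsto_cv {R C : ℝ} {ρ : SpT n → ℝ} (hρ : IsTest R ρ) {F : ℕ → SpT n → ℝ} {f : SpT n → ℝ}
    (hF : ∀ j, BM (F j) C) {z : SpT n}
    (hlim : ∀ y ∈ Metric.ball z R, Tendsto (fun j => F j y) atTop (nhds (f y))) :
    Tendsto (fun j => cv ρ (F j) z) atTop (nhds (cv ρ f z)) := by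
  refine tendsto_integral_of_dominated_convergence (fun w => ‖ρ w‖ * C) ?_
    (hρ.integrable.norm.mul_const C) ?_ ?_
  · intro j
    exact (hρ.1.continuous.measurable.mul
      ((hF j).1.comp (measurable_const.sub measurable_id))).aestronglyMeasurable
  · intro j
    refine Eventually.of_forall fun w => ?_
    rw [norm_mul]
    exact mul_le_mul_of_nonneg_left ((hF j).2 _) (norm_nonneg _)
  · refine Eventually.of_forall fun w => ?_
    by_cases hw : R ≤ ‖w‖
    · simp only [hρ.2 w hw, zero_mul]
      exact tendsto_const_nhds
    · exact tendsto_const_nhds.mul (hlim _ (by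
        rw [Metric.mem_ball, dist_eq_norm, sub_sub_cancel_left, norm_neg]; exact not_le.1 hw))

lemma IsLim.weak (L : IsLim Ω V v σ) (Q : IsSeq Ω κ l h Λ lam φ v0 N V) (E : Eig Ω lam φ)
    (S : Setup Ω κ l h Λ v0) {R : ℝ} {ρ : SpT n → ℝ} (hρ : IsTest R ρ) {z : SpT n}
    (hz : Metric.closedBall z.1 R ⊆ Ω) (hz2 : R ≤ z.2) :
    cv (HL ρ) v z = cv ρ (fun w => h (v w)) z := by
  have hlim : ∀ y ∈ Metric.ball z R, Tendsto (fun j => V (σ j) y) atTop (nhds (v y)) := by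
    intro y hy
    have h1 : dist y.1 z.1 < R := (le_max_left _ _).trans_lt hy
    have h2 : dist y.2 z.2 < R := (le_max_right _ _).trans_lt hy
    rw [Real.dist_eq, abs_lt] at h2
    exact L.tendsto y ⟨hz h1.le, show (0 : ℝ) ≤ y.2 by linarith [h2.1]⟩
  have hcont : Continuous h := S.react.contDiff.continuous
  obtain ⟨D, hD⟩ := (isCompact_Icc (a := (0:ℝ)) (b := 1)).exists_bound_of_continuousOn
    hcont.continuousOn
  have t1 := tendsto_cv hρ.HL (fun j => (Q.approx (σ j)).bm) hlim
  have t2 := tendsto_cv hρ (F := fun j w => h (V (σ j) w)) (f := fun w => h (v w)) (C := D)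
    (fun j => ⟨hcont.measurable.comp (Q.approx (σ j)).meas, fun w => hD _ ((Q.approx (σ j)).mem w)⟩)
    (fun y hy => (hcont.tendsto _).comp (hlim y hy))
  refine tendsto_nhds_unique t1 (t2.congr' ?_)
  obtain ⟨c, hc, hcK⟩ : ∃ c > 0, ∀ x ∈ Metric.closedBall z.1 R, c ≤ φ x := by
    rcases (Metric.closedBall z.1 R).eq_empty_or_nonempty with he | hne
    · exact ⟨1, one_pos, by simp [he]⟩
    · obtain ⟨x₀, hx₀, hmin⟩ := (isCompact_closedBall z.1 R).exists_isMinOn hne E.cont.continuousOn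
      exact ⟨φ x₀, E.pos _ (hz hx₀), fun x hx => hmin hx⟩
  obtain ⟨J, hJ⟩ := exists_nat_one_div_lt hc
  filter_upwards [eventually_ge_atTop J] with j hj
  refine ((Q.approx (σ j)).weak_interior S (Q.le _) (E.measurableSet_superlevel _) hρ hz2 ?_).symm
  intro x hx
  have h2 : 1 / ((σ j : ℝ) + 1) ≤ 1 / ((J : ℝ) + 1) :=
    one_div_le_one_div_of_le (by positivity) (by
      have : J ≤ σ j := hj.trans (L.mono.id_le j)
      gcongr)
  exact (h2.trans_lt hJ).trans_le (hcK x (Metric.ball_subset_closedBall hx))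

lemma IsLim.regular (L : IsLim Ω V v σ) (Q : IsSeq Ω κ l h Λ lam φ v0 N V) (E : Eig Ω lam φ)
    (S : Setup Ω κ l h Λ v0) {x : Sp n} (hx : x ∈ Ω) {t : ℝ} (ht : 0 < t) :
    ContDiffAt ℝ 2 (fun y => v (y, t)) x ∧
      HasDerivAt (fun s => v (x, s)) (lap (fun y => v (y, t)) x + h (v (x, t))) t := by
  obtain ⟨r, hr, hrΩ⟩ := Metric.nhds_basis_closedBall.mem_iff.1 (E.open'.mem_nhds hx)
  obtain ⟨R, hR, hRr, hRt⟩ : ∃ R > 0, 6 * R ≤ r ∧ 6 * R ≤ t :=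
    ⟨min r t / 6, by positivity, by linarith [min_le_left r t], by linarith [min_le_right r t]⟩
  have hv : BM v 1 := ⟨L.meas, fun z => abs_le.2 ⟨by linarith [(L.mem z).1], (L.mem z).2⟩⟩
  have hcont : Continuous h := S.react.contDiff.continuous
  obtain ⟨D, hD⟩ := hv.exists_comp hcont
  have key : ∀ z ∈ Metric.ball ((x, t) : SpT n) (4 * R),
      Metric.closedBall z.1 (2 * R) ⊆ Ω ∧ 2 * R < z.2 := by
    intro z hz
    have h1 : dist z.1 x < 4 * R := (le_max_left _ _).trans_lt hz
    have h2 : dist z.2 t < 4 * R := (le_max_right _ _).trans_lt hz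
    rw [Real.dist_eq, abs_lt] at h2
    refine ⟨fun y hy => hrΩ ?_, by linarith [h2.1]⟩
    rw [Metric.mem_closedBall] at *
    linarith [dist_triangle y z.1 x]
  refine interior_regularity hR S.react.contDiff hv hD (z₀ := (x, t)) ?_ ?_ (fun z _ => rfl)
  · intro z hz
    obtain ⟨h1, h2⟩ := key z hz
    refine (L.continuousOn Q E S).continuousAt ?_
    exact prod_mem_nhds (E.open'.mem_nhds (h1 (Metric.mem_closedBall_self (by positivity))))
      (Ici_mem_nhds (by linarith))
  · intro z hz ρ hρ
    obtain ⟨h1, h2⟩ := key z hz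
    exact L.weak Q E S hρ h1 h2.le

/-- Bounded classical solutions of the normalised problem. -/
theorem exists_normalised_solution (E : Eig Ω lam φ) (S : Setup Ω κ l h Λ v0)
    (hv0 : ∀ x ∉ Ω, v0 x = κ * ∫ y in Ω, v0 y ^ l) :
    ∃ v : SpT n → ℝ, (∀ z, v z ∈ Icc (0 : ℝ) 1) ∧ ContinuousOn v (Ω ×ˢ Ici (0 : ℝ)) ∧
      (∀ x ∈ Ω, v (x, 0) = v0 x) ∧ ContinuousOn (bval Ω κ l v) (Ici 0) ∧
      (∀ t, 0 ≤ bval Ω κ l v t) ∧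
      (∀ T, ∀ ε > 0, ∃ C, ∀ x ∈ Ω, ∀ t ∈ Icc 0 T, |v (x, t) - bval Ω κ l v t| ≤ ε + C * φ x) ∧
      ∀ x ∈ Ω, ∀ t > 0, ContDiffAt ℝ 2 (fun y => v (y, t)) x ∧
        HasDerivAt (fun s => v (x, s)) (lap (fun y => v (y, t)) x + h (v (x, t))) t := by
  obtain ⟨N, V, Q⟩ := exists_isSeq E S
  obtain ⟨v, σ, L⟩ := Q.exists_isLim E S
  refine ⟨v, L.mem, L.continuousOn Q E S, fun x hx => L.zero Q hx, L.continuousOn_bval Q E S,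
    fun t => (bval_mem S.fin S.l_pos S.κ_nonneg S.κ_le L.meas L.mem t).1, fun T ε hε => ?_,
    fun x hx t ht => L.regular Q E S hx ht⟩
  obtain ⟨C, hC⟩ := L.abs_sub_bval_le Q E S hv0 T (ε := ε / 4) (by positivity)
  exact ⟨C, fun x hx t ht => (hC x hx t ht).trans (by linarith)⟩

end Regularity

section Eigenvalue
variable {n : ℕ} {Ω : Set (Sp n)} {lam : ℝ} {φ : Sp n → ℝ}

lemma lap_const_mul (c : ℝ) (f : Sp n → ℝ) (x : Sp n) :
    lap (fun y => c * f y) x = c * lap f x := by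
  have h1 : ∀ g : Sp n → ℝ, fderiv ℝ (fun y => c * g y) = c • fderiv ℝ g := fun g =>
    fderiv_const_smul_field (f := g) c
  unfold lap
  rw [Finset.mul_sum]
  refine Finset.sum_congr rfl fun i _ => ?_
  rw [h1]
  change fderiv ℝ (fun y => c * fderiv ℝ f y _) x _ = _
  rw [h1]
  rfl

lemma lap_const (c : ℝ) (x : Sp n) : lap (fun _ : Sp n => c) x = 0 := by
  simp [lap]

lemma lap_nonpos_of_isLocalMax {f : Sp n → ℝ} {x : Sp n} (hf : ContDiffAt ℝ 2 f x)
    (hmax : IsLocalMax f x) : lap f x ≤ 0 := by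
  unfold lap
  refine Finset.sum_nonpos fun i _ => ?_
  set e : Sp n := EuclideanSpace.single i 1
  let γ : ℝ → Sp n := fun s => x + s • e
  have hγ : ∀ s, HasDerivAt γ e s := fun s => by
    have := ((hasDerivAt_id s).smul_const e).const_add x
    rw [one_smul] at this
    exact this
  have hγ0 : γ 0 = x := by simp [γ]
  have hγc : Tendsto γ (nhds 0) (nhds x) := by
    have := (hγ 0).continuousAt.tendsto
    rwa [hγ0] at this
  have hd : ∀ᶠ y in nhds x, DifferentiableAt ℝ f y := by
    filter_upwards [hf.eventually (by simp)] with y hy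
    exact hy.differentiableAt (by norm_num)
  have hderiv : deriv (fun s => f (γ s)) =ᶠ[nhds 0] fun s => fderiv ℝ f (γ s) e := by
    filter_upwards [hγc.eventually hd] with s hs
    exact (hs.hasFDerivAt.comp_hasDerivAt s (hγ s)).deriv
  have hdd : DifferentiableAt ℝ (fun y => fderiv ℝ f y e) (γ 0) := by
    rw [hγ0]
    have := (hf.fderiv_right (m := 1) (by norm_num)).differentiableAt (by norm_num)
    exact this.clm_apply (differentiableAt_const e)
  have hsecond : deriv (deriv fun s => f (γ s)) 0 = fderiv ℝ (fun y => fderiv ℝ f y e) x e := by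
    rw [hderiv.deriv_eq]
    have := (hdd.hasFDerivAt.comp_hasDerivAt 0 (hγ 0)).deriv
    rwa [hγ0] at this
  have hlm : IsLocalMax (fun s => f (γ s)) 0 := by
    have : ∀ᶠ y in nhds x, f y ≤ f x := hmax
    filter_upwards [hγc.eventually this] with s hs
    rwa [hγ0]
  rw [← hsecond]
  by_contra hpos
  have hmin := isLocalMin_of_deriv_deriv_pos (not_le.1 hpos) hlm.deriv_eq_zero (by
    have hfc : ContinuousAt f (γ 0) := by rw [hγ0]; exact hf.continuousAt
    exact hfc.comp (hγ 0).continuousAt)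
  have hconst : (fun s => f (γ s)) =ᶠ[nhds 0] fun _ => f (γ 0) := by
    have h1 : ∀ᶠ s in nhds 0, f (γ s) ≤ f (γ 0) := hlm
    have h2 : ∀ᶠ s in nhds 0, f (γ 0) ≤ f (γ s) := hmin
    filter_upwards [h1, h2] with s hs1 hs2 using le_antisymm hs1 hs2
  rw [hconst.deriv.deriv_eq] at hpos
  simp at hpos

lemma IsDirichletEigen.nonneg (h : IsDirichletEigen Ω lam φ) (ho : IsOpen Ω)
    (hb : Bornology.IsBounded Ω) (hne : Ω.Nonempty) : 0 ≤ lam := by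
  obtain ⟨h1, h2, h3, h4, h5⟩ := h
  obtain ⟨x, hx, hmax⟩ := hb.isCompact_closure.exists_isMaxOn hne.closure h1
  obtain ⟨y, hy⟩ := hne
  have hpos : 0 < φ x := (h5 y hy).trans_le (hmax (subset_closure hy))
  have hxΩ : x ∈ Ω := by
    by_contra hx'
    exact hpos.ne' (h4 x (by rw [ho.frontier_eq]; exact ⟨hx, hx'⟩))
  have hloc : IsLocalMax φ x := by
    filter_upwards [ho.mem_nhds hxΩ] with z hz using hmax (subset_closure hz)
  have := lap_nonpos_of_isLocalMax (h2.contDiffAt (ho.mem_nhds hxΩ)) hloc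
  have h6 := h3 x hxΩ
  by_contra hneg
  nlinarith [not_le.1 hneg]

open Classical in
lemma IsDirichletEigen.eig (h : IsDirichletEigen Ω lam φ) (ho : IsOpen Ω)
    (hb : Bornology.IsBounded Ω) (hlam : 0 < lam) :
    Eig Ω lam (Ω.piecewise φ fun _ => 0) := by
  obtain ⟨h1, h2, h3, h4, h5⟩ := h
  have heq : EqOn (Ω.piecewise φ fun _ => 0) φ Ω := piecewise_eqOn _ _ _
  refine ⟨ho, hb, hlam, continuous_piecewise h4 h1 continuousOn_const, fun x hx => ?_,
    fun x hx => piecewise_eq_of_notMem _ _ _ hx, h2.congr heq, fun x hx => ?_⟩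
  · rw [heq hx]; exact h5 x hx
  · rw [lap_congr (heq.eventuallyEq_of_mem (ho.mem_nhds hx)), heq hx]
    linarith [h3 x hx]

end Eigenvalue

/-- The reaction `lam (x - x ^ q)`. -/
lemma reaction_rpow {lam q : ℝ} (hlam : 0 < lam) (hq : 1 < q) :
    Reaction (fun x => lam * (x - x ^ q)) (lam * q) := by
  have hq0 : 0 < q := by linarith
  have hC : ContDiff ℝ 1 fun x : ℝ => x ^ q := by
    have := Real.contDiff_rpow_const_of_le (p := q) (n := 1) (by simpa using hq.le)
    simpa using this
  refine ⟨by positivity, (contDiff_id.sub hC).const_smul lam, ?_, by simp, ?_, ?_, ?_⟩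
  · simp [Real.zero_rpow hq0.ne']
  · intro x hx
    have := Real.rpow_le_rpow_of_exponent_ge' hx.1 hx.2 zero_le_one hq.le
    rw [Real.rpow_one] at this
    exact mul_nonneg hlam.le (by linarith)
  · intro x hx
    have := Real.rpow_nonneg hx.1 q
    have h1 : x - x ^ q ≤ q := by linarith [hx.2]
    exact mul_le_mul_of_nonneg_left h1 hlam.le
  · intro N hN
    have hd : ∀ x : ℝ, HasDerivAt (fun x => N * x + lam * (x - x ^ q))
        (N * 1 + lam * (1 - q * x ^ (q - 1))) x := fun x =>
      ((hasDerivAt_id x).const_mul N).add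
        (((hasDerivAt_id x).sub (Real.hasDerivAt_rpow_const (Or.inr hq.le))).const_mul lam)
    refine monotoneOn_of_deriv_nonneg (convex_Icc _ _)
      (fun x _ => (hd x).continuousAt.continuousWithinAt)
      (fun x _ => (hd x).differentiableAt.differentiableWithinAt) fun x hx => ?_
    rw [interior_Icc] at hx
    rw [(hd x).deriv]
    have h1 : x ^ (q - 1) ≤ 1 := Real.rpow_le_one hx.1.le hx.2.le (by linarith)
    have h2 : lam * (q * x ^ (q - 1)) ≤ lam * (q * 1) := by gcongr
    nlinarith

/-- Scaling identity for powers of `M e^{-λt} w`. -/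
lemma exp_mul_scaled_rpow {M lam s t w : ℝ} (hM : 0 < M) (hw : 0 ≤ w) :
    Real.exp (lam * (s - 1) * t) * (M * Real.exp (-lam * t) * w) ^ s
      = M * Real.exp (-lam * t) * (M ^ (s - 1) * w ^ s) := by
  rw [Real.mul_rpow (by positivity) hw, Real.mul_rpow hM.le (Real.exp_pos _).le, ← Real.exp_mul,
    Real.rpow_sub_one hM.ne']
  have : Real.exp (lam * (s - 1) * t) * Real.exp (-lam * t * s) = Real.exp (-lam * t) := by
    rw [← Real.exp_add]; congr 1; ring
  rw [← this]
  field_simp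

section Assembly
variable {n : ℕ} {Ω : Set (Sp n)} {lam κ l : ℝ} {φ : Sp n → ℝ}

open Classical in
/-- A function on `Ω` that approaches a continuous `g` at the boundary extends continuously by `g`. -/
lemma continuousOn_extension (ho : IsOpen Ω) (hφ : Continuous φ) (hφ0 : ∀ x ∉ Ω, φ x = 0)
    {v : SpT n → ℝ} {g : ℝ → ℝ} (hv : ContinuousOn v (Ω ×ˢ Ici (0 : ℝ)))
    (hg : ContinuousOn g (Ici 0))
    (hb : ∀ T, ∀ ε > 0, ∃ C, ∀ x ∈ Ω, ∀ t ∈ Icc 0 T, |v (x, t) - g t| ≤ ε + C * φ x) (T : ℝ) :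
    ContinuousOn (fun z : SpT n => if z.1 ∈ Ω then v z else g z.2) (closure Ω ×ˢ Ico 0 T) := by
  intro z hz
  by_cases hzΩ : z.1 ∈ Ω
  · have h1 : ContinuousWithinAt v (closure Ω ×ˢ Ico 0 T) z := by
      refine (hv z ⟨hzΩ, hz.2.1⟩).mono_of_mem_nhdsWithin ?_
      have h2 : {y : SpT n | y.1 ∈ Ω} ∈ nhds z := continuous_fst.continuousAt (ho.mem_nhds hzΩ)
      filter_upwards [mem_nhdsWithin_of_mem_nhds h2, self_mem_nhdsWithin] with y hy1 hy2
      exact ⟨hy1, hy2.2.1⟩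
    refine h1.congr_of_eventuallyEq ?_ (if_pos hzΩ)
    have h2 : {y : SpT n | y.1 ∈ Ω} ∈ nhds z := continuous_fst.continuousAt (ho.mem_nhds hzΩ)
    filter_upwards [mem_nhdsWithin_of_mem_nhds h2] with y hy using if_pos hy
  · have hgz : ContinuousWithinAt (fun y : SpT n => g y.2) (closure Ω ×ˢ Ico 0 T) z :=
      (hg z.2 hz.2.1).comp continuous_snd.continuousWithinAt fun y hy => hy.2.1
    have hφz : Tendsto (fun y : SpT n => φ y.1) (nhdsWithin z (closure Ω ×ˢ Ico 0 T)) (nhds 0) := by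
      have := ((hφ.comp continuous_fst).continuousWithinAt (s := closure Ω ×ˢ Ico 0 T)
        (x := z)).tendsto
      rw [Function.comp_apply, hφ0 _ hzΩ] at this
      exact this
    rw [Metric.continuousWithinAt_iff'] at hgz ⊢
    intro ε hε
    obtain ⟨C, hC⟩ := hb T (ε / 3) (by positivity)
    have h3 : Tendsto (fun y : SpT n => C * φ y.1) (nhdsWithin z (closure Ω ×ˢ Ico 0 T))
        (nhds 0) := by simpa using hφz.const_mul C
    filter_upwards [hgz (ε / 3) (by positivity), h3.eventually (gt_mem_nhds (by positivity : 0 < ε / 3)),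
      self_mem_nhdsWithin] with y hy1 hy2 hy3
    simp only [if_neg hzΩ]
    rw [Real.dist_eq] at *
    by_cases hy : y.1 ∈ Ω
    · simp only [if_pos hy]
      have h4 := hC y.1 hy y.2 ⟨hy3.2.1, hy3.2.2.le⟩
      have h5 := abs_sub_le (v y) (g y.2) (g z.2)
      have h6 : |v y - g y.2| ≤ ε / 3 + C * φ y.1 := h4
      linarith
    · simp only [if_neg hy]
      linarith

open Classical in
/-- Initial datum of the normalised problem, extended by the boundary value. -/
lemma exists_normalised_init {k₀ M : ℝ} {u0 : Sp n → ℝ} (hfin : volume Ω ≠ ⊤) (hl : 1 < l)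
    (hk₀ : 0 < k₀) (hM : 0 < M) (hκ : k₀ * M ^ (l - 1) * (volume Ω).toReal ≤ 1)
    (ho : IsOpen Ω) (hc : ContinuousOn u0 (closure Ω)) (h0 : ∀ x ∈ closure Ω, 0 ≤ u0 x)
    (h1 : ∀ x ∈ closure Ω, u0 x ≤ M) (hcomp : ∀ x ∈ frontier Ω, u0 x = ∫ y in Ω, k₀ * u0 y ^ l) :
    ∃ v0 : Sp n → ℝ, Continuous v0 ∧ (∀ x, v0 x ∈ Icc (0 : ℝ) 1) ∧ (∀ x ∈ Ω, u0 x = M * v0 x) ∧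
      ∀ x ∉ Ω, v0 x = k₀ * M ^ (l - 1) * ∫ y in Ω, v0 y ^ l := by
  set G : ℝ := k₀ * M ^ (l - 1) * ∫ y in Ω, (u0 y / M) ^ l with hG
  have heq : EqOn (Ω.piecewise (fun x => u0 x / M) fun _ => G) (fun x => u0 x / M) Ω :=
    piecewise_eqOn _ _ _
  have hm : ∀ x ∈ Ω, u0 x / M ∈ Icc (0 : ℝ) 1 := fun x hx =>
    ⟨div_nonneg (h0 x (subset_closure hx)) hM.le, (div_le_one hM).2 (h1 x (subset_closure hx))⟩
  have hG' : G = (∫ y in Ω, k₀ * u0 y ^ l) / M := by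
    rw [hG, ← integral_const_mul, ← integral_div]
    refine setIntegral_congr_fun ho.measurableSet fun y hy => ?_
    rw [Real.div_rpow (h0 y (subset_closure hy)) hM.le, Real.rpow_sub_one hM.ne']
    have : M ^ l ≠ 0 := (Real.rpow_pos_of_pos hM l).ne'
    field_simp
  have hGm : G ∈ Icc (0 : ℝ) 1 := by
    have hκ0 : 0 ≤ k₀ * M ^ (l - 1) := by positivity
    refine ⟨mul_nonneg hκ0 (setIntegral_nonneg ho.measurableSet fun y hy =>
      Real.rpow_nonneg (hm y hy).1 l), ?_⟩
    have := norm_setIntegral_le_of_norm_le_const (μ := volume) (s := Ω)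
      (f := fun y => (u0 y / M) ^ l) (C := 1) hfin.lt_top fun y hy => by
        rw [Real.norm_of_nonneg (Real.rpow_nonneg (hm y hy).1 l)]
        exact Real.rpow_le_one (hm y hy).1 (hm y hy).2 (by linarith)
    rw [one_mul, Real.norm_eq_abs] at this
    exact (mul_le_mul_of_nonneg_left ((le_abs_self _).trans this) hκ0).trans hκ
  refine ⟨Ω.piecewise (fun x => u0 x / M) fun _ => G, continuous_piecewise ?_ (hc.div_const M)
    continuousOn_const, fun x => ?_, fun x hx => ?_, fun x hx => ?_⟩
  · intro x hx
    rw [hG', hcomp x hx]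
  · by_cases hx : x ∈ Ω
    · rw [heq hx]; exact hm x hx
    · rw [piecewise_eq_of_notMem _ _ _ hx]; exact hGm
  · rw [heq hx]; field_simp
  · rw [piecewise_eq_of_notMem _ _ _ hx, hG]
    congr 1
    refine setIntegral_congr_fun ho.measurableSet fun y hy => ?_
    exact congrArg (· ^ l) (heq hy).symm

end Assembly

/-- **Sharpness of the hypothesis on `b` (constant `ε` not allowed).** Let
`min(q,l) > 1`, `b₀ > 0`, `k₀ > 0` with `k₀ ≤ |Ω|⁻¹ (b₀/λ₁)^{(l−1)/(q−1)}`, and take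
`a ≡ 0`, `b(x,t) = b₀ exp[λ₁(q−1)t]`, `k(x,y,t) = k₀ exp[λ₁(l−1)t]`. Then
`ū(x,t) = (λ₁/b₀)^{1/(q−1)} e^{−λ₁t}` is a supersolution of problem (P) in `Q_T` for
every `T > 0` whenever `u₀ ≤ (λ₁/b₀)^{1/(q−1)}`, and problem (P) has global solutions
for such initial data. -/
theorem sharpness_constant_epsilon {n : ℕ} (r p q l : ℝ)
    (hr : 0 < r) (hp : 0 < p) (hq : 1 < q) (hl : 1 < l)
    (Ω : Set (EuclideanSpace ℝ (Fin n)))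
    (a b : EuclideanSpace ℝ (Fin n) → ℝ → ℝ)
    (k : EuclideanSpace ℝ (Fin n) → EuclideanSpace ℝ (Fin n) → ℝ → ℝ)
    (hdata : GoodData Ω a b k)
    (lam : ℝ) (φ : EuclideanSpace ℝ (Fin n) → ℝ) (heig : IsFirstEigen Ω lam φ)
    (b₀ k₀ : ℝ) (hb₀ : 0 < b₀) (hk₀ : 0 < k₀)
    (hk₀le : k₀ ≤ ((volume Ω).toReal)⁻¹ * (b₀ / lam) ^ ((l - 1) / (q - 1)))
    (ha : ∀ x t, a x t = 0)
    (hb : ∀ x t, b x t = b₀ * Real.exp (lam * (q - 1) * t))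
    (hk : ∀ x y t, k x y t = k₀ * Real.exp (lam * (l - 1) * t)) :
    ∀ u0 : EuclideanSpace ℝ (Fin n) → ℝ, GoodInit Ω k l u0 →
      (∀ x ∈ closure Ω, u0 x ≤ (lam / b₀) ^ (1 / (q - 1))) →
      (∀ T : ℝ, 0 < T → IsSuperSol r p q l Ω a b k u0 T
        (fun _ t => (lam / b₀) ^ (1 / (q - 1)) * Real.exp (-lam * t))) ∧
      ∃ u : EuclideanSpace ℝ (Fin n) → ℝ → ℝ,
        ∀ T : ℝ, 0 < T → IsSol r p q l Ω a b k u0 T u := by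
  classical
  obtain ⟨ho, hbd, hne, -⟩ := hdata
  have hq1 : 0 < q - 1 := by linarith
  have hl1 : 0 < l - 1 := by linarith
  have hlam : 0 < lam := by
    refine (heig.1.nonneg ho hbd hne).lt_of_ne fun h0 => ?_
    rw [← h0, div_zero, Real.zero_rpow (by positivity), mul_zero] at hk₀le
    linarith
  have E := heig.1.eig ho hbd hlam
  have hfin : volume Ω ≠ ⊤ := E.volume_ne_top
  have hvol : 0 < (volume Ω).toReal := ENNReal.toReal_pos (ho.measure_pos volume hne).ne' hfin
  intro u0 ⟨hc, h0, hcomp⟩ hle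
  set M : ℝ := (lam / b₀) ^ (1 / (q - 1)) with hMdef
  have hM : 0 < M := by positivity
  have hMq : b₀ * M ^ (q - 1) = lam := by
    rw [hMdef, ← Real.rpow_mul (by positivity), one_div_mul_cancel hq1.ne', Real.rpow_one]
    field_simp
  have hκ : k₀ * M ^ (l - 1) * (volume Ω).toReal ≤ 1 := by
    have h1 : M ^ (l - 1) = (lam / b₀) ^ ((l - 1) / (q - 1)) := by
      rw [hMdef, ← Real.rpow_mul (by positivity)]; congr 1; ring
    have h2 : (b₀ / lam) ^ ((l - 1) / (q - 1)) * M ^ (l - 1) = 1 := by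
      rw [h1, ← Real.mul_rpow (by positivity) (by positivity),
        show b₀ / lam * (lam / b₀) = 1 by field_simp, Real.one_rpow]
    calc k₀ * M ^ (l - 1) * (volume Ω).toReal
        ≤ ((volume Ω).toReal)⁻¹ * (b₀ / lam) ^ ((l - 1) / (q - 1)) * M ^ (l - 1)
          * (volume Ω).toReal := by gcongr
      _ = ((volume Ω).toReal)⁻¹ * (volume Ω).toReal
          * ((b₀ / lam) ^ ((l - 1) / (q - 1)) * M ^ (l - 1)) := by ring
      _ = 1 := by rw [h2, inv_mul_cancel₀ hvol.ne', one_mul]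
  have hbq : ∀ (x : EuclideanSpace ℝ (Fin n)) (t w : ℝ), 0 ≤ w →
      b x t * (M * Real.exp (-lam * t) * w) ^ q = M * Real.exp (-lam * t) * (lam * w ^ q) := by
    intro x t w hw
    rw [hb, mul_assoc, exp_mul_scaled_rpow hM hw, ← hMq]; ring
  have hkl : ∀ (x y : EuclideanSpace ℝ (Fin n)) (t w : ℝ), 0 ≤ w →
      k x y t * (M * Real.exp (-lam * t) * w) ^ l
        = M * Real.exp (-lam * t) * (k₀ * M ^ (l - 1) * w ^ l) := by
    intro x y t w hw
    rw [hk, mul_assoc, exp_mul_scaled_rpow hM hw]; ring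
  have hexp : ∀ t : ℝ, HasDerivAt (fun s => M * Real.exp (-lam * s))
      (M * (Real.exp (-lam * t) * -lam)) t := fun t => by
    have h1 : HasDerivAt (fun s : ℝ => -lam * s) (-lam) t := by
      simpa using (hasDerivAt_id t).const_mul (-lam)
    exact h1.exp.const_mul M
  refine ⟨fun T _ => ⟨⟨?_, ?_, ?_⟩, ?_, ?_, ?_, ?_⟩, ?_⟩
  · exact Continuous.continuousOn (by fun_prop)
  · exact fun t _ => contDiffOn_const
  · exact fun x _ t _ => (hexp t).differentiableAt
  · intro x _ t _; positivity
  · intro x _ t _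
    have h1 := hbq x t 1 zero_le_one
    rw [mul_one, Real.one_rpow] at h1
    change deriv (fun s => M * Real.exp (-lam * s)) t ≥ lap (fun _ => M * Real.exp (-lam * t)) x
      + a x t * (M * Real.exp (-lam * t)) ^ r * _ - b x t * (M * Real.exp (-lam * t)) ^ q
    rw [(hexp t).deriv, h1, ha, lap_const]
    apply le_of_eq; ring
  · intro x _ t _
    have h1 : ∀ y, k x y t * (M * Real.exp (-lam * t)) ^ l
        = M * Real.exp (-lam * t) * (k₀ * M ^ (l - 1)) := fun y => by
      have h1 := hkl x y t 1 zero_le_one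
      rwa [mul_one, Real.one_rpow, mul_one] at h1
    simp only [h1, setIntegral_const, smul_eq_mul, measureReal_def]
    have h2 : 0 < M * Real.exp (-lam * t) := by positivity
    calc (volume Ω).toReal * (M * Real.exp (-lam * t) * (k₀ * M ^ (l - 1)))
        = M * Real.exp (-lam * t) * (k₀ * M ^ (l - 1) * (volume Ω).toReal) := by ring
      _ ≤ M * Real.exp (-lam * t) * 1 := by gcongr
      _ = M * Real.exp (-lam * t) := mul_one _
  · intro x hx
    simpa using hle x (subset_closure hx)
  obtain ⟨v0, hv0c, hv0m, hv0Ω, hv0o⟩ := exists_normalised_init hfin hl hk₀ hM hκ ho hc h0 hle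
    (fun x hx => by rw [hcomp x hx]; simp [hk])
  have S : Setup Ω (k₀ * M ^ (l - 1)) l (fun x => lam * (x - x ^ q)) (lam * q) v0 :=
    ⟨reaction_rpow hlam hq, ho, hfin, hl, by positivity, hκ, hv0c, hv0m⟩
  obtain ⟨v, hvm, hvc, hvi, hgc, hg0, hvb, hvr⟩ := exists_normalised_solution E S hv0o
  set g := bval Ω (k₀ * M ^ (l - 1)) l v with hg
  let u : EuclideanSpace ℝ (Fin n) → ℝ → ℝ := fun x t =>
    M * Real.exp (-lam * t) * if x ∈ Ω then v (x, t) else g t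
  have huΩ : ∀ x ∈ Ω, ∀ t, u x t = M * Real.exp (-lam * t) * v (x, t) := fun x hx t => by
    simp only [u, if_pos hx]
  have hreg : ∀ T, RegQ Ω T u := by
    refine fun T => ⟨?_, fun t ht => ?_, fun x hx t ht => ?_⟩
    · exact (Continuous.continuousOn (by fun_prop)).mul
        (continuousOn_extension ho E.cont E.zero hvc hgc hvb T)
    · refine ContDiffOn.congr (f := fun x => M * Real.exp (-lam * t) * v (x, t)) ?_
        fun x hx => huΩ x hx t
      exact fun x hx => (contDiffAt_const.mul (hvr x hx t ht.1).1).contDiffWithinAt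
    · rw [show u x = fun t => M * Real.exp (-lam * t) * v (x, t) from funext (huΩ x hx)]
      exact (hexp t).differentiableAt.mul (hvr x hx t ht.1).2.differentiableAt
  have hnn : ∀ x t, 0 ≤ u x t := fun x t => by
    refine mul_nonneg (by positivity) ?_
    split_ifs
    exacts [(hvm _).1, hg0 t]
  have hpde : ∀ x ∈ Ω, ∀ t > 0, deriv (u x) t = lap (fun y => u y t) x
      + a x t * u x t ^ r * (∫ y in Ω, u y t ^ p) - b x t * u x t ^ q := by
    intro x hx t ht
    have hlap : lap (fun y => u y t) x = M * Real.exp (-lam * t) * lap (fun y => v (y, t)) x := by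
      rw [← lap_const_mul]
      refine lap_congr ?_
      filter_upwards [ho.mem_nhds hx] with y hy using huΩ y hy t
    rw [hlap, ha, huΩ x hx, hbq x t _ (hvm _).1,
      show u x = fun t => M * Real.exp (-lam * t) * v (x, t) from funext (huΩ x hx)]
    refine ((hexp t).mul (hvr x hx t ht).2).deriv.trans ?_
    ring
  have hbdry : ∀ x ∈ frontier Ω, ∀ t, u x t = ∫ y in Ω, k x y t * u y t ^ l := by
    intro x hx t
    have hxΩ : x ∉ Ω := by
      rw [ho.frontier_eq] at hx; exact hx.2
    have h1 : ∫ y in Ω, k x y t * u y t ^ l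
        = ∫ y in Ω, M * Real.exp (-lam * t) * (k₀ * M ^ (l - 1) * v (y, t) ^ l) := by
      refine setIntegral_congr_fun ho.measurableSet fun y hy => ?_
      rw [huΩ y hy, hkl x y t _ (hvm _).1]
    rw [h1, integral_const_mul, integral_const_mul]
    simp only [u, if_neg hxΩ]
    rfl
  have hinit : ∀ x ∈ Ω, u x 0 = u0 x := by
    intro x hx
    rw [huΩ x hx, hvi x hx, hv0Ω x hx]
    simp
  refine ⟨u, fun T _ => ⟨⟨hreg T, fun x _ t _ => hnn x t, fun x hx t ht => (hpde x hx t ht.1).le,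
    fun x hx t _ => (hbdry x hx t).le, fun x hx => (hinit x hx).le⟩,
    ⟨hreg T, fun x _ t _ => hnn x t, fun x hx t ht => (hpde x hx t ht.1).ge,
    fun x hx t _ => (hbdry x hx t).ge, fun x hx => (hinit x hx).ge⟩⟩⟩
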